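/- arXiv:math/0406491 — 2 statements merged into one kernel-verified Lean document; each statement's English description precedes it below -/
import Mathlib

section
/- There exists R > 0 such that for every E₀ ∈ ℂ with Re E₀ ≥ R and |Im E₀| ≤ 1, the following are equivalent: (i) Im ∫_{−1}^{1} √(E₀ − i·x²) dx = 0 (principal square root); (ii) there exist a sequence (hₙ) of positive real numbers tending to 0, a sequence (Eₙ) in ℂ tending to E₀, and for each n a nonzero twice continuously differentiable function uₙ : [−1,1] → ℂ with −hₙ²·uₙ″(x) + i·x²·uₙ(x) = Eₙ·uₙ(x) for all x ∈ [−1,1] and uₙ(−1) = uₙ(1) = 0. -/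
/-- `u`, with derivative `u'` and second derivative `u''` on `[-1,1]`, is a twice
continuously differentiable solution of the Dirichlet problem
`-h²u'' + W·u = E·u` on `[-1,1]`, `u(-1) = u(1) = 0`. -/
def IsDirichletSol (h : ℝ) (W : ℝ → ℂ) (E : ℂ) (u u' u'' : ℝ → ℂ) : Prop :=
  (∀ x ∈ Set.Icc (-1:ℝ) 1, HasDerivWithinAt u (u' x) (Set.Icc (-1:ℝ) 1) x) ∧
  (∀ x ∈ Set.Icc (-1:ℝ) 1, HasDerivWithinAt u' (u'' x) (Set.Icc (-1:ℝ) 1) x) ∧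
  ContinuousOn u'' (Set.Icc (-1:ℝ) 1) ∧
  (∀ x ∈ Set.Icc (-1:ℝ) 1, -(h:ℂ)^2 * u'' x + W x * u x = E * u x) ∧
  u (-1) = 0 ∧ u 1 = 0

/-! ### Entire solutions by power series -/

/-- The coefficients: `serC s h E` solves `(m+1)(4m+2s) b (m+1) = (i b (m-1) - E b m)/h²`. -/
noncomputable def serC (s : ℕ) (h : ℝ) (E : ℂ) : ℕ → ℂ
  | 0 => 1
  | 1 => -E / ((h:ℂ)^2 * (2 * s))
  | (m+2) => (Complex.I * serC s h E m - E * serC s h E (m+1)) /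
      ((h:ℂ)^2 * ((m+2) * (4 * (m+1) + 2 * s)))

lemma serC_bound (s : ℕ) (hs : 1 ≤ s) (h : ℝ) (hh : 0 < h) (E : ℂ) (ρ : ℝ) (hE : ‖E‖ ≤ ρ) :
    ∀ m, ‖serC s h E m‖ ≤ (1 + (1 + ρ) / h^2)^m / (m.factorial : ℝ) := by
  have hρ : 0 ≤ ρ := (norm_nonneg E).trans hE
  set K := 1 + (1 + ρ) / h^2 with hK
  have hK1 : 1 ≤ K := by rw [hK]; have : 0 ≤ (1+ρ)/h^2 := by positivity
                         linarith
  have hK0 : 0 < K := by linarith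
  have hKh : (1 + ρ) ≤ K * h^2 := by
    rw [hK, add_mul, div_mul_cancel₀ _ (by positivity)]; nlinarith [sq_nonneg h]
  have hs' : (1:ℝ) ≤ s := by exact_mod_cast hs
  have key : ∀ m, ‖serC s h E m‖ ≤ K^m / (m.factorial : ℝ) ∧
      ‖serC s h E (m+1)‖ ≤ K^(m+1) / ((m+1).factorial : ℝ) := by
    intro m
    induction m with
    | zero =>
      refine ⟨by simp [serC], ?_⟩
      have : ‖(h:ℂ)^2 * (2 * s)‖ = h^2 * (2 * s) := by
        simp
      simp only [serC, zero_add, pow_one, norm_div, norm_neg, this, Nat.factorial_one, Nat.cast_one, div_one]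
      rw [div_le_iff₀ (by positivity)]
      have h1 : K * h^2 ≤ K * h^2 * (2 * s) := le_mul_of_one_le_right (by positivity) (by linarith)
      nlinarith
    | succ m ih =>
      refine ⟨ih.2, ?_⟩
      have hn : ‖(h:ℂ)^2 * ((m+2) * (4 * (m+1) + 2 * s))‖ = h^2 * ((m+2) * (4 * (m+1) + 2 * s)) := by
        have : (h:ℂ)^2 * ((m+2) * (4 * (m+1) + 2 * s)) = ((h^2 * ((m+2) * (4 * (m+1) + 2 * s)) : ℝ) : ℂ) := by
          push_cast; ring
        rw [this, Complex.norm_real, Real.norm_of_nonneg (by positivity)]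
      rw [show m + 1 + 1 = m + 2 from rfl]
      simp only [serC, norm_div, hn]
      have hb : ‖Complex.I * serC s h E m - E * serC s h E (m+1)‖ ≤
          K^m / (m.factorial : ℝ) + ρ * (K^(m+1) / ((m+1).factorial : ℝ)) := by
        refine (norm_sub_le _ _).trans ?_
        rw [norm_mul, norm_mul, Complex.norm_I, one_mul]
        gcongr
        · exact ih.1
        · exact ih.2
      rw [div_le_iff₀ (by positivity)]
      refine hb.trans ?_
      have hf1 : ((m+1).factorial : ℝ) = (m+1) * m.factorial := by
        rw [Nat.factorial_succ]; push_cast; ring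
      have hf2 : ((m+2).factorial : ℝ) = (m+2) * ((m+1) * m.factorial) := by
        rw [Nat.factorial_succ, Nat.cast_mul, hf1]; push_cast; ring
      have hfp : (0:ℝ) < m.factorial := by positivity
      have hKm : 0 < K^m := by positivity
      rw [hf1, hf2]
      have e1 : K^m / (m.factorial : ℝ) + ρ * (K^(m+1) / ((m+1) * m.factorial)) =
        (K^m / ((m+1) * m.factorial)) * ((m+1) + ρ * K) := by
        field_simp
        ring
      have e2 : K ^ (m + 2) / ((m+2) * ((m+1) * m.factorial)) * (h^2 * ((m+2) * (4 * (m+1) + 2 * s)))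
        = (K^m / ((m+1) * m.factorial)) * (K * (K * h^2) * (4 * (m+1) + 2 * s)) := by
        field_simp
        ring
      rw [e1, e2]
      apply mul_le_mul_of_nonneg_left _ (by positivity)
      have hm : (0:ℝ) ≤ m := by positivity
      have h4 : (m:ℝ) + 1 ≤ 4 * (m+1) + 2 * s := by linarith
      calc (m:ℝ) + 1 + ρ * K ≤ K * (1 + ρ) * (m + 1) := by
              have : (m:ℝ) + 1 ≤ K * (m+1) := le_mul_of_one_le_left (by positivity) hK1
              have : ρ * K ≤ ρ * K * (m+1) := le_mul_of_one_le_right (by positivity) (by linarith)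
              nlinarith
        _ ≤ K * (K * h^2) * (4 * (m+1) + 2 * s) := by gcongr
  exact fun m => (key m).1

lemma serC_diff (s : ℕ) (h : ℝ) : ∀ m, Differentiable ℂ (fun E => serC s h E m) := by
  have key : ∀ m, Differentiable ℂ (fun E => serC s h E m) ∧
      Differentiable ℂ (fun E => serC s h E (m+1)) := by
    intro m
    induction m with
    | zero => 
      constructor
      · simp only [serC]; fun_prop
      · simp only [serC]; fun_prop
    | succ m ih =>
      refine ⟨ih.2, ?_⟩
      simp only [serC]
      exact ((ih.1.const_mul _).sub (differentiable_id.mul ih.2)).div_const _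
  exact fun m => (key m).1

lemma summable_aux (C K r : ℝ) : Summable (fun m : ℕ => C * (K^m / (m.factorial : ℝ)) * r^m) := by
  have := (Real.summable_pow_div_factorial (K * r)).mul_left C
  refine this.congr fun m => ?_
  rw [mul_pow]; ring

lemma term_bound (b : ℕ → ℂ) (C K : ℝ)
    (hb : ∀ m, ‖b m‖ ≤ C * (K^m / (m.factorial : ℝ))) (r : ℝ) (w : ℂ) (hw : ‖w‖ ≤ r) (m : ℕ) :
    ‖b m * w^m‖ ≤ C * (K^m / (m.factorial : ℝ)) * r^m := by
  rw [norm_mul, norm_pow]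
  have := (norm_nonneg (b m)).trans (hb m)
  gcongr
  exact hb m

lemma summable_ser (b : ℕ → ℂ) (C K : ℝ)
    (hb : ∀ m, ‖b m‖ ≤ C * (K^m / (m.factorial : ℝ))) (w : ℂ) :
    Summable (fun m => b m * w^m) :=
  Summable.of_norm_bounded (summable_aux C K ‖w‖) (fun m => term_bound b C K hb _ w le_rfl m)

lemma hasDerivAt_ser (b : ℕ → ℂ) (C K : ℝ)
    (hb : ∀ m, ‖b m‖ ≤ C * (K^m / (m.factorial : ℝ))) (w : ℂ) :
    HasDerivAt (fun w => ∑' m, b m * w^m) (∑' m : ℕ, ((m+1 : ℂ) * b (m+1)) * w^m) w := by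
  have hU : IsOpen (Metric.ball (0:ℂ) (‖w‖+1)) := Metric.isOpen_ball
  have hw : w ∈ Metric.ball (0:ℂ) (‖w‖+1) := by simp
  have hle : ∀ (i : ℕ) (z : ℂ), z ∈ Metric.ball (0:ℂ) (‖w‖+1) →
      ‖b i * z^i‖ ≤ C * (K^i / (i.factorial : ℝ)) * (‖w‖+1)^i := by
    intro i z hz
    exact term_bound b C K hb _ z (by simpa using (mem_ball_zero_iff.1 hz).le) i
  have hd : ∀ i : ℕ, DifferentiableOn ℂ (fun z : ℂ => b i * z^i) (Metric.ball (0:ℂ) (‖w‖+1)) := by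
    intro i; fun_prop
  have h1 := Complex.differentiableOn_tsum_of_summable_norm (summable_aux C K (‖w‖+1)) hd hU hle
  have h2 := Complex.hasSum_deriv_of_summable_norm (summable_aux C K (‖w‖+1)) hd hU hle hw
  have h3 := (h1.differentiableAt (hU.mem_nhds hw)).hasDerivAt
  have h4 : (fun i : ℕ => deriv (fun z : ℂ => b i * z^i) w) = fun i : ℕ => (i:ℂ) * b i * w^(i-1) := by
    funext i
    simp
    ring
  rw [h4] at h2
  have h5 := h2.tsum_eq
  rw [h2.summable.tsum_eq_zero_add] at h5
  rw [← h5] at h3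
  simpa using h3

lemma shift_bound (b : ℕ → ℂ) (C K : ℝ)
    (hb : ∀ m, ‖b m‖ ≤ C * (K^m / (m.factorial : ℝ))) (m : ℕ) :
    ‖(m+1 : ℂ) * b (m+1)‖ ≤ (C * K) * (K^m / (m.factorial : ℝ)) := by
  have h1 : ‖(m+1 : ℂ)‖ = (m:ℝ)+1 := by
    have : (m+1 : ℂ) = ((m+1 : ℕ) : ℂ) := by push_cast; rfl
    rw [this, Complex.norm_natCast]; push_cast; rfl
  rw [norm_mul, h1]
  have h2 := hb (m+1)
  rw [Nat.factorial_succ] at h2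
  calc ((m:ℝ)+1) * ‖b (m+1)‖ ≤ ((m:ℝ)+1) * (C * (K^(m+1) / (((m+1) * m.factorial : ℕ) : ℝ))) := by gcongr
    _ = _ := by push_cast; field_simp; ring

/-- For each `h, E`: entire `F` with `4wF'' + 2sF' = (iw-E)/h² F`, `F 0 = 1`, analytic in `E`. -/
noncomputable def serF (s : ℕ) (h : ℝ) (E w : ℂ) : ℂ := ∑' m, serC s h E m * w^m

lemma serF_diff (s : ℕ) (hs : 1 ≤ s) (h : ℝ) (hh : 0 < h) (w : ℂ) :
    Differentiable ℂ (fun E => serF s h E w) := by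
  intro E
  have hU : IsOpen (Metric.ball (0:ℂ) (‖E‖+1)) := Metric.isOpen_ball
  have hw : E ∈ Metric.ball (0:ℂ) (‖E‖+1) := by simp
  have h1 := Complex.differentiableOn_tsum_of_summable_norm
    (summable_aux 1 (1 + (1 + (‖E‖+1)) / h^2) (‖w‖))
    (F := fun m E => serC s h E m * w^m) (U := Metric.ball (0:ℂ) (‖E‖+1)) 
    (fun i => ((serC_diff s h i).mul_const _).differentiableOn) hU ?_
  · exact h1.differentiableAt (hU.mem_nhds hw)
  · intro i z hz
    apply term_bound (fun i => serC s h z i) _ _ _ _ w le_rfl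
    intro m
    rw [one_mul]
    exact serC_bound s hs h hh z _ (by simpa using (mem_ball_zero_iff.1 hz).le) m

lemma serF_ode (s : ℕ) (hs : 1 ≤ s) (h : ℝ) (hh : 0 < h) (E : ℂ) :
    ∃ F' F'' : ℂ → ℂ, (∀ w, HasDerivAt (serF s h E) (F' w) w) ∧
      (∀ w, HasDerivAt F' (F'' w) w) ∧
      (∀ w, (h:ℂ)^2 * (4 * w * F'' w + 2 * s * F' w) = (Complex.I * w - E) * serF s h E w) ∧
      serF s h E 0 = 1 := by
  set b := serC s h E with hbdef
  set K := (1 + (1 + ‖E‖) / h^2) with hK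
  have hb : ∀ m, ‖b m‖ ≤ 1 * (K^m / (m.factorial : ℝ)) := by
    intro m; rw [one_mul]; exact serC_bound s hs h hh E _ le_rfl m
  have hb1 := shift_bound b 1 K hb
  have hb2 := shift_bound (fun m : ℕ => (m+1 : ℂ) * b (m+1)) (1 * K) K hb1
  refine ⟨_, _, hasDerivAt_ser b 1 K hb, hasDerivAt_ser (fun m : ℕ => (m+1 : ℂ) * b (m+1)) (1*K) K hb1, ?_, ?_⟩
  · intro w
    have s0 := summable_ser b 1 K hb w
    have s1 := summable_ser _ _ K hb1 w
    have s2 := summable_ser _ _ K hb2 w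
    have hh1 : (h:ℂ) ≠ 0 := by exact_mod_cast hh.ne'
    have hsC : (s:ℂ) ≠ 0 := by
      have : s ≠ 0 := by omega
      exact_mod_cast this
    rw [serF, ← hbdef]
    have L1 : 4 * w * ∑' m : ℕ, ((m+1 : ℂ) * (((m+1 : ℕ)+1 : ℂ) * b (m+1+1))) * w^m
      = ∑' m : ℕ, 4 * ((m+1 : ℂ) * (((m+1 : ℕ)+1 : ℂ) * b (m+1+1))) * w^(m+1) := by
      rw [← tsum_mul_left]; congr 1; funext m; ring
    have L2 : 2 * (s:ℂ) * ∑' m : ℕ, ((m+1 : ℂ) * b (m+1)) * w^m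
      = 2 * s * b 1 + ∑' m : ℕ, 2 * s * (((m+1 : ℕ)+1 : ℂ) * b (m+1+1)) * w^(m+1) := by
      rw [s1.tsum_eq_zero_add, mul_add, ← tsum_mul_left]
      congr 1
      · simp
      · congr 1; funext m; ring
    have R1 : Complex.I * w * ∑' m : ℕ, b m * w^m = ∑' m : ℕ, Complex.I * b m * w^(m+1) := by
      rw [← tsum_mul_left]; congr 1; funext m; ring
    have R2 : E * ∑' m : ℕ, b m * w^m = E + ∑' m : ℕ, E * b (m+1) * w^(m+1) := by
      rw [s0.tsum_eq_zero_add, mul_add, ← tsum_mul_left]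
      congr 1
      · simp [hbdef, serC]
      · congr 1; funext m; ring
    have S1 : Summable (fun m : ℕ => 4 * ((m+1 : ℂ) * (((m+1 : ℕ)+1 : ℂ) * b (m+1+1))) * w^(m+1)) := by
      refine (s2.mul_left (4*w)).congr fun m => ?_
      ring
    have S2 : Summable (fun m : ℕ => 2 * s * (((m+1 : ℕ)+1 : ℂ) * b (m+1+1)) * w^(m+1)) := by
      have := ((summable_nat_add_iff 1).2 s1).mul_left (2 * (s:ℂ))
      refine this.congr fun m => ?_
      ring
    have S3 : Summable (fun m : ℕ => Complex.I * b m * w^(m+1)) := by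
      refine (s0.mul_left (Complex.I*w)).congr fun m => ?_
      ring
    have S4 : Summable (fun m : ℕ => E * b (m+1) * w^(m+1)) := by
      have := ((summable_nat_add_iff 1).2 s0).mul_left E
      refine this.congr fun m => ?_
      ring
    rw [L1, L2, sub_mul, R1, R2]
    have hb1' : (h:ℂ)^2 * (2 * s * b 1) = - E := by
      simp only [hbdef, serC]; field_simp
    have main : (h:ℂ)^2 * ((∑' m : ℕ, 4 * ((m+1 : ℂ) * (((m+1 : ℕ)+1 : ℂ) * b (m+1+1))) * w^(m+1)) + 
      ∑' m : ℕ, 2 * s * (((m+1 : ℕ)+1 : ℂ) * b (m+1+1)) * w^(m+1)) =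
      (∑' m : ℕ, Complex.I * b m * w^(m+1)) - ∑' m : ℕ, E * b (m+1) * w^(m+1) := by
      rw [← S1.tsum_add S2, ← S3.tsum_sub S4, ← tsum_mul_left]
      congr 1; funext m
      have hrec : b (m+1+1) = (Complex.I * b m - E * b (m+1)) / ((h:ℂ)^2 * ((m+2) * (4 * (m+1) + 2 * s))) := by
        simp only [hbdef, serC]
      rw [hrec]
      have hm2 : (m:ℂ) + 2 ≠ 0 := by exact_mod_cast (by omega : m + 2 ≠ 0)
      have hm3 : 4 * ((m:ℂ) + 1) + 2 * s ≠ 0 := by exact_mod_cast (by omega : 4 * (m + 1) + 2 * s ≠ 0)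
      push_cast
      field_simp
      ring
    linear_combination main + hb1'
  · rw [serF, tsum_eq_single 0]
    · simp [serC]
    · intro m hm; simp [hm]

/-! ### Fundamental system and the characteristic determinant -/

noncomputable def phiS (h : ℝ) (E z : ℂ) : ℂ := z * serF 3 h E (z^2)

noncomputable def psiS (h : ℝ) (E z : ℂ) : ℂ := serF 1 h E (z^2)

noncomputable def detS (h : ℝ) (E : ℂ) : ℂ :=
  phiS h E 1 * psiS h E (-1) - phiS h E (-1) * psiS h E 1

lemma detS_diff (h : ℝ) (hh : 0 < h) : Differentiable ℂ (detS h) := by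
  unfold detS phiS psiS
  have h1 := fun w => serF_diff 1 le_rfl h hh w
  have h3 := fun w => serF_diff 3 (by norm_num) h hh w
  exact (((h3 _).const_mul _).mul (h1 _)).sub (((h3 _).const_mul _).mul (h1 _))

lemma psiS_ode (h : ℝ) (hh : 0 < h) (E : ℂ) :
    ∃ ψ' : ℂ → ℂ, (∀ z, HasDerivAt (psiS h E) (ψ' z) z) ∧
      (∀ z, HasDerivAt ψ' ((Complex.I * z^2 - E) / (h:ℂ)^2 * psiS h E z) z) ∧
      psiS h E 0 = 1 ∧ ψ' 0 = 0 := by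
  obtain ⟨F', F'', h1, h2, h3, h4⟩ := serF_ode 1 le_rfl h hh E
  have hh1 : (h:ℂ) ≠ 0 := by exact_mod_cast hh.ne'
  have hsq : ∀ z : ℂ, HasDerivAt (fun z : ℂ => z^2) (2 * z) z := fun z => by
    simpa using hasDerivAt_pow 2 z
  refine ⟨fun z => F' (z^2) * (2 * z), fun z => ?_, fun z => ?_, by simp [psiS, h4], by simp⟩
  · exact (h1 (z^2)).comp z (hsq z)
  · have := ((h2 (z^2)).comp z (hsq z)).mul ((hasDerivAt_id z).const_mul 2)
    refine this.congr_deriv ?_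
    have h5 := h3 (z^2)
    simp only [psiS, Function.comp, id]
    rw [div_mul_eq_mul_div, ← h5]
    field_simp
    push_cast
    ring

lemma phiS_ode (h : ℝ) (hh : 0 < h) (E : ℂ) :
    ∃ φ' : ℂ → ℂ, (∀ z, HasDerivAt (phiS h E) (φ' z) z) ∧
      (∀ z, HasDerivAt φ' ((Complex.I * z^2 - E) / (h:ℂ)^2 * phiS h E z) z) ∧
      phiS h E 0 = 0 ∧ φ' 0 = 1 := by
  obtain ⟨F', F'', h1, h2, h3, h4⟩ := serF_ode 3 (by norm_num) h hh E
  have hh1 : (h:ℂ) ≠ 0 := by exact_mod_cast hh.ne'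
  have hsq : ∀ z : ℂ, HasDerivAt (fun z : ℂ => z^2) (2 * z) z := fun z => by
    simpa using hasDerivAt_pow 2 z
  refine ⟨fun z => serF 3 h E (z^2) + z * (F' (z^2) * (2 * z)), fun z => ?_, fun z => ?_,
    by simp [phiS], by simp [h4]⟩
  · have := (hasDerivAt_id z).mul ((h1 (z^2)).comp z (hsq z))
    refine this.congr_deriv ?_
    simp
  · have := ((h1 (z^2)).comp z (hsq z)).add
      ((hasDerivAt_id z).mul (((h2 (z^2)).comp z (hsq z)).mul ((hasDerivAt_id z).const_mul 2)))
    refine this.congr_deriv ?_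
    have h5 := h3 (z^2)
    simp only [phiS, Function.comp, id, Pi.mul_apply]
    have h6 : (Complex.I * z^2 - E) / (h:ℂ)^2 * (z * serF 3 h E (z^2)) =
        z * (4 * z^2 * F'' (z^2) + 2 * ((3:ℕ):ℂ) * F' (z^2)) := by
      rw [mul_left_comm, div_mul_eq_mul_div, ← h5]
      field_simp
    rw [h6]
    push_cast
    ring

lemma fund_sys (h : ℝ) (hh : 0 < h) (E : ℂ) :
    ∃ φ' ψ' : ℂ → ℂ, (∀ z, HasDerivAt (phiS h E) (φ' z) z) ∧
      (∀ z, HasDerivAt φ' ((Complex.I * z^2 - E) / (h:ℂ)^2 * phiS h E z) z) ∧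
      (∀ z, HasDerivAt (psiS h E) (ψ' z) z) ∧
      (∀ z, HasDerivAt ψ' ((Complex.I * z^2 - E) / (h:ℂ)^2 * psiS h E z) z) ∧
      ∀ z, φ' z * psiS h E z - phiS h E z * ψ' z = 1 := by
  obtain ⟨ψ', a1, a2, a3, a4⟩ := psiS_ode h hh E
  obtain ⟨φ', b1, b2, b3, b4⟩ := phiS_ode h hh E
  refine ⟨φ', ψ', b1, b2, a1, a2, fun z => ?_⟩
  have hd : ∀ z, HasDerivAt (fun z => φ' z * psiS h E z - phiS h E z * ψ' z) 0 z := by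
    intro z
    refine (((b2 z).mul (a1 z)).sub ((b1 z).mul (a2 z))).congr_deriv ?_
    ring
  have := is_const_of_deriv_eq_zero (fun z => (hd z).differentiableAt) (fun z => (hd z).deriv) z 0
  rw [this, a3, a4, b3, b4]; ring

/-- The solution with data `U(-1) = 0`, `U'(-1) = 1`. -/
lemma exists_U (h : ℝ) (hh : 0 < h) (E : ℂ) :
    ∃ U U' : ℂ → ℂ, (∀ z, HasDerivAt U (U' z) z) ∧
      (∀ z, HasDerivAt U' ((Complex.I * z^2 - E) / (h:ℂ)^2 * U z) z) ∧
      U (-1) = 0 ∧ U' (-1) = 1 ∧ U 1 = detS h E := by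
  obtain ⟨φ', ψ', b1, b2, a1, a2, w⟩ := fund_sys h hh E
  refine ⟨fun z => phiS h E z * psiS h E (-1) - phiS h E (-1) * psiS h E z,
    fun z => φ' z * psiS h E (-1) - phiS h E (-1) * ψ' z, fun z => ?_, fun z => ?_, ?_, ?_, rfl⟩
  · exact ((b1 z).mul_const _).sub ((a1 z).const_mul _)
  · refine (((b2 z).mul_const _).sub ((a2 z).const_mul _)).congr_deriv ?_
    ring
  · ring
  · exact w (-1)

lemma eigen_of_det (h : ℝ) (hh : 0 < h) (E : ℂ) (hD : detS h E = 0) :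
    ∃ u u' u'' : ℝ → ℂ,
      IsDirichletSol h (fun x : ℝ => Complex.I * (x : ℂ) ^ 2) E u u' u'' ∧
      ∃ x ∈ Set.Icc (-1:ℝ) 1, u x ≠ 0 := by
  obtain ⟨U, U', d1, d2, e1, e2, e3⟩ := exists_U h hh E
  have hh1 : (h:ℂ) ≠ 0 := by exact_mod_cast hh.ne'
  have hUc : Continuous U := continuous_iff_continuousAt.2 fun z => (d1 z).continuousAt
  refine ⟨fun x => U x, fun x => U' x, fun x => (Complex.I * (x:ℂ)^2 - E) / (h:ℂ)^2 * U x,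
    ⟨fun x _ => (d1 x).comp_ofReal.hasDerivWithinAt, fun x _ => (d2 x).comp_ofReal.hasDerivWithinAt,
      ?_, ?_, ?_, ?_⟩, ?_⟩
  · apply Continuous.continuousOn
    fun_prop
  · intro x _
    field_simp
    ring
  · simpa using e1
  · simp [e3, hD]
  · by_contra! hcon
    have hm : (-1:ℝ) ∈ Set.Icc (-1:ℝ) 1 := by simp
    have k1 : HasDerivWithinAt (fun x : ℝ => U x) (U' ((-1:ℝ):ℂ)) (Set.Icc (-1:ℝ) 1) (-1) :=
      (d1 ((-1:ℝ):ℂ)).comp_ofReal.hasDerivWithinAt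
    have k2 : HasDerivWithinAt (fun x : ℝ => U x) 0 (Set.Icc (-1:ℝ) 1) (-1) :=
      (hasDerivWithinAt_const (-1:ℝ) (Set.Icc (-1:ℝ) 1) (0:ℂ)).congr (fun x hx => hcon x hx) (hcon _ hm)
    have := ((uniqueDiffOn_Icc (by norm_num : (-1:ℝ) < 1)) (-1) hm).eq_deriv _ k1 k2
    rw [Complex.ofReal_neg, Complex.ofReal_one, e2] at this
    exact one_ne_zero this

lemma const_of_deriv_zero (f : ℝ → ℂ)
    (hf : ∀ x ∈ Set.Icc (-1:ℝ) 1, HasDerivWithinAt f 0 (Set.Icc (-1:ℝ) 1) x) :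
    ∀ x ∈ Set.Icc (-1:ℝ) 1, f x = f (-1) := by
  intro x hx
  have := norm_image_sub_le_of_norm_deriv_le_segment' (f' := fun _ => 0) (C := 0) hf (by simp) x hx
  rw [zero_mul] at this
  exact sub_eq_zero.1 (norm_le_zero_iff.1 this)

lemma det_of_eigen (h : ℝ) (hh : 0 < h) (E : ℂ) (u u' u'' : ℝ → ℂ)
    (hu : IsDirichletSol h (fun x : ℝ => Complex.I * (x : ℂ) ^ 2) E u u' u'')
    (hne : ∃ x ∈ Set.Icc (-1:ℝ) 1, u x ≠ 0) : detS h E = 0 := by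
  obtain ⟨φ', ψ', b1, b2, a1, a2, w⟩ := fund_sys h hh E
  obtain ⟨u1, u2, -, u4, u5, u6⟩ := hu
  have hh1 : (h:ℂ) ≠ 0 := by exact_mod_cast hh.ne'
  have u4' : ∀ x ∈ Set.Icc (-1:ℝ) 1, u'' x = (Complex.I * (x:ℂ)^2 - E) / (h:ℂ)^2 * u x := by
    intro x hx
    have := u4 x hx
    field_simp
    linear_combination -this
  have hα := const_of_deriv_zero (fun x => u' x * psiS h E x - u x * ψ' x) (fun x hx => by
    refine (((u2 x hx).mul (a1 x).comp_ofReal.hasDerivWithinAt).sub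
      ((u1 x hx).mul (a2 x).comp_ofReal.hasDerivWithinAt)).congr_deriv ?_
    rw [u4' x hx]; ring)
  have hβ := const_of_deriv_zero (fun x => φ' x * u x - phiS h E x * u' x) (fun x hx => by
    refine (((b2 x).comp_ofReal.hasDerivWithinAt.mul (u1 x hx)).sub
      ((b1 x).comp_ofReal.hasDerivWithinAt.mul (u2 x hx))).congr_deriv ?_
    rw [u4' x hx]; ring)
  set α := (fun x : ℝ => u' x * psiS h E x - u x * ψ' x) (-1) with hαdef
  set β := (fun x : ℝ => φ' x * u x - phiS h E x * u' x) (-1) with hβdef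
  have hrep : ∀ x ∈ Set.Icc (-1:ℝ) 1, u x = β * psiS h E x + α * phiS h E x := by
    intro x hx
    have hα' : u' x * psiS h E x - u x * ψ' x = α := hα x hx
    have hβ' : φ' x * u x - phiS h E x * u' x = β := hβ x hx
    rw [← hα', ← hβ']
    linear_combination (-(u x)) * w x
  have hm1 := hrep (-1) (by simp)
  have hp1 := hrep 1 (by simp)
  rw [u5] at hm1
  rw [u6] at hp1
  push_cast at hm1 hp1
  have q1 : α * detS h E = 0 := by
    unfold detS
    linear_combination psiS h E 1 * hm1 - psiS h E (-1) * hp1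
  have q2 : β * detS h E = 0 := by
    unfold detS
    linear_combination phiS h E (-1) * hp1 - phiS h E 1 * hm1
  by_contra hD
  have qα : α = 0 := (mul_eq_zero.1 q1).resolve_right hD
  have qβ : β = 0 := (mul_eq_zero.1 q2).resolve_right hD
  obtain ⟨x, hx, hux⟩ := hne
  exact hux (by rw [hrep x hx, qα, qβ]; ring)

/-! ### Perturbed harmonic oscillation on `[0,1]` -/

lemma osc_aux (lam : ℂ) (v0 v1 ρ : ℝ → ℂ)
    (h0 : ∀ t ∈ Set.Icc (0:ℝ) 1, HasDerivWithinAt v0 (v1 t) (Set.Icc (0:ℝ) 1) t)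
    (h1 : ∀ t ∈ Set.Icc (0:ℝ) 1,
      HasDerivWithinAt v1 (-lam^2 * v0 t + ρ t * v0 t) (Set.Icc (0:ℝ) 1) t)
    (hρ : ∀ t ∈ Set.Icc (0:ℝ) 1, ‖ρ t‖ ≤ 1) (hv : v0 0 = 0) (hl : 2 ≤ ‖lam‖)
    (him : 0 ≤ lam.im) :
    ‖lam * v0 1 - v1 0 * Complex.sin lam‖ ≤ 2 * ‖v1 0‖ * Real.exp lam.im / ‖lam‖ := by
  set σ := lam.im with hσ
  set c := v1 0 with hc
  have nexp : ∀ t : ℝ, ‖Complex.exp (Complex.I * lam * t)‖ = Real.exp (-(σ * t)) := by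
    intro t; rw [Complex.norm_exp]; congr 1; simp [hσ]
  have nexp' : ∀ t : ℝ, ‖Complex.exp (-(Complex.I * lam * t))‖ = Real.exp (σ * t) := by
    intro t; rw [Complex.norm_exp]; congr 1; simp [hσ]
  have hcont : ContinuousOn (fun t => Real.exp (-(σ * t)) * ‖v0 t‖) (Set.Icc (0:ℝ) 1) := by
    apply ContinuousOn.mul
    · exact (by fun_prop : Continuous fun t : ℝ => Real.exp (-(σ * t))).continuousOn
    · exact ContinuousOn.norm fun t ht => (h0 t ht).continuousWithinAt
  obtain ⟨t0, ht0, hmax⟩ := isCompact_Icc.exists_isMaxOn (Set.nonempty_Icc.2 zero_le_one) hcont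
  set M := Real.exp (-(σ * t0)) * ‖v0 t0‖ with hM
  have hM0 : 0 ≤ M := by positivity
  have hvb : ∀ t ∈ Set.Icc (0:ℝ) 1, ‖v0 t‖ ≤ M * Real.exp (σ * t) := by
    intro t ht
    have h2 : Real.exp (-(σ * t)) * ‖v0 t‖ ≤ M := hmax ht
    calc ‖v0 t‖ = (Real.exp (-(σ * t)) * ‖v0 t‖) * Real.exp (σ * t) := by
          rw [mul_right_comm, ← Real.exp_add]; simp
      _ ≤ _ := by gcongr
  have dexp : ∀ (t : ℝ) (s : Set ℝ), HasDerivWithinAt (fun t : ℝ => Complex.exp (Complex.I * lam * t))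
      (Complex.exp (Complex.I * lam * t) * (Complex.I * lam)) s t := by
    intro t s
    have : HasDerivAt (fun z : ℂ => Complex.exp (Complex.I * lam * z))
      (Complex.exp (Complex.I * lam * t) * (Complex.I * lam)) (t:ℂ) := by
      have := ((hasDerivAt_id (t:ℂ)).const_mul (Complex.I * lam)).cexp
      simpa using this
    exact this.comp_ofReal.hasDerivWithinAt
  have dexp' : ∀ (t : ℝ) (s : Set ℝ), HasDerivWithinAt (fun t : ℝ => Complex.exp (-(Complex.I * lam * t)))
      (Complex.exp (-(Complex.I * lam * t)) * (-(Complex.I * lam))) s t := by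
    intro t s
    have : HasDerivAt (fun z : ℂ => Complex.exp (-(Complex.I * lam * z)))
      (Complex.exp (-(Complex.I * lam * t)) * (-(Complex.I * lam))) (t:ℂ) := by
      have := (((hasDerivAt_id (t:ℂ)).const_mul (Complex.I * lam)).neg).cexp
      simpa using this
    exact this.comp_ofReal.hasDerivWithinAt
  set A : ℝ → ℂ := fun t => Complex.exp (Complex.I * lam * t) * (v1 t - Complex.I * lam * v0 t) with hA
  set B : ℝ → ℂ := fun t => Complex.exp (-(Complex.I * lam * t)) * (v1 t + Complex.I * lam * v0 t) with hB
  have dA : ∀ t ∈ Set.Icc (0:ℝ) 1, HasDerivWithinAt A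
      (Complex.exp (Complex.I * lam * t) * (ρ t * v0 t)) (Set.Icc (0:ℝ) 1) t := by
    intro t ht
    refine ((dexp t _).mul ((h1 t ht).sub ((h0 t ht).const_mul (Complex.I * lam)))).congr_deriv ?_
    simp only [Pi.sub_apply]
    linear_combination (-(Complex.exp (Complex.I * lam * t) * lam^2 * v0 t)) * Complex.I_sq
  have dB : ∀ t ∈ Set.Icc (0:ℝ) 1, HasDerivWithinAt B
      (Complex.exp (-(Complex.I * lam * t)) * (ρ t * v0 t)) (Set.Icc (0:ℝ) 1) t := by
    intro t ht
    refine ((dexp' t _).mul ((h1 t ht).add ((h0 t ht).const_mul (Complex.I * lam)))).congr_deriv ?_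
    simp only [Pi.add_apply]
    linear_combination (-(Complex.exp (-(Complex.I * lam * t)) * lam^2 * v0 t)) * Complex.I_sq
  have hA0 : A 0 = c := by simp [hA, hv, hc]
  have hB0 : B 0 = c := by simp [hB, hv, hc]
  have hρv : ∀ t ∈ Set.Icc (0:ℝ) 1, ‖ρ t * v0 t‖ ≤ M * Real.exp (σ * t) := by
    intro t ht
    rw [norm_mul]
    calc ‖ρ t‖ * ‖v0 t‖ ≤ 1 * ‖v0 t‖ := by gcongr; exact hρ t ht
      _ ≤ _ := by rw [one_mul]; exact hvb t ht
  have bA : ∀ t ∈ Set.Icc (0:ℝ) 1, ‖A t - c‖ ≤ M := by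
    intro t ht
    have := norm_image_sub_le_of_norm_deriv_le_segment' (C := M) dA ?_ t ht
    · rw [hA0, sub_zero] at this
      exact this.trans (mul_le_of_le_one_right hM0 ht.2)
    · intro x hx
      rw [norm_mul, nexp]
      calc Real.exp (-(σ * x)) * ‖ρ x * v0 x‖ ≤ Real.exp (-(σ * x)) * (M * Real.exp (σ * x)) := by
            gcongr; exact hρv x ⟨hx.1, hx.2.le⟩
        _ = M := by rw [mul_left_comm, ← Real.exp_add]; simp
  have bB : ∀ t ∈ Set.Icc (0:ℝ) 1, ‖B t - c‖ ≤ M * Real.exp (2 * (σ * t)) := by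
    intro t ht
    have hsub : Set.Icc (0:ℝ) t ⊆ Set.Icc 0 1 := Set.Icc_subset_Icc_right ht.2
    have := norm_image_sub_le_of_norm_deriv_le_segment' (C := M * Real.exp (2 * (σ * t)))
      (fun x hx => (dB x (hsub hx)).mono hsub) ?_ t ⟨ht.1, le_rfl⟩
    · rw [hB0, sub_zero] at this
      exact this.trans (mul_le_of_le_one_right (by positivity) ht.2)
    · intro x hx
      rw [norm_mul, nexp']
      calc Real.exp (σ * x) * ‖ρ x * v0 x‖ ≤ Real.exp (σ * x) * (M * Real.exp (σ * x)) := by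
            gcongr; exact hρv x (hsub ⟨hx.1, hx.2.le⟩)
        _ = M * Real.exp (2 * (σ * x)) := by rw [mul_left_comm, ← Real.exp_add]; ring_nf
        _ ≤ _ := by gcongr; exact hx.2.le
  have star : ∀ t ∈ Set.Icc (0:ℝ) 1,
      ‖lam * v0 t - c * Complex.sin (lam * t)‖ ≤ M * Real.exp (σ * t) := by
    intro t ht
    have e0 : Complex.exp (Complex.I * lam * t) * Complex.exp (-(Complex.I * lam * t)) = 1 := by
      rw [← Complex.exp_add]; simp
    have e1 : lam * v0 t - c * Complex.sin (lam * t) =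
        (-Complex.I / 2) * (Complex.exp (Complex.I * lam * t) * (B t - c)
          - Complex.exp (-(Complex.I * lam * t)) * (A t - c)) := by
      have e2 : Complex.sin (lam * t) = (Complex.exp (-(Complex.I * lam * t))
        - Complex.exp (Complex.I * lam * t)) * Complex.I / 2 := by
        rw [Complex.sin]; congr 4 <;> ring_nf
      rw [e2, hA, hB]
      simp only
      linear_combination (Complex.I^2 * lam * v0 t) * e0 + lam * v0 t * Complex.I_sq
    rw [e1, norm_mul]
    have e3 : ‖-Complex.I / 2‖ = 1/2 := by simp
    have e4 : ‖Complex.exp (Complex.I * lam * t) * (B t - c)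
          - Complex.exp (-(Complex.I * lam * t)) * (A t - c)‖ ≤ 2 * (M * Real.exp (σ * t)) := by
      refine (norm_sub_le _ _).trans ?_
      rw [norm_mul, norm_mul, nexp, nexp']
      have f1 := mul_le_mul_of_nonneg_left (bB t ht) (Real.exp_pos (-(σ * t))).le
      have f2 := mul_le_mul_of_nonneg_left (bA t ht) (Real.exp_pos (σ * t)).le
      have f3 : Real.exp (-(σ * t)) * (M * Real.exp (2 * (σ * t))) = M * Real.exp (σ * t) := by
        rw [mul_left_comm, ← Real.exp_add]; ring_nf
      linarith
    rw [e3]; linarith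
  have hsin : ∀ t ∈ Set.Icc (0:ℝ) 1, ‖Complex.sin (lam * t)‖ ≤ Real.exp (σ * t) := by
    intro t ht
    have e2 : Complex.sin (lam * t) = (Complex.I / 2) * (Complex.exp (-(Complex.I * lam * t))
        - Complex.exp (Complex.I * lam * t)) := by
        rw [Complex.sin, mul_comm (Complex.I/2), mul_div_assoc]; congr 3 <;> ring_nf
    rw [e2, norm_mul]
    have e3 : ‖Complex.I / 2‖ = 1/2 := by simp
    have e4 := norm_sub_le (Complex.exp (-(Complex.I * lam * t))) (Complex.exp (Complex.I * lam * t))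
    rw [nexp, nexp'] at e4
    have e5 : Real.exp (-(σ * t)) ≤ Real.exp (σ * t) := by
      apply Real.exp_le_exp.2
      have := mul_nonneg him ht.1
      linarith
    rw [e3]; linarith
  have hMb : ‖lam‖ * M ≤ 2 * ‖c‖ := by
    have s1 := star t0 ht0
    have s2 := hsin t0 ht0
    have s3 : ‖lam * v0 t0‖ ≤ (M + ‖c‖) * Real.exp (σ * t0) := by
      have := norm_add_le (lam * v0 t0 - c * Complex.sin (lam * t0)) (c * Complex.sin (lam * t0))
      rw [sub_add_cancel, norm_mul c] at this
      have := mul_le_mul_of_nonneg_left s2 (norm_nonneg c)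
      linarith
    have s4 : ‖lam‖ * M ≤ M + ‖c‖ := by
      have s5 : ‖lam‖ * M = Real.exp (-(σ * t0)) * ‖lam * v0 t0‖ := by rw [hM, norm_mul]; ring
      rw [s5]
      calc _ ≤ Real.exp (-(σ * t0)) * ((M + ‖c‖) * Real.exp (σ * t0)) := by gcongr
        _ = _ := by rw [mul_left_comm, ← Real.exp_add]; simp
    nlinarith
  have fin := star 1 (by simp)
  simp only [Complex.ofReal_one, mul_one] at fin
  refine fin.trans ?_
  rw [le_div_iff₀ (by linarith)]
  have := mul_le_mul_of_nonneg_right hMb (Real.exp_pos σ).le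
  linarith

lemma osc (lam : ℂ) (v0 v1 ρ : ℝ → ℂ)
    (h0 : ∀ t ∈ Set.Icc (0:ℝ) 1, HasDerivWithinAt v0 (v1 t) (Set.Icc (0:ℝ) 1) t)
    (h1 : ∀ t ∈ Set.Icc (0:ℝ) 1,
      HasDerivWithinAt v1 (-lam^2 * v0 t + ρ t * v0 t) (Set.Icc (0:ℝ) 1) t)
    (hρ : ∀ t ∈ Set.Icc (0:ℝ) 1, ‖ρ t‖ ≤ 1) (hv : v0 0 = 0) (hl : 2 ≤ ‖lam‖) :
    ‖lam * v0 1 - v1 0 * Complex.sin lam‖ ≤ 2 * ‖v1 0‖ * Real.exp |lam.im| / ‖lam‖ := by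
  rcases le_total 0 lam.im with him | him
  · rw [abs_of_nonneg him]
    exact osc_aux lam v0 v1 ρ h0 h1 hρ hv hl him
  · have := osc_aux (-lam) v0 v1 ρ h0 (by simpa using h1) hρ hv (by simpa using hl) (by simpa using him)
    rw [abs_of_nonpos him]
    rw [Complex.sin_neg, norm_neg, Complex.neg_im] at this
    rw [← norm_neg]
    have e : -(lam * v0 1 - v1 0 * Complex.sin lam) = -lam * v0 1 - v1 0 * -Complex.sin lam := by ring
    rw [e]
    exact this

/-! ### Part 3: the square root, the Liouville–Green path, and the key estimate -/

noncomputable def qS (E z : ℂ) : ℂ := E - Complex.I * z ^ 2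
noncomputable def pS (E z : ℂ) : ℂ := (E - Complex.I * z ^ 2) ^ (1/2 : ℂ)
noncomputable def gS (E z : ℂ) : ℂ := (E - Complex.I * z ^ 2) ^ (-1/4 : ℂ)
noncomputable def Lint (E : ℂ) : ℂ := ∫ x in (-1:ℝ)..1, pS E x

lemma qS_sub_norm (z : ℂ) : ‖Complex.I * z ^ 2‖ = ‖z‖ ^ 2 := by
  simp

lemma qS_re {E z : ℂ} (hE : 1000 ≤ E.re) (hz : ‖z‖ ≤ 5) : 975 ≤ (qS E z).re := by
  have h1 : |(Complex.I * z ^ 2).re| ≤ 25 := by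
    refine (Complex.abs_re_le_norm _).trans ?_
    rw [qS_sub_norm]
    nlinarith [norm_nonneg z]
  have h2 := (abs_le.mp h1).2
  simp only [qS, Complex.sub_re]
  linarith

lemma qS_slit {E z : ℂ} (hE : 1000 ≤ E.re) (hz : ‖z‖ ≤ 5) : qS E z ∈ Complex.slitPlane := by
  left
  have := qS_re hE hz
  linarith

lemma qS_ne {E z : ℂ} (hE : 1000 ≤ E.re) (hz : ‖z‖ ≤ 5) : qS E z ≠ 0 :=
  Complex.slitPlane_ne_zero (qS_slit hE hz)

lemma qS_norm {E z : ℂ} (hE : 1000 ≤ E.re) (hz : ‖z‖ ≤ 5) : 975 ≤ ‖qS E z‖ :=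
  (qS_re hE hz).trans ((le_abs_self _).trans (Complex.abs_re_le_norm _))

lemma qS_norm_ge {E z : ℂ} (hz : ‖z‖ ≤ 5) : ‖E‖ - 25 ≤ ‖qS E z‖ := by
  have h1 := norm_sub_norm_le E (Complex.I * z ^ 2)
  rw [qS_sub_norm] at h1
  simp only [qS]
  nlinarith [norm_nonneg z]

lemma E_norm {E : ℂ} (hE : 1000 ≤ E.re) : 1000 ≤ ‖E‖ :=
  hE.trans ((le_abs_self _).trans (Complex.abs_re_le_norm _))

lemma pS_sq (E z : ℂ) : pS E z ^ 2 = qS E z := by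
  have := Complex.cpow_ofNat_inv_pow (qS E z) 2
  simp only [pS, qS, one_div] at *
  exact this

lemma pS_ne {E z : ℂ} (hE : 1000 ≤ E.re) (hz : ‖z‖ ≤ 5) : pS E z ≠ 0 := by
  intro h
  have := pS_sq E z
  rw [h] at this
  exact qS_ne hE hz (by rw [← this]; ring)

lemma pS_norm_sq (E z : ℂ) : ‖pS E z‖ ^ 2 = ‖qS E z‖ := by
  rw [← norm_pow, pS_sq]

lemma pS_re {E z : ℂ} (hE : 1000 ≤ E.re) (hz : ‖z‖ ≤ 5) : 1 ≤ (pS E z).re := by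
  have h := Complex.cpow_inv_two_re (qS E z)
  have h1 := qS_re hE hz
  have h2 := qS_norm hE hz
  simp only [pS, qS, one_div] at *
  rw [h]
  apply Real.le_sqrt_of_sq_le
  linarith

lemma qS_deriv (E z : ℂ) : HasDerivAt (qS E) (-2 * Complex.I * z) z := by
  have h := (((hasDerivAt_id z).pow 2).const_mul Complex.I).const_sub E
  refine h.congr_deriv ?_
  simp only [id]
  ring_nf

lemma pS_deriv {E z : ℂ} (hE : 1000 ≤ E.re) (hz : ‖z‖ ≤ 5) :
    HasDerivAt (pS E) (-Complex.I * z / pS E z) z := by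
  have h := (qS_deriv E z).cpow_const (c := (1/2 : ℂ)) (qS_slit hE hz)
  refine h.congr_deriv ?_
  rw [Complex.cpow_sub _ _ (qS_ne hE hz), Complex.cpow_one]
  change 1 / 2 * (pS E z / qS E z) * _ = _
  rw [← pS_sq]
  field_simp [pS_ne hE hz]

lemma gS_ne {E z : ℂ} (hE : 1000 ≤ E.re) (hz : ‖z‖ ≤ 5) : gS E z ≠ 0 := by
  have := qS_ne hE hz
  simp only [gS]
  rw [Ne, Complex.cpow_eq_zero_iff]
  intro h
  exact this h.1

lemma gS_sq {E z : ℂ} (hE : 1000 ≤ E.re) (hz : ‖z‖ ≤ 5) : gS E z ^ 2 * pS E z = 1 := by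
  have h := qS_ne hE hz
  simp only [gS, pS]
  change (qS E z ^ (-1/4:ℂ)) ^ 2 * qS E z ^ (1/2:ℂ) = 1
  rw [sq, ← Complex.cpow_add _ _ h, ← Complex.cpow_add _ _ h]
  norm_num

noncomputable def gS' (E z : ℂ) : ℂ := Complex.I * z / 2 * gS E z / qS E z

lemma gS_deriv {E z : ℂ} (hE : 1000 ≤ E.re) (hz : ‖z‖ ≤ 5) :
    HasDerivAt (gS E) (gS' E z) z := by
  have h := (qS_deriv E z).cpow_const (c := (-1/4 : ℂ)) (qS_slit hE hz)
  refine h.congr_deriv ?_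
  rw [Complex.cpow_sub _ _ (qS_ne hE hz), Complex.cpow_one]
  change -1 / 4 * (gS E z / qS E z) * _ = _
  simp only [gS']
  ring

lemma gS_deriv2 {E z : ℂ} (hE : 1000 ≤ E.re) (hz : ‖z‖ ≤ 5) :
    HasDerivAt (gS' E)
      (gS E z * ((Complex.I / 2) / qS E z - (5/4) * z ^ 2 / qS E z ^ 2)) z := by
  have h := ((((hasDerivAt_id z).const_mul Complex.I).div_const 2).mul (gS_deriv hE hz)).div
    (qS_deriv E z) (qS_ne hE hz)
  refine h.congr_deriv ?_
  have hq := qS_ne hE hz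
  simp only [gS', id, Pi.mul_apply]
  field_simp
  ring_nf
  simp only [Complex.I_sq]
  ring

lemma pS_continuousOn {E : ℂ} (hE : 1000 ≤ E.re) : 
    ContinuousOn (fun x : ℝ => pS E x) (Set.uIcc (-1:ℝ) 1) := by
  intro x hx
  rw [Set.uIcc_of_le (by norm_num)] at hx
  have : ‖(x:ℂ)‖ ≤ 5 := by
    rw [Complex.norm_real, Real.norm_eq_abs, abs_le]; constructor <;> linarith [hx.1, hx.2]
  exact ((pS_deriv hE this).continuousAt.comp
    Complex.continuous_ofReal.continuousAt).continuousWithinAt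

lemma real_norm_le {x : ℝ} (hx : x ∈ Set.Icc (-1:ℝ) 1) : ‖(x:ℂ)‖ ≤ 1 := by
  rw [Complex.norm_real, Real.norm_eq_abs, abs_le]; exact hx

lemma Lint_re {E : ℂ} (hE : 1000 ≤ E.re) : 2 ≤ (Lint E).re := by
  have hi : IntervalIntegrable (fun x : ℝ => pS E x) MeasureTheory.volume (-1) 1 :=
    (pS_continuousOn hE).intervalIntegrable
  have h1 : (Lint E).re = ∫ x in (-1:ℝ)..1, (pS E x).re := by
    have := Complex.reCLM.intervalIntegral_comp_comm hi
    simp only [Complex.reCLM_apply] at this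
    exact this.symm
  rw [h1]
  have h2 : (∫ x in (-1:ℝ)..1, (1:ℝ)) ≤ ∫ x in (-1:ℝ)..1, (pS E x).re := by
    apply intervalIntegral.integral_mono_on (by norm_num) (by simp)
    · exact (Complex.continuous_re.comp_continuousOn (pS_continuousOn hE)).intervalIntegrable
    · intro x hx
      exact pS_re hE ((real_norm_le hx).trans (by norm_num))
  norm_num at h2 ⊢
  linarith

lemma Lint_norm_ge {E : ℂ} (hE : 1000 ≤ E.re) : 2 ≤ ‖Lint E‖ :=
  (Lint_re hE).trans ((le_abs_self _).trans (Complex.abs_re_le_norm _))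

lemma pS_norm_le {E : ℂ} {x : ℝ} (hx : x ∈ Set.Icc (-1:ℝ) 1) :
    ‖pS E x‖ ≤ Real.sqrt (‖E‖ + 1) := by
  apply Real.le_sqrt_of_sq_le
  rw [pS_norm_sq]
  have h1 := norm_sub_le E (Complex.I * (x:ℂ) ^ 2)
  rw [qS_sub_norm] at h1
  have := real_norm_le hx
  simp only [qS]
  nlinarith [norm_nonneg (x:ℂ)]

lemma Lint_norm_le (E : ℂ) : ‖Lint E‖ ^ 2 ≤ 4 * (‖E‖ + 1) := by
  have h : ‖Lint E‖ ≤ Real.sqrt (‖E‖ + 1) * |1 - (-1)| := by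
    apply intervalIntegral.norm_integral_le_of_norm_le_const
    intro x hx
    rw [Set.uIoc_of_le (by norm_num)] at hx
    exact pS_norm_le ⟨hx.1.le, hx.2⟩
  have h2 : |(1:ℝ) - (-1)| = 2 := by norm_num
  rw [h2] at h
  have h3 := Real.sq_sqrt (show 0 ≤ ‖E‖ + 1 by positivity)
  nlinarith [norm_nonneg (Lint E), Real.sqrt_nonneg (‖E‖ + 1)]

lemma Lint_le_q {E z : ℂ} (hE : 1000 ≤ E.re) (hz : ‖z‖ ≤ 5) : 
    ‖Lint E‖ ^ 2 ≤ 9 * ‖qS E z‖ := by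
  have h1 := Lint_norm_le E
  have h2 := qS_norm_ge (E := E) hz
  have h3 := E_norm hE
  linarith

lemma Lint_div_p {E z : ℂ} (hE : 1000 ≤ E.re) (hz : ‖z‖ ≤ 5) : 
    ‖Lint E / pS E z‖ ≤ 3 := by
  have h1 := Lint_le_q hE hz
  rw [← pS_norm_sq] at h1
  have hp : 0 < ‖pS E z‖ := norm_pos_iff.mpr (pS_ne hE hz)
  rw [norm_div, div_le_iff₀ hp]
  nlinarith [norm_nonneg (Lint E)]

lemma norm_le_four {z : ℂ} (hz : z ∈ Metric.closedBall (-1:ℂ) 3) : ‖z‖ ≤ 4 := by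
  rw [mem_closedBall_iff_norm] at hz
  have h := norm_sub_le (z - (-1)) 1
  simp only [norm_one] at h
  have e : z - (-1) - 1 = z := by ring
  rw [e] at h
  linarith

lemma field_lip {E : ℂ} (hE : 1000 ≤ E.re) :
    ∃ K : NNReal, LipschitzOnWith K (fun z => Lint E / pS E z) (Metric.closedBall (-1:ℂ) 3) := by
  refine ⟨‖Lint E‖₊ * 5, ?_⟩
  refine Convex.lipschitzOnWith_of_nnnorm_hasDerivWithin_le (𝕜 := ℂ)
    (f' := fun z => Lint E * (Complex.I * z / pS E z ^ 3)) (convex_closedBall _ _) ?_ ?_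
  · intro z hz
    have hz4 := norm_le_four hz
    have hz5 : ‖z‖ ≤ 5 := by linarith
    have hp := pS_ne hE hz5
    have h := ((pS_deriv hE hz5).inv hp).const_mul (Lint E)
    have h' : HasDerivAt (fun z => Lint E / pS E z) (Lint E * (Complex.I * z / pS E z ^ 3)) z := by
      simp only [div_eq_mul_inv]
      refine h.congr_deriv ?_
      field_simp
    exact h'.hasDerivWithinAt
  · intro z hz
    have hz4 := norm_le_four hz
    have hz5 : ‖z‖ ≤ 5 := by linarith
    rw [← NNReal.coe_le_coe, coe_nnnorm]
    rw [NNReal.coe_mul, coe_nnnorm]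
    change _ ≤ ‖Lint E‖ * 5
    rw [norm_mul]
    gcongr
    rw [norm_div, norm_mul, Complex.norm_I, one_mul, norm_pow]
    have h1 : 1 ≤ ‖pS E z‖ :=
      (pS_re hE hz5).trans ((le_abs_self _).trans (Complex.abs_re_le_norm _))
    have h3 : 1 ≤ ‖pS E z‖ ^ 3 := one_le_pow₀ h1
    exact (div_le_self (norm_nonneg _) h3).trans hz5

lemma path_exists {E : ℂ} (hE : 1000 ≤ E.re) :
    ∃ γ : ℝ → ℂ, γ 0 = -1 ∧ (∀ t ∈ Set.Icc (0:ℝ) 1, ‖γ t‖ ≤ 4) ∧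
      ∀ t ∈ Set.Icc (0:ℝ) 1, HasDerivWithinAt γ (Lint E / pS E (γ t)) (Set.Icc (0:ℝ) 1) t := by
  obtain ⟨K, hK⟩ := field_lip hE
  have hf : IsPicardLindelof (fun _ : ℝ => fun z => Lint E / pS E z)
      (⟨0, by norm_num⟩ : Set.Icc (0:ℝ) 1) (-1:ℂ) 3 0 3 K := by
    apply IsPicardLindelof.of_time_independent
    · intro z hz
      have hz4 := norm_le_four (by simpa using hz)
      simpa using Lint_div_p hE (z := z) (by linarith)
    · simpa using hK
    · norm_num
  obtain ⟨α, hα⟩ := ODE.FunSpace.exists_isFixedPt_next hf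
    (Metric.mem_closedBall_self (by simp) : (-1:ℂ) ∈ Metric.closedBall (-1:ℂ) ((0:NNReal):ℝ))
  have hmem : ∀ t, α.compProj t ∈ Metric.closedBall (-1:ℂ) 3 := fun t => by
    simpa using α.compProj_mem_closedBall hf.mul_max_le (t := t)
  refine ⟨α.compProj, ?_, fun t _ => norm_le_four (hmem t), fun t ht ↦ ?_⟩
  · have h0 : α.compProj ((⟨0, by norm_num⟩ : Set.Icc (0:ℝ) 1) : ℝ) = -1 := by
      rw [ODE.FunSpace.compProj_val, ← hα, ODE.FunSpace.next_apply₀]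
    exact h0
  · apply ODE.hasDerivWithinAt_picard_Icc (⟨0, by norm_num⟩ : Set.Icc (0:ℝ) 1).2
      hf.continuousOn_uncurry
      α.continuous_compProj.continuousOn (fun _ ht' ↦ α.compProj_mem_closedBall hf.mul_max_le)
      (-1) ht |>.congr_of_mem _ ht
    intro t' ht'
    nth_rw 1 [← hα]
    rw [ODE.FunSpace.compProj_of_mem ht', ODE.FunSpace.next_apply]

lemma prim_inj {E : ℂ} (hE : 1000 ≤ E.re) (S : ℂ → ℂ)
    (hS : ∀ z ∈ Metric.ball (0:ℂ) 5, HasDerivAt S (pS E z) z) {a b : ℂ}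
    (ha : ‖a‖ ≤ 4) (hb : ‖b‖ ≤ 4) (hab : S a = S b) : a = b := by
  by_contra hne
  have hd : b - a ≠ 0 := sub_ne_zero.mpr (Ne.symm hne)
  set w : ℝ → ℂ := fun t => a + t * (b - a) with hw
  have hwn : ∀ t ∈ Set.Icc (0:ℝ) 1, ‖w t‖ ≤ 4 := by
    intro t ht
    have e : w t = (1 - t : ℝ) * a + (t:ℝ) * b := by
      simp only [hw]; push_cast; ring
    rw [e]
    refine (norm_add_le _ _).trans ?_
    rw [norm_mul, norm_mul, Complex.norm_real, Complex.norm_real, Real.norm_eq_abs,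
      Real.norm_eq_abs, abs_of_nonneg (by linarith [ht.2]), abs_of_nonneg ht.1]
    nlinarith [ht.1, ht.2]
  have hwd : ∀ t : ℝ, HasDerivAt w (b - a) t := by
    intro t
    have h := (((hasDerivAt_id t).ofReal_comp).mul_const (b - a)).const_add a
    refine h.congr_deriv ?_
    simp
  have hder : ∀ t ∈ Set.Icc (0:ℝ) 1, HasDerivAt (fun t => S (w t) / (b - a)) (pS E (w t)) t := by
    intro t ht
    have h1 := hS (w t) (by
      rw [mem_ball_zero_iff]; linarith [hwn t ht])
    have h2 := ((h1.comp t (hwd t)).div_const (b - a))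
    refine h2.congr_deriv ?_
    field_simp
  have hre : ∀ t ∈ Set.Icc (0:ℝ) 1,
      HasDerivAt (fun t => (S (w t) / (b - a)).re) (pS E (w t)).re t := by
    intro t ht
    exact (Complex.reCLM.hasFDerivAt.comp_hasDerivAt t (hder t ht))
  obtain ⟨c, hc, hc2⟩ := exists_hasDerivAt_eq_slope (fun t => (S (w t) / (b - a)).re)
    (fun t => (pS E (w t)).re) (zero_lt_one)
    (fun t ht => (hre t ht).continuousAt.continuousWithinAt)
    (fun t ht => hre t ⟨ht.1.le, ht.2.le⟩)
  have hp := pS_re hE (z := w c) (by linarith [hwn c ⟨hc.1.le, hc.2.le⟩])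
  have e0 : w 0 = a := by simp [hw]
  have e1 : w 1 = b := by simp [hw]
  simp only [e0, e1, hab] at hc2
  simp at hc2
  linarith

lemma path_full {E : ℂ} (hE : 1000 ≤ E.re) :
    ∃ γ : ℝ → ℂ, γ 0 = -1 ∧ γ 1 = 1 ∧ (∀ t ∈ Set.Icc (0:ℝ) 1, ‖γ t‖ ≤ 4) ∧
      ∀ t ∈ Set.Icc (0:ℝ) 1, HasDerivWithinAt γ (Lint E / pS E (γ t)) (Set.Icc (0:ℝ) 1) t := by
  obtain ⟨γ, h0, hn, hd⟩ := path_exists hE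
  have hdiff : DifferentiableOn ℂ (pS E) (Metric.ball (0:ℂ) 5) := by
    intro z hz
    rw [mem_ball_zero_iff] at hz
    exact (pS_deriv hE hz.le).differentiableAt.differentiableWithinAt
  obtain ⟨S, hS⟩ := hdiff.isExactOn_ball
  refine ⟨γ, h0, ?_, hn, hd⟩
  have hmem1 : ∀ x : ℝ, x ∈ Set.uIcc (-1:ℝ) 1 → (x:ℂ) ∈ Metric.ball (0:ℂ) 5 := by
    intro x hx
    rw [Set.uIcc_of_le (by norm_num)] at hx
    rw [mem_ball_zero_iff]
    linarith [real_norm_le hx]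
  have hL : Lint E = S 1 - S (-1) := by
    have := intervalIntegral.integral_eq_sub_of_hasDerivAt (a := (-1:ℝ)) (b := 1)
      (f := fun x : ℝ => S x) (f' := fun x : ℝ => pS E x)
      (fun x hx => (hS _ (hmem1 x hx)).comp_ofReal) (pS_continuousOn hE).intervalIntegrable
    simp only [Complex.ofReal_one, Complex.ofReal_neg] at this
    exact this
  have hSd : ∀ t ∈ Set.Icc (0:ℝ) 1,
      HasDerivWithinAt (fun t => S (γ t) - t * Lint E) 0 (Set.Icc (0:ℝ) 1) t := by
    intro t ht
    have hb : ‖γ t‖ ≤ 5 := by linarith [hn t ht]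
    have h1 := (hS (γ t) (by rw [mem_ball_zero_iff]; linarith [hn t ht])).comp_hasDerivWithinAt t
      (hd t ht)
    have h2 := h1.sub ((((hasDerivAt_id t).ofReal_comp).mul_const (Lint E)).hasDerivWithinAt
      (s := Set.Icc (0:ℝ) 1))
    refine h2.congr_deriv ?_
    have := pS_ne hE hb
    field_simp
    simp
  have hconst := constant_of_has_deriv_right_zero (f := fun t : ℝ => S (γ t) - t * Lint E)
    (a := 0) (b := 1) (fun t ht => (hSd t ht).continuousWithinAt)
    (fun t ht => ((hSd t ⟨ht.1, ht.2.le⟩).mono_of_mem_nhdsWithin (Icc_mem_nhdsGE_of_mem ht))) 1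
    (by norm_num)
  simp only [h0] at hconst
  have hfin : S (γ 1) = S 1 := by
    simp at hconst
    rw [hL] at hconst
    linear_combination hconst
  exact prim_inj hE S hS (hn 1 (by norm_num)) (by simp) hfin

lemma rho_bound {E z : ℂ} (hE : 1000 ≤ E.re) (hz : ‖z‖ ≤ 4) :
    ‖-(Lint E ^ 2 / qS E z) * ((Complex.I / 2) / qS E z - (5/4) * z ^ 2 / qS E z ^ 2)‖ ≤ 1 := by
  have hz5 : ‖z‖ ≤ 5 := by linarith
  have hq := qS_norm hE hz5
  have hL := Lint_le_q hE hz5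
  have hq0 : 0 < ‖qS E z‖ := by linarith
  rw [norm_mul, norm_neg, norm_div, norm_pow]
  have h1 : ‖Lint E‖ ^ 2 / ‖qS E z‖ ≤ 9 := by
    rw [div_le_iff₀ hq0]; exact hL
  have h2 : ‖(Complex.I / 2) / qS E z - (5/4) * z ^ 2 / qS E z ^ 2‖ ≤ 1 / 10 := by
    refine (norm_sub_le _ _).trans ?_
    have a1 : ‖(Complex.I / 2) / qS E z‖ ≤ 1 / 20 := by
      rw [norm_div, norm_div, Complex.norm_I, div_le_iff₀ hq0]
      norm_num
      linarith
    have a2 : ‖(5/4) * z ^ 2 / qS E z ^ 2‖ ≤ 1 / 20 := by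
      rw [norm_div, norm_mul, norm_pow, norm_pow, div_le_iff₀ (by positivity)]
      norm_num
      nlinarith [norm_nonneg z]
    linarith
  calc _ ≤ 9 * (1 / 10 : ℝ) := by gcongr
    _ ≤ 1 := by norm_num

lemma key_est {E : ℂ} (hE : 1000 ≤ E.re) {h : ℝ} (hh : 0 < h) (hl : 2 ≤ ‖Lint E / h‖) :
    ‖pS E 1 * detS h E / h - Complex.sin (Lint E / h)‖
      ≤ 2 * Real.exp |(Lint E / h).im| / ‖Lint E / h‖ := by
  obtain ⟨U, U', hU, hU', hUm, hUm', hU1⟩ := exists_U h hh E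
  obtain ⟨γ, g0, g1, hn, hd⟩ := path_full hE
  have hh' : (h:ℂ) ≠ 0 := by exact_mod_cast hh.ne'
  have hL0 : Lint E ≠ 0 := by
    intro h0
    have := Lint_norm_ge hE
    rw [h0, norm_zero] at this
    linarith
  have hb : ∀ t ∈ Set.Icc (0:ℝ) 1, ‖γ t‖ ≤ 5 := fun t ht => by linarith [hn t ht]
  have hosc := osc (Lint E / h) (fun t => U (γ t) / gS E (γ t))
    (fun t => Lint E * (U' (γ t) * gS E (γ t) - U (γ t) * gS' E (γ t)))
    (fun t => -(Lint E ^ 2 / qS E (γ t)) *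
      ((Complex.I / 2) / qS E (γ t) - (5/4) * (γ t) ^ 2 / qS E (γ t) ^ 2))
    (by
      intro t ht
      have hg := gS_ne hE (hb t ht)
      have hp := pS_ne hE (hb t ht)
      have hgp := gS_sq hE (hb t ht)
      have h1 := ((hU (γ t)).div (gS_deriv hE (hb t ht)) hg).comp_hasDerivWithinAt t (hd t ht)
      refine h1.congr_deriv ?_
      have hp2 : pS E (γ t) = 1 / gS E (γ t) ^ 2 := by
        field_simp
        linear_combination hgp
      rw [hp2]
      field_simp)
    (by
      intro t ht
      have hg := gS_ne hE (hb t ht)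
      have hp := pS_ne hE (hb t ht)
      have hgp := gS_sq hE (hb t ht)
      have h1 := ((((hU' (γ t)).mul (gS_deriv hE (hb t ht))).sub
        ((hU (γ t)).mul (gS_deriv2 hE (hb t ht)))).const_mul (Lint E)).comp_hasDerivWithinAt t
          (hd t ht)
      refine h1.congr_deriv ?_
      have hp2 : pS E (γ t) = 1 / gS E (γ t) ^ 2 := by
        field_simp
        linear_combination hgp
      have hq : qS E (γ t) = 1 / gS E (γ t) ^ 4 := by
        rw [← pS_sq, hp2]
        field_simp
      have e1 : Complex.I * (γ t) ^ 2 - E = - (1 / gS E (γ t) ^ 4) := by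
        rw [← hq, qS]; ring
      rw [e1, hq, hp2]
      field_simp
      ring)
    (fun t ht => rho_bound hE (hn t ht))
    (by simp only [g0, hUm, zero_div])
    hl
  simp only [g0, g1, hUm, hUm', hU1] at hosc
  have hgg : gS E (-1) = gS E 1 := by simp [gS]
  have hg := gS_ne hE (z := 1) (by simp)
  have hgp := gS_sq hE (z := 1) (by simp)
  have hp2 : pS E 1 = 1 / gS E 1 ^ 2 := by
    field_simp
    linear_combination hgp
  rw [hgg] at hosc
  have e2 : Lint E / h * (detS h E / gS E 1) - Lint E * (1 * gS E 1 - 0 * gS' E (-1)) *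
      Complex.sin (Lint E / h) =
      (Lint E * gS E 1) * (pS E 1 * detS h E / h - Complex.sin (Lint E / h)) := by
    rw [hp2]
    field_simp
    ring
  have e3 : Lint E * (1 * gS E 1 - 0 * gS' E (-1)) = Lint E * gS E 1 := by ring
  rw [e2, e3, norm_mul (Lint E * gS E 1)] at hosc
  have hpos : 0 < ‖Lint E * gS E 1‖ := norm_pos_iff.mpr (mul_ne_zero hL0 hg)
  have e4 : 2 * ‖Lint E * gS E 1‖ * Real.exp |(Lint E / h).im| / ‖Lint E / h‖ =
    ‖Lint E * gS E 1‖ * (2 * Real.exp |(Lint E / h).im| / ‖Lint E / h‖) := by ring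
  rw [e4] at hosc
  exact le_of_mul_le_mul_left hosc hpos

/-! ### Part 4: dependence of the action on the energy, and the final argument -/

lemma Lint_diff {E F : ℂ} (hE : 1000 ≤ E.re) (hF : 1000 ≤ F.re) {B : ℝ}
    (hEB : ‖E‖ + 1 ≤ B) (hFB : ‖F‖ + 1 ≤ B) :
    ‖Lint E - Lint F‖ ≤ ‖E - F‖ ∧ ‖E - F‖ * (1 / B) ≤ ‖Lint E - Lint F‖ := by
  have hB : 0 < B := by linarith [norm_nonneg E]
  have hre : ∀ x ∈ Set.Icc (-1:ℝ) 1, 2 ≤ (pS E x + pS F x).re := by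
    intro x hx
    have h5 : ‖(x:ℂ)‖ ≤ 5 := (real_norm_le hx).trans (by norm_num)
    rw [Complex.add_re]
    linarith [pS_re hE h5, pS_re hF h5]
  have hno : ∀ x ∈ Set.Icc (-1:ℝ) 1, 2 ≤ ‖pS E x + pS F x‖ := fun x hx =>
    (hre x hx).trans ((le_abs_self _).trans (Complex.abs_re_le_norm _))
  have hne : ∀ x ∈ Set.Icc (-1:ℝ) 1, pS E x + pS F x ≠ 0 := by
    intro x hx h0
    have := hno x hx
    rw [h0, norm_zero] at this
    linarith
  have hcont : ContinuousOn (fun x : ℝ => (pS E x + pS F x)⁻¹) (Set.uIcc (-1:ℝ) 1) := by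
    apply ((pS_continuousOn hE).add (pS_continuousOn hF)).inv₀
    intro x hx
    rw [Set.uIcc_of_le (by norm_num)] at hx
    exact hne x hx
  set J : ℂ := ∫ x in (-1:ℝ)..1, (pS E x + pS F x)⁻¹ with hJ
  have hLJ : Lint E - Lint F = (E - F) * J := by
    rw [hJ, ← intervalIntegral.integral_const_mul, Lint, Lint,
      ← intervalIntegral.integral_sub (pS_continuousOn hE).intervalIntegrable
        (pS_continuousOn hF).intervalIntegrable]
    apply intervalIntegral.integral_congr
    intro x hx
    rw [Set.uIcc_of_le (by norm_num)] at hx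
    have h1 := pS_sq E x
    have h2 := pS_sq F x
    have h3 := hne x hx
    simp only [qS] at h1 h2
    show pS E x - pS F x = (E - F) * (pS E x + pS F x)⁻¹
    rw [← div_eq_mul_inv, eq_div_iff h3]
    linear_combination h1 - h2
  have hJ1 : ‖J‖ ≤ 1 := by
    have h : ‖J‖ ≤ (1/2) * |1 - (-1:ℝ)| := by
      apply intervalIntegral.norm_integral_le_of_norm_le_const
      intro x hx
      rw [Set.uIoc_of_le (by norm_num)] at hx
      have := hno x ⟨hx.1.le, hx.2⟩
      rw [norm_inv, one_div]
      exact inv_anti₀ (by norm_num) this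
    norm_num at h
    exact h
  have hJ2 : 1 / B ≤ ‖J‖ := by
    have h1 : J.re = ∫ x in (-1:ℝ)..1, ((pS E x + pS F x)⁻¹).re := by
      have := Complex.reCLM.intervalIntegral_comp_comm
        (hcont.intervalIntegrable (μ := MeasureTheory.volume))
      simp only [Complex.reCLM_apply] at this
      exact this.symm
    have h2 : (∫ x in (-1:ℝ)..1, (1 / (2 * B):ℝ)) ≤ J.re := by
      rw [h1]
      apply intervalIntegral.integral_mono_on (by norm_num) (by simp)
      · exact (Complex.continuous_re.comp_continuousOn hcont).intervalIntegrable
      · intro x hx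
        have hn2 : ‖pS E x + pS F x‖ ≤ 2 * Real.sqrt B := by
          refine (norm_add_le _ _).trans ?_
          have a1 := (pS_norm_le (E := E) hx).trans (Real.sqrt_le_sqrt hEB)
          have a2 := (pS_norm_le (E := F) hx).trans (Real.sqrt_le_sqrt hFB)
          linarith
        have hns : Complex.normSq (pS E x + pS F x) ≤ 4 * B := by
          rw [Complex.normSq_eq_norm_sq]
          have := Real.sq_sqrt hB.le
          nlinarith [norm_nonneg (pS E x + pS F x), Real.sqrt_nonneg B]
        have hns0 : 0 < Complex.normSq (pS E x + pS F x) := Complex.normSq_pos.mpr (hne x hx)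
        rw [Complex.inv_re, div_le_div_iff₀ (by positivity) hns0]
        nlinarith [hre x hx]
    have h3 : (∫ x in (-1:ℝ)..1, (1 / (2 * B):ℝ)) = 1 / B := by
      rw [intervalIntegral.integral_const, smul_eq_mul]
      field_simp
      norm_num
    rw [h3] at h2
    exact h2.trans ((le_abs_self _).trans (Complex.abs_re_le_norm _))
  rw [hLJ, norm_mul]
  constructor
  · nlinarith [norm_nonneg (E - F)]
  · gcongr

lemma zero_of_bound {f : ℂ → ℂ} {z : ℂ} {r ε : ℝ} (hr : 0 < r)
    (hf : DiffContOnCl ℂ f (Metric.ball z r)) (hε : 0 < ε)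
    (hs : ∀ w ∈ Metric.sphere z r, ε ≤ ‖f w‖) (hz : ‖f z‖ < ε) :
    ∃ w ∈ Metric.closedBall z r, f w = 0 := by
  by_contra! hcon
  have hinv : DiffContOnCl ℂ f⁻¹ (Metric.ball z r) := by
    apply hf.inv
    intro w hw
    rw [closure_ball z hr.ne'] at hw
    exact hcon w hw
  have h := Complex.norm_le_of_forall_mem_frontier_norm_le Metric.isBounded_ball hinv (C := 1/ε)
    (by
      intro w hw
      rw [frontier_ball z hr.ne'] at hw
      have := hs w hw
      rw [Pi.inv_apply, norm_inv, one_div]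
      exact inv_anti₀ hε this)
    (subset_closure (Metric.mem_ball_self hr))
  have h0 : 0 < ‖f z‖ := norm_pos_iff.mpr (hcon z (Metric.mem_closedBall_self hr.le))
  rw [Pi.inv_apply, norm_inv, one_div] at h
  have := inv_strictAnti₀ h0 hz
  linarith

lemma sin_norm_ge (z : ℂ) :
    (Real.exp |z.im| - Real.exp (-|z.im|)) / 2 ≤ ‖Complex.sin z‖ := by
  have e : ‖Complex.sin z‖ = ‖Complex.exp (-z * Complex.I) - Complex.exp (z * Complex.I)‖ / 2 := by
    rw [Complex.sin, norm_div, norm_mul, Complex.norm_I]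
    norm_num
  have n1 : ‖Complex.exp (-z * Complex.I)‖ = Real.exp z.im := by
    rw [Complex.norm_exp]; simp
  have n2 : ‖Complex.exp (z * Complex.I)‖ = Real.exp (-z.im) := by
    rw [Complex.norm_exp]; simp
  have h := abs_norm_sub_norm_le (Complex.exp (-z * Complex.I)) (Complex.exp (z * Complex.I))
  rw [n1, n2] at h
  rw [e]
  have h1 := (abs_le.mp h).1
  have h2 := (abs_le.mp h).2
  rcases abs_cases z.im with ⟨a, _⟩ | ⟨a, _⟩
  · rw [a]; linarith
  · rw [a, neg_neg]; linarith

lemma sin_norm_add_nat_pi (z : ℂ) (k : ℕ) :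
    ‖Complex.sin (z + k * Real.pi)‖ = ‖Complex.sin z‖ := by
  induction k with
  | zero => simp
  | succ k ih =>
    have e : z + ((k + 1 : ℕ) : ℂ) * Real.pi = (z + k * Real.pi) + Real.pi := by
      push_cast; ring
    rw [e, Complex.sin_antiperiodic, norm_neg, ih]

lemma sin_norm_small {z : ℂ} (hz : ‖z‖ ≤ 1) : ‖z‖ / 2 ≤ ‖Complex.sin z‖ := by
  have h := Complex.sin_bound hz
  have h1 : ‖z‖ ≤ ‖Complex.sin z‖ + ‖Complex.sin z - (z - z ^ 3 / 6)‖ + ‖z ^ 3 / 6‖ := by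
    have e : z = Complex.sin z - (Complex.sin z - (z - z ^ 3 / 6)) + z ^ 3 / 6 := by ring
    calc ‖z‖ = ‖Complex.sin z - (Complex.sin z - (z - z ^ 3 / 6)) + z ^ 3 / 6‖ := by rw [← e]
      _ ≤ _ := (norm_add_le _ _).trans (by gcongr; exact norm_sub_le _ _)
  have h2 : ‖z ^ 3 / 6‖ = ‖z‖ ^ 3 / 6 := by
    rw [norm_div, norm_pow]; norm_num
  have h0 := norm_nonneg z
  have h3 : ‖z‖ ^ 3 ≤ ‖z‖ := by
    calc ‖z‖ ^ 3 ≤ ‖z‖ ^ 1 := pow_le_pow_of_le_one h0 hz (by norm_num)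
      _ = ‖z‖ := pow_one _
  have h5 : ‖z‖ ^ 5 ≤ ‖z‖ := by
    calc ‖z‖ ^ 5 ≤ ‖z‖ ^ 1 := pow_le_pow_of_le_one h0 hz (by norm_num)
      _ = ‖z‖ := pow_one _
  linarith

lemma eigen_im {E : ℂ} (hE : 1000 ≤ E.re) {h : ℝ} (hh : 0 < h) (hh1 : h ≤ 1)
    (hD : detS h E = 0) : 1 - Real.exp (-2 * |(Lint E).im| / h) ≤ 2 * h := by
  have hL := Lint_norm_ge hE
  have hn : ‖Lint E / h‖ = ‖Lint E‖ / h := by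
    rw [norm_div, Complex.norm_real, Real.norm_eq_abs, abs_of_pos hh]
  have hl : 2 / h ≤ ‖Lint E / h‖ := by rw [hn]; gcongr
  have h2h : 2 ≤ 2 / h := by rw [le_div_iff₀ hh]; linarith
  have hk := key_est hE hh (h2h.trans hl)
  rw [hD, mul_zero, zero_div, zero_sub, norm_neg] at hk
  have hs := sin_norm_ge (Lint E / h)
  have him : |(Lint E / h).im| = |(Lint E).im| / h := by
    rw [Complex.div_ofReal_im, abs_div, abs_of_pos hh]
  rw [him] at hk hs
  set s := |(Lint E).im| / h with hsdef
  have hpos := Real.exp_pos s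
  have hk2 : 2 * Real.exp s / ‖Lint E / h‖ ≤ Real.exp s * h := by
    rw [div_le_iff₀ (by linarith [h2h.trans hl])]
    have : Real.exp s * h * (2 / h) ≤ Real.exp s * h * ‖Lint E / h‖ := by gcongr
    have e : Real.exp s * h * (2 / h) = 2 * Real.exp s := by field_simp
    linarith
  have e5 : -2 * |(Lint E).im| / h = -s + -s := by rw [hsdef]; ring
  rw [e5, Real.exp_add]
  have e6 : Real.exp s * Real.exp (-s) = 1 := by rw [← Real.exp_add]; simp
  have h7 : Real.exp s * (1 - Real.exp (-s) * Real.exp (-s)) ≤ Real.exp s * (2 * h) := by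
    have : Real.exp s * (1 - Real.exp (-s) * Real.exp (-s)) = Real.exp s - Real.exp (-s) := by
      linear_combination (- Real.exp (-s)) * e6
    rw [this]
    linarith
  exact le_of_mul_le_mul_left h7 hpos

lemma dir_back {E₀ : ℂ} (hE : 1001 ≤ E₀.re) (hseq : ℕ → ℝ) (Eseq : ℕ → ℂ)
    (hpos : ∀ n, 0 < hseq n) (ht : Filter.Tendsto hseq Filter.atTop (nhds 0))
    (hEt : Filter.Tendsto Eseq Filter.atTop (nhds E₀)) (hD : ∀ n, detS (hseq n) (Eseq n) = 0) :
    (Lint E₀).im = 0 := by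
  by_contra hne
  set κ := |(Lint E₀).im| with hκ
  have hκ0 : 0 < κ := abs_pos.mpr hne
  have hc : 0 < 1 - Real.exp (-κ) := by
    have : Real.exp (-κ) < 1 := by rw [Real.exp_lt_one_iff]; linarith
    linarith
  have ev1 : ∀ᶠ n in Filter.atTop, ‖Eseq n - E₀‖ < min 1 (κ / 2) := by
    have := Metric.tendsto_nhds.mp hEt (min 1 (κ/2)) (by positivity)
    simpa only [dist_eq_norm] using this
  have ev2 : ∀ᶠ n in Filter.atTop, hseq n < min 1 ((1 - Real.exp (-κ)) / 2) :=
    ht.eventually_lt_const (by positivity)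
  obtain ⟨n, hn1, hn2⟩ := (ev1.and ev2).exists
  have hh := hpos n
  have hnE : ‖Eseq n - E₀‖ < 1 := hn1.trans_le (min_le_left _ _)
  have hnκ : ‖Eseq n - E₀‖ < κ / 2 := hn1.trans_le (min_le_right _ _)
  have hre : 1000 ≤ (Eseq n).re := by
    have h1 := (Complex.abs_re_le_norm (Eseq n - E₀)).trans hnE.le
    rw [Complex.sub_re] at h1
    linarith [(abs_le.mp h1).1]
  have hLd := (Lint_diff hre (show 1000 ≤ E₀.re by linarith)
    (B := max (‖Eseq n‖ + 1) (‖E₀‖ + 1)) (le_max_left _ _) (le_max_right _ _)).1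
  have h2 := (Complex.abs_im_le_norm (Lint (Eseq n) - Lint E₀)).trans (hLd.trans hnκ.le)
  rw [Complex.sub_im] at h2
  have h3 : κ / 2 ≤ |(Lint (Eseq n)).im| := by
    have := abs_sub_abs_le_abs_sub (Lint E₀).im (Lint (Eseq n)).im
    rw [abs_sub_comm] at this
    linarith
  have hh1 : hseq n ≤ 1 := (hn2.trans_le (min_le_left _ _)).le
  have h4 := eigen_im hre hh hh1 (hD n)
  have h5 : Real.exp (-2 * |(Lint (Eseq n)).im| / hseq n) ≤ Real.exp (-κ) := by
    apply Real.exp_le_exp.mpr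
    rw [div_le_iff₀ hh]
    nlinarith
  have h6 : hseq n < (1 - Real.exp (-κ)) / 2 := hn2.trans_le (min_le_right _ _)
  linarith

lemma err_est {E : ℂ} (hE : 1000 ≤ E.re) {h : ℝ} (hh : 0 < h) (hh1 : h ≤ 1)
    (him : |(Lint E / h).im| ≤ 1) :
    ‖pS E 1 * detS h E / h - Complex.sin (Lint E / h)‖ ≤ 3 * h := by
  have hL := Lint_norm_ge hE
  have hn : ‖Lint E / h‖ = ‖Lint E‖ / h := by
    rw [norm_div, Complex.norm_real, Real.norm_eq_abs, abs_of_pos hh]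
  have hl : 2 / h ≤ ‖Lint E / h‖ := by rw [hn]; gcongr
  have h2h : 2 ≤ 2 / h := by rw [le_div_iff₀ hh]; linarith
  refine (key_est hE hh (h2h.trans hl)).trans ?_
  have h3 : Real.exp |(Lint E / h).im| ≤ 3 :=
    (Real.exp_le_exp.mpr him).trans Real.exp_one_lt_three.le
  rw [div_le_iff₀ (by linarith [h2h.trans hl])]
  have : 3 * h * (2 / h) ≤ 3 * h * ‖Lint E / h‖ := by gcongr
  have e : 3 * h * (2 / h) = 6 := by field_simp; norm_num
  linarith

lemma dir_fwd_one {E₀ : ℂ} (hE : 1001 ≤ E₀.re) (him : (Lint E₀).im = 0) {k : ℕ} {h : ℝ}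
    (hh : 0 < h) (hh1 : h ≤ 1) (hk : (Lint E₀).re = h * (k * Real.pi))
    (hm : 12 * h * (‖E₀‖ + 2) < 1) :
    ∃ E ∈ Metric.closedBall E₀ h, detS h E = 0 := by
  set B := ‖E₀‖ + 2 with hB
  have hB0 : 0 < B := by positivity
  have hhc : (h:ℂ) ≠ 0 := by exact_mod_cast hh.ne'
  have hL0 : Lint E₀ = h * (k * Real.pi) := by
    apply Complex.ext
    · rw [hk]
      have : ((h:ℂ) * (k * Real.pi)) = ((h * (k * Real.pi) : ℝ) : ℂ) := by push_cast; ring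
      rw [this, Complex.ofReal_re]
    · rw [him]
      have : ((h:ℂ) * (k * Real.pi)) = ((h * (k * Real.pi) : ℝ) : ℂ) := by push_cast; ring
      rw [this, Complex.ofReal_im]
  have hball : ∀ E ∈ Metric.closedBall E₀ 1, 1000 ≤ E.re ∧ ‖E‖ + 1 ≤ B := by
    intro E hEb
    rw [mem_closedBall_iff_norm] at hEb
    have h1 := (Complex.abs_re_le_norm (E - E₀)).trans hEb
    rw [Complex.sub_re] at h1
    have h2 := norm_sub_norm_le E E₀
    exact ⟨by linarith [(abs_le.mp h1).1], by linarith⟩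
  have hest : ∀ E ∈ Metric.closedBall E₀ h,
      ‖E - E₀‖ * (1 / B) / h / 2 - 3 * h ≤ ‖pS E 1 * detS h E / h‖ := by
    intro E hEh
    obtain ⟨hre, hEB⟩ := hball E (Metric.closedBall_subset_closedBall hh1 hEh)
    rw [mem_closedBall_iff_norm] at hEh
    have hd := Lint_diff hre (show 1000 ≤ E₀.re by linarith) hEB (by linarith : ‖E₀‖ + 1 ≤ B)
    set η := (Lint E - Lint E₀) / h with hη
    have hηn : ‖η‖ = ‖Lint E - Lint E₀‖ / h := by
      rw [hη, norm_div, Complex.norm_real, Real.norm_eq_abs, abs_of_pos hh]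
    have hη1 : ‖η‖ ≤ 1 := by
      rw [hηn, div_le_one hh]
      exact hd.1.trans hEh
    have hlam : Lint E / h = η + k * Real.pi := by
      rw [hη, hL0]
      field_simp
      ring
    have hi : |(Lint E / h).im| ≤ 1 := by
      have : (Lint E / h).im = η.im := by
        rw [hlam]; simp
      rw [this]
      exact (Complex.abs_im_le_norm _).trans hη1
    have he := err_est hre hh hh1 hi
    rw [hlam] at he
    have hs := sin_norm_small hη1
    rw [← sin_norm_add_nat_pi η k] at hs
    have htri := norm_sub_norm_le (Complex.sin (η + k * Real.pi)) (pS E 1 * detS h E / h)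
    rw [norm_sub_rev] at htri
    have hlow : ‖E - E₀‖ * (1 / B) / h ≤ ‖η‖ := by
      rw [hηn]
      gcongr
      exact hd.2
    linarith
  have hcen : ‖pS E₀ 1 * detS h E₀ / h‖ ≤ 3 * h := by
    have hlam : Lint E₀ / h = k * Real.pi := by
      rw [hL0]; field_simp
    have := err_est (show 1000 ≤ E₀.re by linarith) hh hh1 (by
      rw [hlam]; simp)
    rw [hlam, Complex.sin_nat_mul_pi, sub_zero] at this
    exact this
  have hmm : 12 * h < 1 / B := by
    rw [lt_div_iff₀ hB0]; linarith
  have hdiff : DiffContOnCl ℂ (fun E => pS E 1 * detS h E / h) (Metric.ball E₀ h) := by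
    apply DifferentiableOn.diffContOnCl
    rw [closure_ball _ hh.ne']
    intro E hEh
    obtain ⟨hre, hEB⟩ := hball E (Metric.closedBall_subset_closedBall hh1 hEh)
    have hq := qS_slit hre (z := 1) (by simp)
    have hp : DifferentiableAt ℂ (fun E => pS E 1) E := by
      have h1 := ((hasDerivAt_id E).sub_const (Complex.I * 1 ^ 2)).cpow_const (c := (1/2:ℂ)) hq
      exact h1.differentiableAt
    exact ((hp.mul (detS_diff h hh E)).div_const _).differentiableWithinAt
  obtain ⟨E, hEb, hE0⟩ := zero_of_bound hh hdiff (show 0 < 1 / B / 2 - 3 * h by linarith)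
    (by
      intro E hEs
      have h1 := hest E (Metric.sphere_subset_closedBall hEs)
      rw [mem_sphere_iff_norm] at hEs
      rw [hEs] at h1
      have e : h * (1 / B) / h / 2 = 1 / B / 2 := by field_simp
      rw [e] at h1
      exact h1)
    (by
      show ‖pS E₀ 1 * detS h E₀ / h‖ < 1 / B / 2 - 3 * h
      linarith)
  refine ⟨E, hEb, ?_⟩
  obtain ⟨hre, hEB⟩ := hball E (Metric.closedBall_subset_closedBall hh1 hEb)
  have hp := pS_ne hre (z := 1) (by simp)
  have h1 : pS E 1 * detS h E / h = 0 := hE0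
  rw [div_eq_zero_iff] at h1
  rcases h1 with h1 | h1
  · exact (mul_eq_zero.mp h1).resolve_left hp
  · exact absurd h1 hhc

lemma dir_fwd {E₀ : ℂ} (hE : 1001 ≤ E₀.re) (him : (Lint E₀).im = 0) :
    ∃ (hseq : ℕ → ℝ) (Eseq : ℕ → ℂ), (∀ n, 0 < hseq n) ∧
      Filter.Tendsto hseq Filter.atTop (nhds 0) ∧
      Filter.Tendsto Eseq Filter.atTop (nhds E₀) ∧ ∀ n, detS (hseq n) (Eseq n) = 0 := by
  have hL := Lint_re (show 1000 ≤ E₀.re by linarith)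
  set ℓ := (Lint E₀).re with hℓ
  have hpi := Real.pi_pos
  have ht : Filter.Tendsto (fun k : ℕ => ℓ / (k * Real.pi)) Filter.atTop (nhds 0) := by
    apply Filter.Tendsto.div_atTop tendsto_const_nhds
    exact Filter.Tendsto.atTop_mul_const hpi tendsto_natCast_atTop_atTop
  have ev : ∀ᶠ k : ℕ in Filter.atTop, ℓ / (k * Real.pi) < 1 / (12 * (‖E₀‖ + 2)) :=
    ht.eventually_lt_const (by positivity)
  obtain ⟨N, hN⟩ := Filter.eventually_atTop.mp ev
  have hkey : ∀ n : ℕ, ∃ E ∈ Metric.closedBall E₀ (ℓ / ((n + (N + 1) : ℕ) * Real.pi)),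
      detS (ℓ / ((n + (N + 1) : ℕ) * Real.pi)) E = 0 := by
    intro n
    have hb := hN (n + (N + 1)) (by omega)
    have hkpos : (0:ℝ) < ((n + (N + 1) : ℕ) : ℝ) := by
      exact_mod_cast (by omega : 0 < n + (N + 1))
    have h0 : 0 < 12 * (‖E₀‖ + 2) := by positivity
    have hb2 := (lt_div_iff₀ h0).mp hb
    apply dir_fwd_one hE him (k := n + (N + 1)) (by positivity)
    · refine hb.le.trans ?_
      rw [div_le_one h0]
      linarith [norm_nonneg E₀]
    · rw [← hℓ]
      field_simp
    · linarith
  choose Es hEs1 hEs2 using hkey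
  have ht2 := ht.comp (Filter.tendsto_add_atTop_nat (N + 1))
  refine ⟨fun n => ℓ / ((n + (N + 1) : ℕ) * Real.pi), Es, ?_, ht2, ?_, hEs2⟩
  · intro n
    have hkpos : (0:ℝ) < ((n + (N + 1) : ℕ) : ℝ) := by
      exact_mod_cast (by omega : 0 < n + (N + 1))
    positivity
  · rw [tendsto_iff_dist_tendsto_zero]
    exact squeeze_zero (fun n => dist_nonneg) (fun n => hEs1 n) ht2

/-- Theorem `reci` of the paper for `P^h = -h²d²/dx² + ix²`:
for `E₀` large with small imaginary part, `Im ∫_{-1}^1 √(E₀ − ix²) dx = 0` iff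
`E₀` is a limit as `h → 0` of Dirichlet eigenvalues of `P^h`. -/
theorem stmt13 :
    ∃ R : ℝ, 0 < R ∧
      ∀ E₀ : ℂ, R ≤ E₀.re → |E₀.im| ≤ 1 →
        (((∫ x in (-1:ℝ)..1,
            (E₀ - Complex.I * (x : ℂ) ^ 2) ^ (1/2 : ℂ)).im = 0)
        ↔
        (∃ (hseq : ℕ → ℝ) (Eseq : ℕ → ℂ),
          (∀ n, 0 < hseq n) ∧
          Filter.Tendsto hseq Filter.atTop (nhds 0) ∧
          Filter.Tendsto Eseq Filter.atTop (nhds E₀) ∧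
          ∀ n, ∃ u u' u'' : ℝ → ℂ,
            IsDirichletSol (hseq n) (fun x : ℝ => Complex.I * (x : ℂ) ^ 2)
              (Eseq n) u u' u'' ∧
            ∃ x ∈ Set.Icc (-1:ℝ) 1, u x ≠ 0)) := by
  refine ⟨1001, by norm_num, ?_⟩
  intro E₀ hE _
  constructor
  · intro him
    obtain ⟨hs, Es, hpos, ht, hEt, hD⟩ := dir_fwd hE him
    exact ⟨hs, Es, hpos, ht, hEt, fun n => eigen_of_det (hs n) (hpos n) (Es n) (hD n)⟩
  · rintro ⟨hs, Es, hpos, ht, hEt, hu⟩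
    apply dir_back hE hs Es hpos ht hEt
    intro n
    obtain ⟨u, u', u'', hsol, hne⟩ := hu n
    exact det_of_eigen (hs n) (hpos n) (Es n) u u' u'' hsol hne
end

section
/- Let β ∈ (−1,1) and δ ∈ (0,1]. There exists R > 0 such that for every E₀ ∈ ℂ with Re E₀ ≥ R and |Im E₀| ≤ 1, the following are equivalent: (i) Im ∫_{−1}^{β} √(E₀ − i·x² + i·δ) dx = 0 or Im ∫_{β}^{1} √(E₀ − i·x² − i·δ) dx = 0 (principal square roots); (ii) there exist a sequence (hₙ) of positive real numbers tending to 0, a sequence (Eₙ) in ℂ tending to E₀, and for each n a nonzero continuously differentiable function uₙ : [−1,1] → ℂ whose restrictions to [−1,β] and to [β,1] are twice continuously differentiable, with −hₙ²·uₙ″(x) + (i·x² − i·δ)·uₙ(x) = Eₙ·uₙ(x) for x ∈ [−1,β), −hₙ²·uₙ″(x) + (i·x² + i·δ)·uₙ(x) = Eₙ·uₙ(x) for x ∈ (β,1], and uₙ(−1) = uₙ(1) = 0. -/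
/-- `u`, with derivative `u'` on `[-1,1]` and one-sided second derivatives
`ul''` on `[-1,β]`, `ur''` on `[β,1]`, is a continuously differentiable function on
`[-1,1]`, twice continuously differentiable on `[-1,β]` and on `[β,1]`, solving
`-h²u'' + Wl·u = E·u` on `[-1,β)`, `-h²u'' + Wr·u = E·u` on `(β,1]`, and
`u(-1) = u(1) = 0`. -/
def IsPiecewiseDirichletSol (h β : ℝ) (Wl Wr : ℝ → ℂ) (E : ℂ)
    (u u' ul'' ur'' : ℝ → ℂ) : Prop :=
  (∀ x ∈ Set.Icc (-1:ℝ) 1, HasDerivWithinAt u (u' x) (Set.Icc (-1:ℝ) 1) x) ∧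
  ContinuousOn u' (Set.Icc (-1:ℝ) 1) ∧
  (∀ x ∈ Set.Icc (-1:ℝ) β, HasDerivWithinAt u' (ul'' x) (Set.Icc (-1:ℝ) β) x) ∧
  ContinuousOn ul'' (Set.Icc (-1:ℝ) β) ∧
  (∀ x ∈ Set.Icc β (1:ℝ), HasDerivWithinAt u' (ur'' x) (Set.Icc β (1:ℝ)) x) ∧
  ContinuousOn ur'' (Set.Icc β (1:ℝ)) ∧
  (∀ x ∈ Set.Ico (-1:ℝ) β, -(h:ℂ)^2 * ul'' x + Wl x * u x = E * u x) ∧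
  (∀ x ∈ Set.Ioc β (1:ℝ), -(h:ℂ)^2 * ur'' x + Wr x * u x = E * u x) ∧
  u (-1) = 0 ∧ u 1 = 0

namespace WKB
open Complex Metric Filter Topology

lemma ps_deriv {c : ℕ → ℂ} (hc : ∀ r : ℝ, 0 ≤ r → Summable (fun n => ‖c n‖ * r ^ n)) (z : ℂ) :
    HasDerivAt (fun w : ℂ => ∑' n, c n * w ^ n) (∑' n : ℕ, ((n + 1 : ℕ) : ℂ) * c (n + 1) * z ^ n) z := by
  have hU : IsOpen (ball (0 : ℂ) (‖z‖ + 1)) := isOpen_ball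
  have hz : z ∈ ball (0 : ℂ) (‖z‖ + 1) := by simp
  have hd : ∀ n : ℕ, DifferentiableOn ℂ (fun w : ℂ => c n * w ^ n) (ball (0 : ℂ) (‖z‖ + 1)) := by
    intro n; fun_prop
  have hb : ∀ (n : ℕ) (w : ℂ), w ∈ ball (0 : ℂ) (‖z‖ + 1) →
      ‖c n * w ^ n‖ ≤ ‖c n‖ * (‖z‖ + 1) ^ n := by
    intro n w hw
    rw [norm_mul, norm_pow]
    have : ‖w‖ ≤ ‖z‖ + 1 := by simpa using (mem_ball_zero_iff.1 hw).le
    gcongr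
  have hs := hc (‖z‖ + 1) (by positivity)
  have h1 := hasSum_deriv_of_summable_norm hs hd hU hb hz
  have h2 := (differentiableOn_tsum_of_summable_norm hs hd hU hb).differentiableAt (hU.mem_nhds hz)
  have h3 := (hasSum_nat_add_iff' 1).2 h1
  have h4 : ∑' n : ℕ, ((n + 1 : ℕ) : ℂ) * c (n + 1) * z ^ n
      = deriv (fun w : ℂ => ∑' n, c n * w ^ n) z := by
    have : ∑ i ∈ Finset.range 1, deriv (fun w : ℂ => c i * w ^ i) z = 0 := by simp
    rw [this, sub_zero] at h3
    rw [← h3.tsum_eq]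
    congr 1
    ext n
    rw [deriv_const_mul _ (by fun_prop)]
    simp
    ring
  rw [h4]
  exact h2.hasDerivAt

lemma ps_next {c : ℕ → ℂ} (hc : ∀ r : ℝ, 0 ≤ r → Summable (fun n => ‖c n‖ * r ^ n)) :
    ∀ r : ℝ, 0 ≤ r → Summable (fun n => ‖((n + 1 : ℕ) : ℂ) * c (n + 1)‖ * r ^ n) := by
  intro r hr
  have h := (summable_nat_add_iff 1).2 (hc (2 * (r + 1)) (by positivity))
  refine Summable.of_nonneg_of_le (fun n => by positivity) (fun n => ?_) h
  rw [norm_mul, Complex.norm_natCast, mul_pow, mul_comm ((n + 1 : ℕ) : ℝ), mul_assoc]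
  have h1 : ((n + 1 : ℕ) : ℝ) ≤ 2 ^ (n + 1) := by
    exact_mod_cast (Nat.lt_two_pow_self (n := n + 1)).le
  have h2 : r ^ n ≤ (r + 1) ^ (n + 1) := by
    calc r ^ n ≤ (r + 1) ^ n := by gcongr; linarith
      _ ≤ (r + 1) ^ (n + 1) := pow_le_pow_right₀ (by linarith) (by omega)
  gcongr

/-- power series coefficients of the solution of `f'' = (a + b z²) f`. -/
noncomputable def cf (b c0 c1 : ℂ) : ℕ → ℂ → ℂ
  | 0, _ => c0
  | 1, _ => c1
  | 2, a => a * c0 / 2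
  | 3, a => a * c1 / 6
  | n + 4, a => (a * cf b c0 c1 (n + 2) a + b * cf b c0 c1 n a) / ((n + 4) * (n + 3))

lemma cf_diff (b c0 c1 : ℂ) (n : ℕ) : Differentiable ℂ (cf b c0 c1 n) := by
  induction n using Nat.strong_induction_on with
  | _ n ih =>
    match n, ih with
    | 0, _ => exact differentiable_const _
    | 1, _ => exact differentiable_const _
    | 2, _ =>
      have : cf b c0 c1 2 = fun a => a * c0 / 2 := by ext a; simp [cf]
      rw [this]; fun_prop
    | 3, _ =>
      have : cf b c0 c1 3 = fun a => a * c1 / 6 := by ext a; simp [cf]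
      rw [this]; fun_prop
    | n + 4, ih =>
      have h1 := ih (n + 2) (by omega)
      have h2 := ih n (by omega)
      have : cf b c0 c1 (n + 4) = fun a =>
          (a * cf b c0 c1 (n + 2) a + b * cf b c0 c1 n a) / ((n + 4) * (n + 3)) := by
        ext a; rw [cf]
      rw [this]; fun_prop

lemma cf_bound {b c0 c1 a : ℂ} (h0 : ‖c0‖ ≤ 1) (h1 : ‖c1‖ ≤ 1) {K : ℝ} (hK : 1 ≤ K)
    (hab : ‖a‖ + ‖b‖ ≤ K) (n : ℕ) : ‖cf b c0 c1 n a‖ ≤ K ^ n / ((n / 2).factorial : ℝ) := by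
  have ha0 := norm_nonneg a
  have hb0 := norm_nonneg b
  have hK2 : K ≤ K ^ 2 := by nlinarith
  have hK3 : K ≤ K ^ 3 := by nlinarith
  induction n using Nat.strong_induction_on with
  | _ n ih =>
    match n, ih with
    | 0, _ => simpa [cf] using h0
    | 1, _ => simpa [cf] using h1.trans hK
    | 2, _ =>
      have : ‖a‖ * ‖c0‖ ≤ ‖a‖ := mul_le_of_le_one_right ha0 h0
      simp [cf]; nlinarith
    | 3, _ =>
      have : ‖a‖ * ‖c1‖ ≤ ‖a‖ := mul_le_of_le_one_right ha0 h1
      simp [cf]; nlinarith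
    | n + 4, ih =>
      have e1 := ih (n + 2) (by omega)
      have e2 := ih n (by omega)
      have d1 : (n + 2) / 2 = n / 2 + 1 := by omega
      have d2 : (n + 4) / 2 = n / 2 + 2 := by omega
      rw [d1] at e1
      rw [d2]
      have hm : n / 2 ≤ n := Nat.div_le_self _ _
      generalize n / 2 = m at *
      have hm' : (m : ℝ) ≤ n := by exact_mod_cast hm
      unfold cf
      rw [norm_div]
      have hden : ‖((n : ℂ) + 4) * ((n : ℂ) + 3)‖ = ((n : ℝ) + 4) * (n + 3) := by
        rw [norm_mul]
        have t1 : ((n : ℂ) + 4) = ((n + 4 : ℕ) : ℂ) := by push_cast; ring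
        have t2 : ((n : ℂ) + 3) = ((n + 3 : ℕ) : ℂ) := by push_cast; ring
        rw [t1, t2, Complex.norm_natCast, Complex.norm_natCast]; push_cast; ring
      rw [hden]
      have hf : (0 : ℝ) < (m.factorial : ℝ) := by exact_mod_cast m.factorial_pos
      have f1 : ((m + 1).factorial : ℝ) = (m + 1) * m.factorial := by
        push_cast [Nat.factorial_succ]; ring
      have f2 : ((m + 2).factorial : ℝ) = (m + 2) * (m + 1) * m.factorial := by
        push_cast [Nat.factorial_succ]; ring
      rw [f1] at e1
      rw [f2]
      have hX : 0 ≤ K ^ n / m.factorial := by positivity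
      have e1' : ‖cf b c0 c1 (n + 2) a‖ ≤ K ^ 2 * (K ^ n / m.factorial) := by
        refine e1.trans ?_
        rw [div_le_iff₀ (by positivity)]
        have : K ^ 2 * (K ^ n / m.factorial) * ((m + 1) * m.factorial) = K ^ (n + 2) * (m + 1) := by
          field_simp; ring
        rw [this]
        have : 0 ≤ K ^ (n + 2) := by positivity
        nlinarith [show (0 : ℝ) ≤ m from Nat.cast_nonneg m]
      have num : ‖a * cf b c0 c1 (n + 2) a + b * cf b c0 c1 n a‖ ≤ K ^ 4 * (K ^ n / m.factorial) := by
        calc _ ≤ ‖a‖ * ‖cf b c0 c1 (n + 2) a‖ + ‖b‖ * ‖cf b c0 c1 n a‖ := by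
              refine (norm_add_le _ _).trans ?_
              rw [norm_mul, norm_mul]
          _ ≤ ‖a‖ * (K ^ 2 * (K ^ n / m.factorial)) + ‖b‖ * (K ^ n / m.factorial) := by gcongr
          _ ≤ K ^ 4 * (K ^ n / m.factorial) := by
            have : ‖a‖ * K ^ 2 + ‖b‖ ≤ K ^ 4 := by nlinarith
            nlinarith
      rw [div_le_div_iff₀ (by positivity) (by positivity)]
      have hmm : ((m : ℝ) + 2) * (m + 1) ≤ (n + 4) * (n + 3) := by
        have : (0 : ℝ) ≤ m := Nat.cast_nonneg m
        nlinarith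
      calc _ ≤ K ^ 4 * (K ^ n / m.factorial) * ((m + 2) * (m + 1) * m.factorial) := by gcongr
        _ = K ^ (n + 4) * ((m + 2) * (m + 1)) := by field_simp; ring
        _ ≤ _ := by gcongr

lemma summable_half (x : ℝ) : Summable (fun n : ℕ => x ^ n / ((n / 2).factorial : ℝ)) := by
  apply Summable.even_add_odd
  · have := Real.summable_pow_div_factorial (x ^ 2)
    refine this.congr (fun n => ?_)
    rw [show 2 * n / 2 = n by omega, pow_mul]
  · have := (Real.summable_pow_div_factorial (x ^ 2)).mul_left x
    refine this.congr (fun n => ?_)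
    rw [show (2 * n + 1) / 2 = n by omega, pow_add, pow_mul]; ring

lemma cf_summable {b c0 c1 a : ℂ} (h0 : ‖c0‖ ≤ 1) (h1 : ‖c1‖ ≤ 1) :
    ∀ r : ℝ, 0 ≤ r → Summable (fun n => ‖cf b c0 c1 n a‖ * r ^ n) := by
  intro r hr
  refine Summable.of_nonneg_of_le (fun n => by positivity) (fun n => ?_)
    (summable_half ((1 + ‖a‖ + ‖b‖) * r))
  rw [mul_pow, mul_div_right_comm]
  gcongr
  exact cf_bound h0 h1 (by linarith [norm_nonneg a, norm_nonneg b]) (by linarith) n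

lemma exists_sol (b c0 c1 : ℂ) (h0 : ‖c0‖ ≤ 1) (h1 : ‖c1‖ ≤ 1) :
    ∃ f g : ℂ → ℂ → ℂ, (∀ a, f a 0 = c0 ∧ g a 0 = c1) ∧
      (∀ a z, HasDerivAt (f a) (g a z) z) ∧
      (∀ a z, HasDerivAt (g a) ((a + b * z ^ 2) * f a z) z) ∧
      (∀ z, Differentiable ℂ (fun a => f a z)) ∧ (∀ z, Differentiable ℂ (fun a => g a z)) := by
  have hs := fun a => cf_summable (b := b) (a := a) h0 h1
  refine ⟨fun a z => ∑' n, cf b c0 c1 n a * z ^ n,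
    fun a z => ∑' n : ℕ, ((n + 1 : ℕ) : ℂ) * cf b c0 c1 (n + 1) a * z ^ n, ?_, ?_, ?_, ?_, ?_⟩
  · intro a
    beta_reduce
    constructor
    · rw [tsum_eq_single 0]
      · simp [cf]
      · intro n hn; simp [hn]
    · rw [tsum_eq_single 0]
      · simp [cf]
      · intro n hn; simp [hn]
  · intro a z
    exact ps_deriv (hs a) z
  · intro a z
    have h := ps_deriv (ps_next (hs a)) z
    convert h using 1
    have S0 : Summable (fun n => cf b c0 c1 n a * z ^ n) := by
      refine Summable.of_norm_bounded (hs a ‖z‖ (norm_nonneg _)) (fun n => ?_)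
      rw [norm_mul, norm_pow]
    have S2 : Summable (fun n : ℕ => ((n + 1 : ℕ) : ℂ) * (((n + 1 + 1 : ℕ) : ℂ) * cf b c0 c1 (n + 1 + 1) a) * z ^ n) := by
      have := ps_next (ps_next (hs a)) ‖z‖ (norm_nonneg _)
      refine Summable.of_norm_bounded this (fun n => ?_)
      rw [norm_mul, norm_pow]
    rw [← S2.sum_add_tsum_nat_add 2]
    beta_reduce
    rw [add_mul]
    conv_lhs => rw [← S0.sum_add_tsum_nat_add 2]
    have e3 : b * z ^ 2 * (∑ i ∈ Finset.range 2, cf b c0 c1 i a * z ^ i + ∑' i, cf b c0 c1 (i + 2) a * z ^ (i + 2))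
        = ∑' i, b * z ^ 2 * (cf b c0 c1 i a * z ^ i) := by
      rw [S0.sum_add_tsum_nat_add 2, tsum_mul_left]
    rw [e3, mul_add, ← tsum_mul_left, add_assoc, ← Summable.tsum_add]
    · congr 1
      · simp [Finset.sum_range_succ, cf]; ring
      · congr 1
        ext n
        have : cf b c0 c1 (n + 2 + 1 + 1) a = (a * cf b c0 c1 (n + 2) a + b * cf b c0 c1 n a) / ((n + 4) * (n + 3)) := by
          rw [show n + 2 + 1 + 1 = n + 4 by ring]; rw [cf]
        rw [this]
        have t1 : ((n : ℂ) + 4) ≠ 0 := by exact_mod_cast (Nat.succ_ne_zero (n + 3))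
        have t2 : ((n : ℂ) + 3) ≠ 0 := by exact_mod_cast (Nat.succ_ne_zero (n + 2))
        push_cast
        field_simp
        ring
    · exact ((summable_nat_add_iff 2).2 S0).mul_left a
    · exact S0.mul_left _
  · intro z a0
    set K := 1 + (‖a0‖ + 1) + ‖b‖
    have hU : IsOpen (ball (0 : ℂ) (‖a0‖ + 1)) := isOpen_ball
    refine (differentiableOn_tsum_of_summable_norm (summable_half (K * ‖z‖)) (U := ball (0 : ℂ) (‖a0‖ + 1))
      (fun n => ?_) hU (fun n a ha => ?_)).differentiableAt (hU.mem_nhds (by simp))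
    · exact ((cf_diff b c0 c1 n).mul_const _).differentiableOn
    · have : ‖a‖ ≤ ‖a0‖ + 1 := by simpa using (mem_ball_zero_iff.1 ha).le
      rw [norm_mul, norm_pow, mul_pow, mul_div_right_comm]
      gcongr
      exact cf_bound h0 h1 (by simp only [K]; linarith [norm_nonneg a0, norm_nonneg b]) (by simp only [K]; linarith) n
  · intro z a0
    set K := 1 + (‖a0‖ + 1) + ‖b‖
    have hU : IsOpen (ball (0 : ℂ) (‖a0‖ + 1)) := isOpen_ball
    have hsum := (summable_nat_add_iff 1).2 (summable_half (K * (2 * (‖z‖ + 1))))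
    refine (differentiableOn_tsum_of_summable_norm hsum (U := ball (0 : ℂ) (‖a0‖ + 1))
      (fun n => ?_) hU (fun n a ha => ?_)).differentiableAt (hU.mem_nhds (by simp))
    · exact (((cf_diff b c0 c1 (n + 1)).const_mul _).mul_const _).differentiableOn
    · have : ‖a‖ ≤ ‖a0‖ + 1 := by simpa using (mem_ball_zero_iff.1 ha).le
      have h3 := cf_bound (b := b) (a := a) h0 h1 (K := K) (by simp only [K]; linarith [norm_nonneg a0, norm_nonneg b]) (by simp only [K]; linarith) (n + 1)
      rw [norm_mul, norm_mul, norm_pow, mul_pow, mul_div_right_comm, Complex.norm_natCast]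
      have h1 : ((n + 1 : ℕ) : ℝ) ≤ 2 ^ (n + 1) := by
        exact_mod_cast (Nat.lt_two_pow_self (n := n + 1)).le
      have h2 : ‖z‖ ^ n ≤ (‖z‖ + 1) ^ (n + 1) := by
        calc ‖z‖ ^ n ≤ (‖z‖ + 1) ^ n := by gcongr; linarith
          _ ≤ (‖z‖ + 1) ^ (n + 1) := pow_le_pow_right₀ (by linarith [norm_nonneg z]) (by omega)
      rw [mul_comm ((n + 1 : ℕ) : ℝ), mul_assoc, mul_pow]
      gcongr

end WKB

namespace WKB
open Complex Metric Filter Topology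

/-- the principal square root of `e - i z²`. -/
noncomputable def sq (e z : ℂ) : ℂ := (e - I * z ^ 2) ^ (1 / 2 : ℂ)

lemma sqrt_sq (w : ℂ) : (w ^ (1 / 2 : ℂ)) ^ 2 = w := by
  rw [one_div]; exact cpow_ofNat_inv_pow w 2

lemma sqrt_re {w : ℂ} (hw : 81 ≤ w.re) : 9 ≤ (w ^ (1 / 2 : ℂ)).re := by
  rw [one_div, cpow_inv_two_re]
  apply Real.le_sqrt_of_sq_le
  have := re_le_norm w
  linarith

lemma sqrt_deriv {w : ℂ} (hw : 0 < w.re) :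
    HasDerivAt (fun w : ℂ => w ^ (1 / 2 : ℂ)) (1 / (2 * w ^ (1 / 2 : ℂ))) w := by
  have hs : w ∈ slitPlane := Or.inl hw
  have hw0 : w ≠ 0 := slitPlane_ne_zero hs
  have h := (hasDerivAt_id w).cpow_const (c := 1 / 2) hs
  refine HasDerivAt.congr_deriv (f := fun w : ℂ => w ^ (1 / 2 : ℂ)) h ?_
  have h2 := sqrt_sq w
  have h3 : w ^ (1 / 2 : ℂ) ≠ 0 := by
    intro h0; rw [h0] at h2; exact hw0 (by rw [← h2]; simp)
  change 1 / 2 * w ^ (1 / 2 - 1 : ℂ) * 1 = _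
  rw [cpow_sub _ _ hw0, cpow_one, mul_one]
  generalize w ^ (1 / 2 : ℂ) = v at *
  rw [← h2]
  field_simp

lemma Q_re {e z : ℂ} (he : 90 ≤ e.re) (hz : ‖z‖ ≤ 3) : 81 ≤ (e - I * z ^ 2).re := by
  have h1 : (I * z ^ 2).re ≤ ‖I * z ^ 2‖ := re_le_norm _
  have h2 : ‖I * z ^ 2‖ ≤ 9 := by
    rw [norm_mul, norm_I, norm_pow, one_mul]; nlinarith [norm_nonneg z]
  rw [sub_re]; linarith

lemma sq_sq (e z : ℂ) : sq e z ^ 2 = e - I * z ^ 2 := sqrt_sq _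

lemma sq_re {e z : ℂ} (he : 90 ≤ e.re) (hz : ‖z‖ ≤ 3) : 9 ≤ (sq e z).re := sqrt_re (Q_re he hz)

lemma sq_norm {e z : ℂ} (he : 90 ≤ e.re) (hz : ‖z‖ ≤ 3) : 9 ≤ ‖sq e z‖ :=
  (sq_re he hz).trans (re_le_norm _)

lemma sq_ne {e z : ℂ} (he : 90 ≤ e.re) (hz : ‖z‖ ≤ 3) : sq e z ≠ 0 := by
  intro h
  have := sq_norm he hz
  rw [h] at this; simp at this; linarith

lemma sq_deriv {e z : ℂ} (he : 90 ≤ e.re) (hz : ‖z‖ ≤ 3) :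
    HasDerivAt (sq e) (- I * z / sq e z) z := by
  have h1 : HasDerivAt (fun z : ℂ => e - I * z ^ 2) (-(I * (2 * z))) z := by
    have := ((hasDerivAt_pow 2 z).const_mul I).const_sub e
    simpa using this
  have h2 := sqrt_deriv (w := e - I * z ^ 2) (by linarith [Q_re he hz])
  have h3 := h2.comp z h1
  have h4 := sq_ne he hz
  refine h3.congr_deriv ?_
  change 1 / (2 * sq e z) * _ = _
  field_simp

lemma sq_deriv_e {e z : ℂ} (he : 90 ≤ e.re) (hz : ‖z‖ ≤ 3) :
    HasDerivAt (fun e => sq e z) (1 / (2 * sq e z)) e := by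
  have h1 : HasDerivAt (fun e : ℂ => e - I * z ^ 2) 1 e := (hasDerivAt_id e).sub_const _
  have h2 := sqrt_deriv (w := e - I * z ^ 2) (by linarith [Q_re he hz])
  have h3 := h2.comp e h1
  rw [mul_one] at h3
  exact h3

lemma sq_sub {e z : ℂ} (he : 90 ≤ e.re) (hz : ‖z‖ ≤ 3) : ‖sq e z - sq e 0‖ ≤ 1 / 2 := by
  have h1 : (sq e z - sq e 0) * (sq e z + sq e 0) = - (I * z ^ 2) := by
    have e1 := sq_sq e z
    have e2 := sq_sq e 0
    linear_combination e1 - e2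
  have h2 : ‖sq e z - sq e 0‖ * ‖sq e z + sq e 0‖ ≤ 9 := by
    rw [← norm_mul, h1, norm_neg, norm_mul, norm_I, norm_pow, one_mul]; nlinarith [norm_nonneg z]
  have h3 : 18 ≤ ‖sq e z + sq e 0‖ := by
    have := sq_re he hz
    have := sq_re (z := 0) he (by simp)
    have := re_le_norm (sq e z + sq e 0)
    rw [add_re] at this
    linarith
  nlinarith [norm_nonneg (sq e z - sq e 0)]

lemma path {e : ℂ} (he : 90 ≤ e.re) {a b : ℝ} (ha : |a| ≤ 1) (hb : |b| ≤ 1) :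
    ∃ γ : ℝ → ℂ, γ 0 = a ∧ γ 1 = b ∧ ∀ t ∈ Set.Icc (0 : ℝ) 1, ‖γ t‖ ≤ 2 ∧
      HasDerivAt γ ((∫ x in a..b, sq e x) / sq e (γ t)) t ∧
      ‖(∫ x in a..b, sq e x) / sq e (γ t)‖ ≤ 3 := by
  have hball : ∀ z ∈ ball (0 : ℂ) 3, ‖z‖ ≤ 3 := fun z hz => by simpa using (mem_ball_zero_iff.1 hz).le
  have hs0 := sq_norm (z := 0) he (by simp)
  have hs0' := sq_ne (z := 0) he (by simp)
  have hex : IsExactOn (fun z => sq e z / sq e 0) (ball 0 3) := by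
    apply DifferentiableOn.isExactOn_ball
    intro z hz
    exact ((sq_deriv he (hball z hz)).div_const _).differentiableAt.differentiableWithinAt
  obtain ⟨T, hT⟩ := hex
  -- FTC
  have hL : (∫ x in a..b, sq e x) = sq e 0 * (T b - T a) := by
    have hmem : ∀ x ∈ Set.uIcc a b, ‖(x : ℂ)‖ < 3 := by
      intro x hx
      rw [norm_real, Real.norm_eq_abs]
      have h1 := abs_le.1 ha
      have h2 := abs_le.1 hb
      have := Set.uIcc_subset_Icc (a₂ := -1) (b₂ := 1) ⟨h1.1, h1.2⟩ ⟨h2.1, h2.2⟩ hx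
      have : |x| ≤ 1 := abs_le.2 ⟨this.1, this.2⟩
      linarith
    have h1 : ∀ x ∈ Set.uIcc a b, HasDerivAt (fun x : ℝ => sq e 0 * T x) (sq e x) x := by
      intro x hx
      have := ((hT x (mem_ball_zero_iff.2 (hmem x hx))).comp_ofReal).const_mul (sq e 0)
      refine this.congr_deriv ?_
      field_simp
    rw [intervalIntegral.integral_eq_sub_of_hasDerivAt h1]
    · ring
    · apply ContinuousOn.intervalIntegrable
      intro x hx
      exact ((sq_deriv he (hmem x hx).le).continuousAt.comp
        continuous_ofReal.continuousAt).continuousWithinAt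
  have happ : ApproximatesLinearOn T ((ContinuousLinearEquiv.refl ℂ ℂ : ℂ ≃L[ℂ] ℂ) : ℂ →L[ℂ] ℂ) (ball 0 3) (1 / 18) := by
    rw [ApproximatesLinearOn]
    intro x hx y hy
    have h := (convex_ball (0 : ℂ) 3).norm_image_sub_le_of_norm_hasDerivWithin_le
      (f := fun z => T z - z) (f' := fun z => sq e z / sq e 0 - 1) (C := 1 / 18)
      (fun z hz => ((hT z hz).sub (hasDerivAt_id z)).hasDerivWithinAt)
      (fun z hz => ?_) hy hx
    · simp only [ContinuousLinearEquiv.coe_coe, ContinuousLinearEquiv.coe_refl', id]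
      have e1 : T x - T y - (x - y) = (T x - x) - (T y - y) := by ring
      rw [e1]
      simpa using h
    · rw [div_sub_one hs0', norm_div, div_le_iff₀ (by linarith)]
      have := sq_sub he (hball z hz)
      linarith
  have hN : ‖((ContinuousLinearEquiv.refl ℂ ℂ : ℂ ≃L[ℂ] ℂ).symm : ℂ →L[ℂ] ℂ)‖₊ = 1 := by
    simp
  have hc : Subsingleton ℂ ∨ (1 / 18 : NNReal) < ‖((ContinuousLinearEquiv.refl ℂ ℂ : ℂ ≃L[ℂ] ℂ).symm : ℂ →L[ℂ] ℂ)‖₊⁻¹ := by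
    right
    rw [hN]
    rw [← NNReal.coe_lt_coe]; norm_num
  have hsurj := happ.surjOn_closedBall_of_nonlinearRightInverse
    (ContinuousLinearEquiv.refl ℂ ℂ : ℂ ≃L[ℂ] ℂ).toNonlinearRightInverse (ε := 2) (b := 0) (by norm_num)
    (closedBall_subset_ball (by norm_num))
  have hrad : (((ContinuousLinearEquiv.refl ℂ ℂ : ℂ ≃L[ℂ] ℂ).toNonlinearRightInverse.nnnorm : ℝ)⁻¹ - ((1 / 18 : NNReal) : ℝ)) * 2 = 17 / 9 := by
    have : (ContinuousLinearEquiv.refl ℂ ℂ : ℂ ≃L[ℂ] ℂ).toNonlinearRightInverse.nnnorm = 1 := hN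
    rw [this]; norm_num
  rw [hrad] at hsurj
  have hlip : ∀ x ∈ ball (0 : ℂ) 3, ∀ y ∈ ball (0 : ℂ) 3, ‖T x - T y‖ ≤ 19 / 18 * ‖x - y‖ := by
    intro x hx y hy
    have := happ x hx y hy
    simp only [ContinuousLinearEquiv.coe_coe, ContinuousLinearEquiv.coe_refl', id] at this
    have h2 : T x - T y = (T x - T y - (x - y)) + (x - y) := by ring
    rw [h2]
    refine (norm_add_le _ _).trans ?_
    norm_num at this
    linarith
  set H := happ.toOpenPartialHomeomorph T (ball 0 3) hc isOpen_ball with hH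
  have hHc : ∀ z, H z = T z := fun z => rfl
  have hsrc : H.source = ball 0 3 := rfl
  have haB : (a : ℂ) ∈ ball (0 : ℂ) 3 := by
    rw [mem_ball_zero_iff, norm_real, Real.norm_eq_abs]; linarith
  have hbB : (b : ℂ) ∈ ball (0 : ℂ) 3 := by
    rw [mem_ball_zero_iff, norm_real, Real.norm_eq_abs]; linarith
  have hin : ∀ c : ℝ, |c| ≤ 1 → T c ∈ closedBall (T 0) (17 / 9) := by
    intro c hc
    have hcB : (c : ℂ) ∈ ball (0 : ℂ) 3 := by
      rw [mem_ball_zero_iff, norm_real, Real.norm_eq_abs]; linarith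
    have := hlip c hcB 0 (by simp)
    rw [mem_closedBall, dist_eq_norm]
    rw [sub_zero, norm_real, Real.norm_eq_abs] at this
    linarith
  have hTab : ‖T b - T a‖ ≤ 19 / 9 := by
    have := hlip b hbB a haB
    rw [← ofReal_sub, norm_real, Real.norm_eq_abs] at this
    have := abs_sub b a
    linarith
  refine ⟨fun t => H.symm (T a + t * (T b - T a)), ?_, ?_, ?_⟩
  · simp only [ofReal_zero, zero_mul, add_zero]
    exact H.left_inv haB
  · simp only [ofReal_one, one_mul, add_sub_cancel]
    exact H.left_inv hbB
  · intro t ht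
    have hmem : T a + t * (T b - T a) ∈ closedBall (T 0) (17 / 9) := by
      have := (convex_closedBall (T 0) (17 / 9)).add_smul_sub_mem (hin a ha) (hin b hb) ht
      simpa using this
    obtain ⟨z, hz, hTz⟩ := hsurj hmem
    have hzB : z ∈ ball (0 : ℂ) 3 := closedBall_subset_ball (by norm_num) hz
    have hz2 : ‖z‖ ≤ 2 := by simpa using hz
    have hzeq : H.symm (T a + t * (T b - T a)) = z := by
      rw [← hTz]; exact H.left_inv hzB
    have htgt : T a + t * (T b - T a) ∈ H.target := by
      rw [← hTz]; exact H.map_source hzB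
    have hsz := sq_ne he (z := z) (by linarith)
    have hd : HasDerivAt H.symm (sq e z / sq e 0)⁻¹ (T a + t * (T b - T a)) := by
      apply H.hasDerivAt_symm htgt (div_ne_zero hsz hs0')
      rw [hzeq]
      exact hT z hzB
    beta_reduce
    rw [hzeq, hL]
    refine ⟨hz2, ?_, ?_⟩
    · have hin : HasDerivAt (fun t : ℝ => T a + t * (T b - T a)) (T b - T a) t := by
        have := ((hasDerivAt_id t).ofReal_comp.mul_const (T b - T a)).const_add (T a)
        simpa using this
      have := hd.comp t hin
      refine this.congr_deriv ?_
      field_simp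
    · rw [norm_div, norm_mul, div_le_iff₀ (norm_pos_iff.2 hsz)]
      have h1 := sq_sub he (z := z) (by linarith)
      have h2 := norm_sub_norm_le (sq e 0) (sq e z)
      rw [norm_sub_rev] at h2
      have h3 := sq_norm he (z := z) (by linarith)
      nlinarith [norm_nonneg (T b - T a), norm_nonneg (sq e 0)]
end WKB

namespace WKB
open Complex Metric Filter Topology

lemma abs_ode {P M l s : ℝ → ℂ} {k : ℂ} (hk : 0 ≤ k.im)
    (hP : ∀ t ∈ Set.Icc (0 : ℝ) 1, HasDerivAt P (2 * I * k * P t + l t * (P t - M t)) t)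
    (hM : ∀ t ∈ Set.Icc (0 : ℝ) 1, HasDerivAt M (-(l t * (P t - M t))) t)
    (hs : ∀ t ∈ Set.Icc (0 : ℝ) 1, HasDerivAt s (2 * l t * s t) t)
    (hl : ∀ t ∈ Set.Icc (0 : ℝ) 1, ‖l t‖ ≤ 1 / 4)
    (hs9 : ∀ t ∈ Set.Icc (0 : ℝ) 1, 9 ≤ ‖s t‖) (hP0 : P 0 = 1) (hM0 : M 0 = 1) :
    ‖P 1‖ ≤ 3 ∧ ‖M 1‖ ≤ 3 ∧
      (0 < k.im → ‖P 1‖ ≤ 2 / k.im ∧ ‖M 1 ^ 2 / s 1 - 1 / s 0‖ ≤ 2 / k.im) := by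
  have hIco : ∀ t ∈ Set.Ico (0 : ℝ) 1, t ∈ Set.Icc (0 : ℝ) 1 := fun t ht => ⟨ht.1, ht.2.le⟩
  have one_mem : (1 : ℝ) ∈ Set.Icc (0 : ℝ) 1 := by simp
  -- energy
  have hN : ∀ t ∈ Set.Icc (0 : ℝ) 1, (‖P t‖ ^ 2 + ‖M t‖ ^ 2) * Real.exp (-t) ≤ 2 := by
    have hd : ∀ t ∈ Set.Icc (0 : ℝ) 1, HasDerivAt (fun t => (‖P t‖ ^ 2 + ‖M t‖ ^ 2) * Real.exp (-t))
        ((2 * inner ℝ (P t) (2 * I * k * P t + l t * (P t - M t)) + 2 * inner ℝ (M t) (-(l t * (P t - M t)))) * Real.exp (-t)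
          + (‖P t‖ ^ 2 + ‖M t‖ ^ 2) * (-Real.exp (-t))) t := by
      intro t ht
      have h1 := ((hP t ht).norm_sq.add (hM t ht).norm_sq)
      have h2 : HasDerivAt (fun t : ℝ => Real.exp (-t)) (-Real.exp (-t)) t := by
        have := (hasDerivAt_neg t).exp
        simpa using this
      exact h1.mul h2
    intro t ht
    refine image_le_of_deriv_right_le_deriv_boundary (B := fun _ => 2) (B' := fun _ => 0)
      (fun t ht => (hd t ht).continuousAt.continuousWithinAt)
      (fun t ht => (hd t (hIco t ht)).hasDerivWithinAt) ?_ continuousOn_const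
      (fun t _ => hasDerivWithinAt_const _ _ _) ?_ ht
    · simp [hP0, hM0]; norm_num
    · intro t ht
      have e1 : inner ℝ (P t) (2 * I * k * P t + l t * (P t - M t)) + inner ℝ (M t) (-(l t * (P t - M t)))
          = -2 * k.im * ‖P t‖ ^ 2 + inner ℝ (P t - M t) (l t * (P t - M t)) := by
        rw [inner_add_right, inner_neg_right, inner_sub_left]
        have : inner ℝ (P t) (2 * I * k * P t) = -2 * k.im * ‖P t‖ ^ 2 := by
          rw [Complex.sq_norm, normSq_apply, Complex.inner]
          simp
          ring
        rw [this]; ring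
      have e2 : inner ℝ (P t - M t) (l t * (P t - M t)) ≤ 1 / 4 * ‖P t - M t‖ ^ 2 := by
        refine (real_inner_le_norm _ _).trans ?_
        rw [norm_mul]
        have := hl t (hIco t ht)
        nlinarith [sq_nonneg ‖P t - M t‖]
      have e3 : ‖P t - M t‖ ^ 2 ≤ 2 * (‖P t‖ ^ 2 + ‖M t‖ ^ 2) := by
        have h1 := norm_sub_le (P t) (M t)
        have h2 : ‖P t - M t‖ ^ 2 ≤ (‖P t‖ + ‖M t‖) ^ 2 := by gcongr
        nlinarith [sq_nonneg (‖P t‖ - ‖M t‖)]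
      have e4 : 0 ≤ k.im * ‖P t‖ ^ 2 := by positivity
      have e5 : 2 * inner ℝ (P t) (2 * I * k * P t + l t * (P t - M t)) + 2 * inner ℝ (M t) (-(l t * (P t - M t)))
          ≤ ‖P t‖ ^ 2 + ‖M t‖ ^ 2 := by linarith
      have := Real.exp_pos (-t)
      nlinarith
  have hN2 : ∀ t ∈ Set.Icc (0 : ℝ) 1, ‖P t‖ ^ 2 + ‖M t‖ ^ 2 ≤ 9 := by
    intro t ht
    have h1 := hN t ht
    have h2 : Real.exp (-1) ≤ Real.exp (-t) := Real.exp_le_exp.2 (by linarith [ht.2])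
    have h3 : 2 / 9 ≤ Real.exp (-1) := by
      have := Real.exp_one_lt_d9
      rw [Real.exp_neg, ← one_div, div_le_div_iff₀ (by norm_num) (Real.exp_pos 1)]; linarith
    nlinarith [sq_nonneg ‖P t‖, sq_nonneg ‖M t‖]
  have hP3 : ∀ t ∈ Set.Icc (0 : ℝ) 1, ‖P t‖ ≤ 3 := fun t ht => by
    have := hN2 t ht
    nlinarith [norm_nonneg (P t), sq_nonneg ‖M t‖]
  have hM3 : ∀ t ∈ Set.Icc (0 : ℝ) 1, ‖M t‖ ≤ 3 := fun t ht => by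
    have := hN2 t ht
    nlinarith [norm_nonneg (M t), sq_nonneg ‖P t‖]
  refine ⟨hP3 1 one_mem, hM3 1 one_mem, fun hκ => ?_⟩
  set κ := k.im with hκd
  have hexpn : ∀ t : ℝ, ‖exp (-2 * I * k * t)‖ = Real.exp (2 * κ * t) := by
    intro t
    rw [Complex.norm_exp]
    congr 1
    simp [hκd]
  have hPd : ∀ t ∈ Set.Icc (0 : ℝ) 1, ‖P t‖ ≤ Real.exp (-(2 * κ * t)) + 1 / κ := by
    have hd : ∀ t ∈ Set.Icc (0 : ℝ) 1, HasDerivAt (fun t : ℝ => exp (-2 * I * k * t) * P t)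
        (exp (-2 * I * k * t) * (l t * (P t - M t))) t := by
      intro t ht
      have h1 : HasDerivAt (fun t : ℝ => exp (-2 * I * k * t)) (exp (-2 * I * k * t) * (-2 * I * k)) t := by
        have := ((hasDerivAt_id t).ofReal_comp.const_mul (-2 * I * k)).cexp
        simpa using this
      refine (h1.mul (hP t ht)).congr_deriv ?_
      ring
    have hB : ∀ t : ℝ, HasDerivAt (fun t => 1 + Real.exp (2 * κ * t) / κ) (2 * Real.exp (2 * κ * t)) t := by
      intro t
      have := ((((hasDerivAt_id t).const_mul (2 * κ)).exp).div_const κ).const_add 1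
      refine this.congr_deriv ?_
      simp; field_simp
    intro t ht
    have := image_norm_le_of_norm_deriv_right_le_deriv_boundary
      (fun t ht => (hd t ht).continuousAt.continuousWithinAt)
      (fun t ht => (hd t (hIco t ht)).hasDerivWithinAt) (B := fun t => 1 + Real.exp (2 * κ * t) / κ)
      (by simp [hP0]; positivity) hB (fun t ht => ?_) ht
    · rw [norm_mul, hexpn] at this
      have hpos := Real.exp_pos (2 * κ * t)
      rw [Real.exp_neg]
      rw [← mul_le_mul_iff_right₀ hpos]
      refine this.trans (le_of_eq ?_)
      field_simp
    · rw [norm_mul, hexpn, norm_mul]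
      have h1 := hl t (hIco t ht)
      have h2 := (norm_sub_le (P t) (M t)).trans (add_le_add (hP3 t (hIco t ht)) (hM3 t (hIco t ht)))
      have hpos := Real.exp_pos (2 * κ * t)
      have : ‖l t‖ * ‖P t - M t‖ ≤ 1 / 4 * 6 := by
        have := norm_nonneg (P t - M t)
        gcongr; linarith
      nlinarith
  constructor
  · refine (hPd 1 one_mem).trans ?_
    have h1 := Real.add_one_le_exp (2 * κ * 1)
    rw [Real.exp_neg]
    have h2 : (Real.exp (2 * κ * 1))⁻¹ ≤ κ⁻¹ := inv_anti₀ hκ (by linarith)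
    rw [one_div, div_eq_mul_inv]; linarith
  · have hs0 : ∀ t ∈ Set.Icc (0 : ℝ) 1, s t ≠ 0 := fun t ht h => by
      have := hs9 t ht; rw [h] at this; simp at this; linarith
    have hd : ∀ t ∈ Set.Icc (0 : ℝ) 1, HasDerivAt (fun t : ℝ => M t ^ 2 / s t - 1 / s 0)
        (-(2 * l t * M t * P t / s t)) t := by
      intro t ht
      have := ((((hM t ht).pow 2).div (hs t ht) (hs0 t ht)).sub_const (1 / s 0))
      refine this.congr_deriv ?_
      have := hs0 t ht
      simp
      field_simp
      ring
    have hB : ∀ t : ℝ, HasDerivAt (fun t => (1 - Real.exp (-(2 * κ * t))) / (2 * κ) + t / κ)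
        (Real.exp (-(2 * κ * t)) + 1 / κ) t := by
      intro t
      have := (((((hasDerivAt_id t).const_mul (2 * κ)).neg.exp).const_sub 1).div_const (2 * κ)).add
        ((hasDerivAt_id t).div_const κ)
      refine this.congr_deriv ?_
      simp
      field_simp
    have := image_norm_le_of_norm_deriv_right_le_deriv_boundary
      (fun t ht => (hd t ht).continuousAt.continuousWithinAt)
      (fun t ht => (hd t (hIco t ht)).hasDerivWithinAt)
      (B := fun t => (1 - Real.exp (-(2 * κ * t))) / (2 * κ) + t / κ)
      (by simp [hM0]) hB (fun t ht => ?_) one_mem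
    · refine this.trans ?_
      have hpos := Real.exp_pos (-(2 * κ * 1))
      have h1 : (1 - Real.exp (-(2 * κ * 1))) / (2 * κ) ≤ 1 / κ := by
        rw [div_le_div_iff₀ (by positivity) hκ]; nlinarith
      have : 2 / κ = 1 / κ + 1 / κ := by ring
      linarith
    · refine le_trans ?_ (hPd t (hIco t ht))
      have h1 := hl t (hIco t ht)
      have h2 := hM3 t (hIco t ht)
      have h3 := hs9 t (hIco t ht)
      rw [norm_neg, norm_div, norm_mul, norm_mul, norm_mul, div_le_iff₀ (by linarith)]
      have h4 : ‖l t‖ * ‖M t‖ ≤ 1 / 4 * 3 := by gcongr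
      have h5 : ‖(2 : ℂ)‖ = 2 := by simp
      rw [h5]
      nlinarith [norm_nonneg (P t)]

lemma one_sided {e : ℂ} (he : 90 ≤ e.re) {a b : ℝ} (ha : |a| ≤ 1) (hb : |b| ≤ 1) {h : ℝ} (hh : 0 < h)
    {σ : ℂ} (hσ : σ = 1 ∨ σ = -1) (hL : 0 ≤ (σ * ∫ x in a..b, sq e x).im) {u u' : ℂ → ℂ}
    (hu : ∀ z, HasDerivAt u (u' z) z)
    (hu' : ∀ z, HasDerivAt u' ((-e / h ^ 2 + I / h ^ 2 * z ^ 2) * u z) z)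
    (hua : u a = 0) (hua' : h * u' a = 1) {P M : ℂ}
    (hP : P = exp (I * (σ * (∫ x in a..b, sq e x) / h)) * (h * u' b + I * (σ * sq e b) * u b))
    (hM : M = exp (I * (σ * (∫ x in a..b, sq e x) / h)) * (h * u' b - I * (σ * sq e b) * u b)) :
    ‖P‖ ≤ 3 ∧ ‖M‖ ≤ 3 ∧
      (0 < (σ * ∫ x in a..b, sq e x).im →
        ‖P‖ ≤ 2 / ((σ * ∫ x in a..b, sq e x).im / h) ∧
        ‖M ^ 2 / (σ * sq e b) - 1 / (σ * sq e a)‖ ≤ 2 / ((σ * ∫ x in a..b, sq e x).im / h)) := by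
  obtain ⟨γ, hγ0, hγ1, hγ⟩ := path he ha hb
  generalize (∫ x in a..b, sq e x) = L at *
  have hσ2 : σ ^ 2 = 1 := by rcases hσ with rfl | rfl <;> norm_num
  have hσn : ‖σ‖ = 1 := by rcases hσ with rfl | rfl <;> simp
  have hσ0 : σ ≠ 0 := by intro h0; simp [h0] at hσn
  have hhc : (h : ℂ) ≠ 0 := by exact_mod_cast hh.ne'
  set k : ℂ := σ * L / h with hk
  have hkim : k.im = (σ * L).im / h := by rw [hk, div_ofReal_im]
  have key := abs_ode (k := k)
    (P := fun t : ℝ => exp (I * k * t) * (h * u' (γ t) + I * (σ * sq e (γ t)) * u (γ t)))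
    (M := fun t : ℝ => exp (I * k * t) * (h * u' (γ t) - I * (σ * sq e (γ t)) * u (γ t)))
    (s := fun t : ℝ => σ * sq e (γ t))
    (l := fun t : ℝ => -(I * γ t * (L / sq e (γ t)) / (2 * sq e (γ t) ^ 2)))
    (by rw [hkim]; positivity) ?_ ?_ ?_ ?_ ?_ ?_ ?_
  · beta_reduce at key
    have e1 : exp (I * k * ((1 : ℝ) : ℂ)) = exp (I * k) := by simp
    rw [hγ0, hγ1, e1, ← hP, ← hM, hkim] at key
    refine ⟨key.1, key.2.1, fun hpos => ?_⟩
    exact key.2.2 (by positivity)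
  · intro t ht
    obtain ⟨hz2, hd, hD⟩ := hγ t ht
    have hs := sq_ne he (z := γ t) (by linarith)
    have hsq := sq_sq e (γ t)
    have d1 : HasDerivAt (fun t : ℝ => exp (I * k * t)) (exp (I * k * t) * (I * k)) t := by
      have := ((hasDerivAt_id t).ofReal_comp.const_mul (I * k)).cexp
      simpa using this
    have d2 := (hu' (γ t)).comp t hd
    have d3 := (hu (γ t)).comp t hd
    have d4 := (sq_deriv he (z := γ t) (by linarith)).comp t hd
    refine (d1.mul ((d2.const_mul (h : ℂ)).add (((d4.const_mul σ).const_mul I).mul d3))).congr_deriv ?_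
    simp only [Function.comp, Pi.add_apply, Pi.mul_apply]
    rw [hk]
    have hq : (-e / (h : ℂ) ^ 2 + I / h ^ 2 * γ t ^ 2) = -(sq e (γ t)) ^ 2 / h ^ 2 := by
      rw [hsq]; field_simp; ring
    rw [hq]
    generalize exp _ = X
    generalize u (γ t) = U
    generalize u' (γ t) = V
    generalize sq e (γ t) = s at *
    field_simp
    rcases hσ with rfl | rfl <;> ring_nf <;> simp only [I_sq] <;> ring
  · intro t ht
    obtain ⟨hz2, hd, hD⟩ := hγ t ht
    have hs := sq_ne he (z := γ t) (by linarith)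
    have hsq := sq_sq e (γ t)
    have d1 : HasDerivAt (fun t : ℝ => exp (I * k * t)) (exp (I * k * t) * (I * k)) t := by
      have := ((hasDerivAt_id t).ofReal_comp.const_mul (I * k)).cexp
      simpa using this
    have d2 := (hu' (γ t)).comp t hd
    have d3 := (hu (γ t)).comp t hd
    have d4 := (sq_deriv he (z := γ t) (by linarith)).comp t hd
    refine (d1.mul ((d2.const_mul (h : ℂ)).sub (((d4.const_mul σ).const_mul I).mul d3))).congr_deriv ?_
    simp only [Function.comp, Pi.sub_apply, Pi.mul_apply]
    rw [hk]
    have hq : (-e / (h : ℂ) ^ 2 + I / h ^ 2 * γ t ^ 2) = -(sq e (γ t)) ^ 2 / h ^ 2 := by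
      rw [hsq]; field_simp; ring
    rw [hq]
    generalize exp _ = X
    generalize u (γ t) = U
    generalize u' (γ t) = V
    generalize sq e (γ t) = s at *
    field_simp
    rcases hσ with rfl | rfl <;> ring_nf <;> simp only [I_sq] <;> ring
  · intro t ht
    obtain ⟨hz2, hd, hD⟩ := hγ t ht
    have hs := sq_ne he (z := γ t) (by linarith)
    have d4 := (sq_deriv he (z := γ t) (by linarith)).comp t hd
    refine (d4.const_mul σ).congr_deriv ?_
    field_simp
  · intro t ht
    obtain ⟨hz2, hd, hD⟩ := hγ t ht
    have h9 := sq_norm he (z := γ t) (by linarith)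
    rw [norm_neg, norm_div, norm_mul, norm_mul, norm_I, one_mul, norm_mul, norm_pow, Complex.norm_ofNat,
      div_le_iff₀ (by positivity)]
    have : ‖γ t‖ * ‖L / sq e (γ t)‖ ≤ 2 * 3 := by gcongr
    nlinarith
  · intro t ht
    obtain ⟨hz2, hd, hD⟩ := hγ t ht
    have h9 := sq_norm he (z := γ t) (by linarith)
    rw [norm_mul, hσn, one_mul]; exact h9
  · simp [hγ0, hua, hua']
  · simp [hγ0, hua, hua']
end WKB


namespace WKB
open Complex Metric Filter Topology

lemma exists_u (h : ℝ) (hh : 0 < h) (x0 : ℝ) : ∃ u u' : ℂ → ℂ → ℂ, (∀ e, u e x0 = 0) ∧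
    (∀ e, h * u' e x0 = 1) ∧ (∀ e z, HasDerivAt (u e) (u' e z) z) ∧
    (∀ e z, HasDerivAt (u' e) ((-e / h ^ 2 + I / h ^ 2 * z ^ 2) * u e z) z) ∧
    (∀ z, Differentiable ℂ (fun e => u e z)) ∧ (∀ z, Differentiable ℂ (fun e => u' e z)) := by
  obtain ⟨C, C', hC0, hC, hC', hCa, hCa'⟩ := exists_sol (I / h ^ 2) 1 0 (by simp) (by simp)
  obtain ⟨S, S', hS0, hS, hS', hSa, hSa'⟩ := exists_sol (I / h ^ 2) 0 1 (by simp) (by simp)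
  have hhc : (h : ℂ) ≠ 0 := by exact_mod_cast hh.ne'
  have hW : ∀ a z, C a z * S' a z - S a z * C' a z = 1 := by
    intro a z
    have hd : ∀ z, HasDerivAt (fun z => C a z * S' a z - S a z * C' a z) 0 z := by
      intro z
      refine (((hC a z).mul (hS' a z)).sub ((hS a z).mul (hC' a z))).congr_deriv ?_
      ring
    have := is_const_of_deriv_eq_zero (fun z => (hd z).differentiableAt) (fun z => (hd z).deriv) z 0
    rw [this]; simp [hC0, hS0]
  have hda : Differentiable ℂ (fun e : ℂ => -e / (h : ℂ) ^ 2) := by fun_prop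
  refine ⟨fun e z => 1 / h * (C (-e / h ^ 2) x0 * S (-e / h ^ 2) z - S (-e / h ^ 2) x0 * C (-e / h ^ 2) z),
    fun e z => 1 / h * (C (-e / h ^ 2) x0 * S' (-e / h ^ 2) z - S (-e / h ^ 2) x0 * C' (-e / h ^ 2) z),
    ?_, ?_, ?_, ?_, ?_, ?_⟩
  · intro e; ring
  · intro e; beta_reduce; rw [hW]; field_simp
  · intro e z
    exact ((((hS _ z).const_mul _).sub ((hC _ z).const_mul _)).const_mul _)
  · intro e z
    refine ((((hS' _ z).const_mul _).sub ((hC' _ z).const_mul _)).const_mul _).congr_deriv ?_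
    ring
  · intro z
    have h1 := (hCa x0).comp hda
    have h2 := (hSa x0).comp hda
    have h3 := (hCa z).comp hda
    have h4 := (hSa z).comp hda
    exact ((h1.mul h4).sub (h2.mul h3)).const_mul _
  · intro z
    have h1 := (hCa x0).comp hda
    have h2 := (hSa x0).comp hda
    have h3 := (hCa' z).comp hda
    have h4 := (hSa' z).comp hda
    exact ((h1.mul h4).sub (h2.mul h3)).const_mul _

open Classical in
/-- solution with `u x0 = 0` and `h u' x0 = 1`. -/
noncomputable def U (h x0 : ℝ) : ℂ → ℂ → ℂ :=
  if hh : 0 < h then (exists_u h hh x0).choose else fun _ _ => 0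

open Classical in
/-- derivative of `U`. -/
noncomputable def U' (h x0 : ℝ) : ℂ → ℂ → ℂ :=
  if hh : 0 < h then (exists_u h hh x0).choose_spec.choose else fun _ _ => 0

lemma U_spec {h : ℝ} (hh : 0 < h) (x0 : ℝ) : (∀ e, U h x0 e x0 = 0) ∧
    (∀ e, h * U' h x0 e x0 = 1) ∧ (∀ e z, HasDerivAt (U h x0 e) (U' h x0 e z) z) ∧
    (∀ e z, HasDerivAt (U' h x0 e) ((-e / h ^ 2 + I / h ^ 2 * z ^ 2) * U h x0 e z) z) ∧
    (∀ z, Differentiable ℂ (fun e => U h x0 e z)) ∧ (∀ z, Differentiable ℂ (fun e => U' h x0 e z)) := by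
  unfold U U'
  simp only [hh, dif_pos]
  exact (exists_u h hh x0).choose_spec.choose_spec

/-- the characteristic function -/
noncomputable def F (β δ h : ℝ) (E : ℂ) : ℂ :=
  U h (-1) (E + I * δ) β * (h * U' h 1 (E - I * δ) β) -
    h * U' h (-1) (E + I * δ) β * U h 1 (E - I * δ) β

lemma F_diff {h : ℝ} (hh : 0 < h) (β δ : ℝ) : Differentiable ℂ (F β δ h) := by
  obtain ⟨-, -, -, -, h1, h2⟩ := U_spec hh (-1)
  obtain ⟨-, -, -, -, h3, h4⟩ := U_spec hh 1
  have ha : Differentiable ℂ (fun E : ℂ => E + I * δ) := by fun_prop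
  have hb : Differentiable ℂ (fun E : ℂ => E - I * δ) := by fun_prop
  exact (((h1 β).comp ha).mul (((h4 β).comp hb).const_mul _)).sub
    ((((h2 β).comp ha).const_mul _).mul ((h3 β).comp hb))

lemma wron {p q : ℝ} {c u u' v v' : ℝ → ℂ}
    (hu : ∀ x ∈ Set.Icc p q, HasDerivWithinAt u (u' x) (Set.Icc p q) x)
    (hu' : ∀ x ∈ Set.Icc p q, HasDerivWithinAt u' (c x * u x) (Set.Icc p q) x)
    (hv : ∀ x ∈ Set.Icc p q, HasDerivWithinAt v (v' x) (Set.Icc p q) x)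
    (hv' : ∀ x ∈ Set.Icc p q, HasDerivWithinAt v' (c x * v x) (Set.Icc p q) x)
    {x y : ℝ} (hx : x ∈ Set.Icc p q) (hy : y ∈ Set.Icc p q) :
    u x * v' x - u' x * v x = u y * v' y - u' y * v y := by
  have := (convex_Icc p q).norm_image_sub_le_of_norm_hasDerivWithin_le
    (f := fun x => u x * v' x - u' x * v x) (f' := fun _ => 0) (C := 0)
    (fun x hx => by
      refine (((hu x hx).mul (hv' x hx)).sub ((hu' x hx).mul (hv x hx))).congr_deriv ?_
      ring) (fun x _ => by simp) hy hx
  rw [zero_mul, norm_le_zero_iff, sub_eq_zero] at this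
  exact this

lemma U_real {h : ℝ} (hh : 0 < h) (x0 : ℝ) (e : ℂ) (s : Set ℝ) (x : ℝ) :
    HasDerivWithinAt (fun x : ℝ => U h x0 e x) (U' h x0 e x) s x ∧
    HasDerivWithinAt (fun x : ℝ => U' h x0 e x) ((-e / h ^ 2 + I / h ^ 2 * (x : ℂ) ^ 2) * U h x0 e x) s x := by
  obtain ⟨-, -, h1, h2, -, -⟩ := U_spec hh x0
  exact ⟨((h1 e x).comp_ofReal).hasDerivWithinAt, ((h2 e x).comp_ofReal).hasDerivWithinAt⟩

lemma zero_of_zero {h : ℝ} (hh : 0 < h) {p q : ℝ} {e : ℂ} {u u' : ℝ → ℂ}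
    (hu : ∀ x ∈ Set.Icc p q, HasDerivWithinAt u (u' x) (Set.Icc p q) x)
    (hu' : ∀ x ∈ Set.Icc p q, HasDerivWithinAt u' ((-e / h ^ 2 + I / h ^ 2 * (x : ℂ) ^ 2) * u x) (Set.Icc p q) x)
    {y : ℝ} (hy : y ∈ Set.Icc p q) (h0 : u y = 0) (h0' : u' y = 0) {x : ℝ} (hx : x ∈ Set.Icc p q) :
    u x = 0 := by
  have := wron hu hu' (fun z _ => (U_real hh x e _ z).1) (fun z _ => (U_real hh x e _ z).2) hy hx
  obtain ⟨h1, h2, -⟩ := U_spec hh x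
  rw [h0, h0', h1 e] at this
  simp only [zero_mul, sub_self, mul_zero, sub_zero] at this
  have h3 := h2 e
  rcases mul_eq_zero.1 this.symm with h4 | h4
  · exact h4
  · rw [h4] at h3; simp at h3

lemma U_ne {h : ℝ} (hh : 0 < h) {p q x0 : ℝ} (hpq : p < q) (hx0 : x0 ∈ Set.Icc p q) (e : ℂ) :
    ∃ x ∈ Set.Icc p q, U h x0 e x ≠ 0 := by
  by_contra! hc
  have h1 := (U_real hh x0 e (Set.Icc p q) x0).1
  have h2 : HasDerivWithinAt (fun x : ℝ => U h x0 e x) 0 (Set.Icc p q) x0 :=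
    (hasDerivWithinAt_const x0 _ (0 : ℂ)).congr hc (hc x0 hx0)
  have h3 := UniqueDiffWithinAt.eq_deriv _ (uniqueDiffOn_Icc hpq x0 hx0) h1 h2
  have := (U_spec hh x0).2.1 e
  rw [h3] at this
  simp at this

lemma U_ne' {h : ℝ} (hh : 0 < h) {p q x0 : ℝ} (hpq : p < q) (hx0 : x0 ∈ Set.Icc p q) (e : ℂ)
    {y : ℝ} (hy : y ∈ Set.Icc p q) (h0 : U h x0 e y = 0) (h0' : U' h x0 e y = 0) : False := by
  obtain ⟨x, hx, hne⟩ := U_ne hh hpq hx0 e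
  exact hne (zero_of_zero (u := fun x : ℝ => U h x0 e x) (u' := fun x : ℝ => U' h x0 e x) hh
    (fun z _ => (U_real hh x0 e _ z).1) (fun z _ => (U_real hh x0 e _ z).2) hy h0 h0' hx)

lemma F_of_eig {β δ h : ℝ} (hβ : β ∈ Set.Ioo (-1:ℝ) 1) (hh : 0 < h) {E : ℂ} {u u' ul'' ur'' : ℝ → ℂ}
    (hs : IsPiecewiseDirichletSol h β (fun x : ℝ => I * (x : ℂ) ^ 2 - I * δ)
      (fun x : ℝ => I * (x : ℂ) ^ 2 + I * δ) E u u' ul'' ur'')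
    (hne : ∃ x ∈ Set.Icc (-1:ℝ) 1, u x ≠ 0) : F β δ h E = 0 := by
  obtain ⟨hu, hu'c, hl, hlc, hr, hrc, hlo, hro, hu1, hu2⟩ := hs
  have hhc : (h : ℂ) ≠ 0 := by exact_mod_cast hh.ne'
  have hucont : ContinuousOn u (Set.Icc (-1:ℝ) 1) := fun x hx => (hu x hx).continuousWithinAt
  have hsl : Set.Icc (-1:ℝ) β ⊆ Set.Icc (-1:ℝ) 1 := Set.Icc_subset_Icc le_rfl hβ.2.le
  have hsr : Set.Icc β (1:ℝ) ⊆ Set.Icc (-1:ℝ) 1 := Set.Icc_subset_Icc hβ.1.le le_rfl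
  have hcoef : ∀ e : ℂ, Continuous (fun x : ℝ => (-e / (h : ℂ) ^ 2 + I / h ^ 2 * (x : ℂ) ^ 2)) := by
    intro e; fun_prop
  have el : Set.EqOn ul'' (fun x : ℝ => (-(E + I * δ) / (h : ℂ) ^ 2 + I / h ^ 2 * (x : ℂ) ^ 2) * u x)
      (Set.Icc (-1) β) := by
    refine Set.EqOn.of_subset_closure (s := Set.Ico (-1) β) ?_ hlc
      ((hcoef _).continuousOn.mul (hucont.mono hsl)) Set.Ico_subset_Icc_self ?_
    · intro x hx
      have := hlo x hx
      beta_reduce at this ⊢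
      field_simp
      linear_combination -this
    · rw [closure_Ico hβ.1.ne]
  have er : Set.EqOn ur'' (fun x : ℝ => (-(E - I * δ) / (h : ℂ) ^ 2 + I / h ^ 2 * (x : ℂ) ^ 2) * u x)
      (Set.Icc β 1) := by
    refine Set.EqOn.of_subset_closure (s := Set.Ioc β 1) ?_ hrc
      ((hcoef _).continuousOn.mul (hucont.mono hsr)) Set.Ioc_subset_Icc_self ?_
    · intro x hx
      have := hro x hx
      beta_reduce at this ⊢
      field_simp
      linear_combination -this
    · rw [closure_Ioc hβ.2.ne]
  have hul : ∀ x ∈ Set.Icc (-1:ℝ) β, HasDerivWithinAt u (u' x) (Set.Icc (-1:ℝ) β) x :=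
    fun x hx => (hu x (hsl hx)).mono hsl
  have hur : ∀ x ∈ Set.Icc β (1:ℝ), HasDerivWithinAt u (u' x) (Set.Icc β (1:ℝ)) x :=
    fun x hx => (hu x (hsr hx)).mono hsr
  have hul' : ∀ x ∈ Set.Icc (-1:ℝ) β, HasDerivWithinAt u'
      ((-(E + I * δ) / (h : ℂ) ^ 2 + I / h ^ 2 * (x : ℂ) ^ 2) * u x) (Set.Icc (-1:ℝ) β) x :=
    fun x hx => (hl x hx).congr_deriv (el hx)
  have hur' : ∀ x ∈ Set.Icc β (1:ℝ), HasDerivWithinAt u'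
      ((-(E - I * δ) / (h : ℂ) ^ 2 + I / h ^ 2 * (x : ℂ) ^ 2) * u x) (Set.Icc β (1:ℝ)) x :=
    fun x hx => (hr x hx).congr_deriv (er hx)
  have bl : β ∈ Set.Icc (-1:ℝ) β := ⟨hβ.1.le, le_rfl⟩
  have br : β ∈ Set.Icc β (1:ℝ) := ⟨le_rfl, hβ.2.le⟩
  by_contra hF
  have w1 := wron hul hul' (fun z _ => (U_real hh (-1) (E + I * δ) _ z).1)
    (fun z _ => (U_real hh (-1) (E + I * δ) _ z).2) bl (y := -1) ⟨le_rfl, hβ.1.le⟩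
  have w2 := wron hur hur' (fun z _ => (U_real hh 1 (E - I * δ) _ z).1)
    (fun z _ => (U_real hh 1 (E - I * δ) _ z).2) br (y := 1) ⟨hβ.2.le, le_rfl⟩
  rw [hu1, (U_spec hh (-1)).1] at w1
  rw [hu2, (U_spec hh 1).1] at w2
  have hu0 : u β = 0 := by
    have : u β * F β δ h E = 0 := by
      unfold F
      linear_combination -h * U h 1 (E - I * δ) β * w1 + h * U h (-1) (E + I * δ) β * w2
    exact (mul_eq_zero.1 this).resolve_right hF
  have hu0' : u' β = 0 := by
    have : u' β * F β δ h E = 0 := by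
      unfold F
      linear_combination -h * U' h 1 (E - I * δ) β * w1 + h * U' h (-1) (E + I * δ) β * w2
    exact (mul_eq_zero.1 this).resolve_right hF
  obtain ⟨x, hx, hxne⟩ := hne
  apply hxne
  rcases le_total x β with hxb | hxb
  · exact zero_of_zero hh hul hul' bl hu0 hu0' ⟨hx.1, hxb⟩
  · exact zero_of_zero hh hur hur' br hu0 hu0' ⟨hxb, hx.2⟩

lemma glue {f g f' g' : ℝ → ℂ} {β : ℝ} (hf : ∀ x, HasDerivAt f (f' x) x)
    (hg : ∀ x, HasDerivAt g (g' x) x) (h0 : f β = g β) (h1 : f' β = g' β) (x : ℝ) :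
    HasDerivAt (fun x => if x ≤ β then f x else g x) (if x ≤ β then f' x else g' x) x := by
  rcases lt_trichotomy x β with h | h | h
  · rw [if_pos h.le]
    refine (hf x).congr_of_eventuallyEq ?_
    filter_upwards [gt_mem_nhds h] with y hy
    rw [if_pos (le_of_lt hy)]
  · subst h
    rw [if_pos le_rfl]
    have a1 : HasDerivWithinAt (fun y => if y ≤ x then f y else g y) (f' x) (Set.Iic x) x := by
      refine (hf x).hasDerivWithinAt.congr (fun y hy => ?_) ?_
      · exact if_pos hy
      · simp
    have a2 : HasDerivWithinAt (fun y => if y ≤ x then f y else g y) (f' x) (Set.Ici x) x := by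
      rw [h1]
      refine (hg x).hasDerivWithinAt.congr (fun y hy => ?_) ?_
      · rcases eq_or_lt_of_le (Set.mem_Ici.1 hy) with rfl | hlt
        · simp [h0]
        · exact if_neg (not_le.2 hlt)
      · simp [h0]
    have := a1.union a2
    rwa [Set.Iic_union_Ici, hasDerivWithinAt_univ] at this
  · rw [if_neg (not_le.2 h)]
    refine (hg x).congr_of_eventuallyEq ?_
    filter_upwards [lt_mem_nhds h] with y hy
    rw [if_neg (not_le.2 hy)]

lemma eig_of_F {β δ h : ℝ} (hβ : β ∈ Set.Ioo (-1:ℝ) 1) (hh : 0 < h) {E : ℂ} (hF : F β δ h E = 0) :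
    ∃ u u' ul'' ur'' : ℝ → ℂ,
    IsPiecewiseDirichletSol h β (fun x : ℝ => I * (x : ℂ) ^ 2 - I * δ)
      (fun x : ℝ => I * (x : ℂ) ^ 2 + I * δ) E u u' ul'' ur'' ∧ ∃ x ∈ Set.Icc (-1:ℝ) 1, u x ≠ 0 := by
  have hhc : (h : ℂ) ≠ 0 := by exact_mod_cast hh.ne'
  have n1 := U_ne' hh hβ.1 (x0 := -1) ⟨le_rfl, hβ.1.le⟩ (E + I * δ) (y := β) ⟨hβ.1.le, le_rfl⟩
  have n2 := U_ne' hh hβ.2 (x0 := 1) ⟨hβ.2.le, le_rfl⟩ (E - I * δ) (y := β) ⟨le_rfl, hβ.2.le⟩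
  have hF' : U h (-1) (E + I * δ) β * U' h 1 (E - I * δ) β =
      U' h (-1) (E + I * δ) β * U h 1 (E - I * δ) β := by
    unfold F at hF
    apply mul_left_cancel₀ hhc
    linear_combination hF
  obtain ⟨c, hc1, hc2⟩ : ∃ c : ℂ, U h (-1) (E + I * δ) β = c * U h 1 (E - I * δ) β ∧
      U' h (-1) (E + I * δ) β = c * U' h 1 (E - I * δ) β := by
    by_cases hr : U h 1 (E - I * δ) β = 0
    · have hs : U' h 1 (E - I * δ) β ≠ 0 := fun hs => n2 hr hs
      rw [hr, mul_zero] at hF'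
      have hp := (mul_eq_zero.1 hF').resolve_right hs
      exact ⟨U' h (-1) (E + I * δ) β / U' h 1 (E - I * δ) β, by rw [hp, hr, mul_zero], by field_simp⟩
    · refine ⟨U h (-1) (E + I * δ) β / U h 1 (E - I * δ) β, by field_simp, ?_⟩
      field_simp
      linear_combination -hF'
  have dl := fun x => (U_real hh (-1) (E + I * δ) Set.univ x).1
  have dl' := fun x => (U_real hh (-1) (E + I * δ) Set.univ x).2
  have dr := fun x => (U_real hh 1 (E - I * δ) Set.univ x).1
  have dr' := fun x => (U_real hh 1 (E - I * δ) Set.univ x).2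
  simp only [hasDerivWithinAt_univ] at dl dl' dr dr'
  have hcl : Continuous (fun x : ℝ => U h (-1) (E + I * δ) x) :=
    continuous_iff_continuousAt.2 fun x => (dl x).continuousAt
  have hcr : Continuous (fun x : ℝ => U h 1 (E - I * δ) x) :=
    continuous_iff_continuousAt.2 fun x => (dr x).continuousAt
  have hcl' : Continuous (fun x : ℝ => U' h (-1) (E + I * δ) x) :=
    continuous_iff_continuousAt.2 fun x => (dl' x).continuousAt
  have hcr' : Continuous (fun x : ℝ => U' h 1 (E - I * δ) x) :=
    continuous_iff_continuousAt.2 fun x => (dr' x).continuousAt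
  refine ⟨fun x => if x ≤ β then U h (-1) (E + I * δ) x else c * U h 1 (E - I * δ) x,
    fun x => if x ≤ β then U' h (-1) (E + I * δ) x else c * U' h 1 (E - I * δ) x,
    fun x => (-(E + I * δ) / h ^ 2 + I / h ^ 2 * (x : ℂ) ^ 2) * U h (-1) (E + I * δ) x,
    fun x => c * ((-(E - I * δ) / h ^ 2 + I / h ^ 2 * (x : ℂ) ^ 2) * U h 1 (E - I * δ) x),
    ⟨?_, ?_, ?_, ?_, ?_, ?_, ?_, ?_, ?_, ?_⟩, ?_⟩
  · intro x _
    exact (glue dl (fun x => (dr x).const_mul c) hc1 hc2 x).hasDerivWithinAt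
  · apply Continuous.continuousOn
    refine Continuous.if_le hcl' (hcr'.const_mul c) continuous_id continuous_const ?_
    intro x hx
    subst hx
    exact hc2
  · intro x hx
    refine ((dl' x).hasDerivWithinAt).congr (fun y hy => if_pos hy.2) (if_pos hx.2)
  · apply Continuous.continuousOn
    fun_prop
  · intro x hx
    have : ∀ y ∈ Set.Icc β (1:ℝ), (if y ≤ β then U' h (-1) (E + I * δ) y else c * U' h 1 (E - I * δ) y)
        = c * U' h 1 (E - I * δ) y := by
      intro y hy
      rcases eq_or_lt_of_le hy.1 with rfl | hlt
      · simp [hc2]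
      · exact if_neg (not_le.2 hlt)
    exact ((dr' x).const_mul c).hasDerivWithinAt.congr this (this x hx)
  · apply Continuous.continuousOn
    fun_prop
  · intro x hx
    beta_reduce
    rw [if_pos hx.2.le]
    field_simp
    ring
  · intro x hx
    beta_reduce
    rw [if_neg (not_le.2 hx.1)]
    field_simp
    ring
  · beta_reduce
    rw [if_pos hβ.1.le]
    exact (U_spec hh (-1)).1 _
  · beta_reduce
    rw [if_neg (not_le.2 hβ.2), (U_spec hh 1).1, mul_zero]
  · obtain ⟨x, hx, hne⟩ := U_ne hh hβ.1 (x0 := -1) ⟨le_rfl, hβ.1.le⟩ (E + I * δ)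
    refine ⟨x, ⟨hx.1, hx.2.trans hβ.2.le⟩, ?_⟩
    beta_reduce
    rwa [if_pos hx.2]
end WKB


namespace WKB
open Complex Metric Filter Topology

lemma side {e : ℂ} (he : 90 ≤ e.re) {a b : ℝ} (ha : |a| ≤ 1) (hb : |b| ≤ 1) {h : ℝ} (hh : 0 < h)
    {l : ℝ} (hl : l = |(∫ x in a..b, sq e x).im|) :
    ∃ s t P M X : ℂ, s ^ 2 = e - I * b ^ 2 ∧ 9 ≤ ‖s‖ ∧ t ^ 2 = e - I * a ^ 2 ∧ 9 ≤ ‖t‖ ∧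
      ‖X‖ = Real.exp (-(l / h)) ∧ X * (h * U' h a e b) = (P + M) / 2 ∧
      X * U h a e b = (P - M) / (2 * I * s) ∧ ‖P‖ ≤ 3 ∧ ‖M‖ ≤ 3 ∧
      (0 < l → ‖P‖ ≤ 2 * h / l ∧ ‖M ^ 2 / s - 1 / t‖ ≤ 2 * h / l) := by
  obtain ⟨σ, hσ, hσl⟩ : ∃ σ : ℂ, (σ = 1 ∨ σ = -1) ∧ (σ * ∫ x in a..b, sq e x).im = l := by
    rcases le_total 0 (∫ x in a..b, sq e x).im with h0 | h0
    · exact ⟨1, Or.inl rfl, by rw [hl, one_mul, abs_of_nonneg h0]⟩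
    · exact ⟨-1, Or.inr rfl, by rw [hl, neg_one_mul, neg_im, abs_of_nonpos h0]⟩
  have hl0 : 0 ≤ l := by rw [hl]; positivity
  obtain ⟨u1, u2, u3, u4, -, -⟩ := U_spec hh a
  have key := one_sided he ha hb hh hσ (by rw [hσl]; exact hl0) (u3 e) (u4 e) (u1 e) (u2 e) rfl rfl
  have hσ2 : σ ^ 2 = 1 := by rcases hσ with rfl | rfl <;> norm_num
  have hσn : ‖σ‖ = 1 := by rcases hσ with rfl | rfl <;> simp
  have na : ‖(a : ℂ)‖ ≤ 3 := by rw [norm_real, Real.norm_eq_abs]; linarith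
  have nb : ‖(b : ℂ)‖ ≤ 3 := by rw [norm_real, Real.norm_eq_abs]; linarith
  have sa := sq_norm he na
  have sb := sq_norm he nb
  have hs0 : σ * sq e b ≠ 0 := by
    rw [← norm_pos_iff, norm_mul, hσn]; linarith
  refine ⟨σ * sq e b, σ * sq e a, _, _, exp (I * (σ * (∫ x in a..b, sq e x) / h)),
    ?_, ?_, ?_, ?_, ?_, ?_, ?_, key.1, key.2.1, ?_⟩
  · rw [mul_pow, hσ2, sq_sq, one_mul]
  · rw [norm_mul, hσn, one_mul]; exact sb
  · rw [mul_pow, hσ2, sq_sq, one_mul]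
  · rw [norm_mul, hσn, one_mul]; exact sa
  · rw [Complex.norm_exp, I_mul_re, div_ofReal_im, hσl]
  · ring
  · rw [eq_div_iff (mul_ne_zero (mul_ne_zero two_ne_zero I_ne_zero) hs0)]; ring
  · intro hpos
    rw [hσl] at key
    have e1 : 2 / (l / h) = 2 * h / l := by field_simp
    rw [e1] at key
    exact key.2.2 hpos

lemma FXX {s r Pl Ml Pr Mr Xl Xr ul vl ur vr : ℂ} (hs : s ≠ 0) (hr : r ≠ 0)
    (h1 : Xl * vl = (Pl + Ml) / 2) (h2 : Xl * ul = (Pl - Ml) / (2 * I * s))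
    (h3 : Xr * vr = (Pr + Mr) / 2) (h4 : Xr * ur = (Pr - Mr) / (2 * I * r)) :
    Xl * Xr * (ul * vr - vl * ur) = (Pl - Ml) * (Pr + Mr) / (4 * I * s) - (Pl + Ml) * (Pr - Mr) / (4 * I * r) := by
  have : Xl * Xr * (ul * vr - vl * ur) = (Xl * ul) * (Xr * vr) - (Xl * vl) * (Xr * ur) := by ring
  rw [this, h1, h2, h3, h4]
  field_simp
  ring

lemma upper_alg {s r Pl Ml Pr Mr : ℂ} (hs : 9 ≤ ‖s‖) (hr : 9 ≤ ‖r‖)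
    (hPl : ‖Pl‖ ≤ 3) (hMl : ‖Ml‖ ≤ 3) (hPr : ‖Pr‖ ≤ 3) (hMr : ‖Mr‖ ≤ 3) :
    ‖(Pl - Ml) * (Pr + Mr) / (4 * I * s) - (Pl + Ml) * (Pr - Mr) / (4 * I * r)‖ ≤ 2 := by
  have a1 := (norm_sub_le Pl Ml).trans (add_le_add hPl hMl)
  have a2 := (norm_add_le Pl Ml).trans (add_le_add hPl hMl)
  have a3 := (norm_sub_le Pr Mr).trans (add_le_add hPr hMr)
  have a4 := (norm_add_le Pr Mr).trans (add_le_add hPr hMr)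
  have b1 : ‖(Pl - Ml) * (Pr + Mr) / (4 * I * s)‖ ≤ 1 := by
    rw [norm_div, norm_mul, norm_mul, norm_mul, norm_I, Complex.norm_ofNat, div_le_one (by positivity)]
    nlinarith [norm_nonneg (Pl - Ml), norm_nonneg (Pr + Mr)]
  have b2 : ‖(Pl + Ml) * (Pr - Mr) / (4 * I * r)‖ ≤ 1 := by
    rw [norm_div, norm_mul, norm_mul, norm_mul, norm_I, Complex.norm_ofNat, div_le_one (by positivity)]
    nlinarith [norm_nonneg (Pl + Ml), norm_nonneg (Pr - Mr)]
  refine (norm_sub_le _ _).trans ?_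
  linarith

lemma M_lower {s t M : ℂ} {S ε : ℝ} (hs : 9 ≤ ‖s‖) (ht : 9 ≤ ‖t‖) (htS : ‖t‖ ≤ S) (hM : ‖M‖ ≤ 3)
    (hε : ε ≤ 1 / (2 * S)) (h : ‖M ^ 2 / s - 1 / t‖ ≤ ε) : 3 / (2 * S) ≤ ‖M‖ := by
  have hS : 0 < S := by linarith
  have h1 : 1 / S ≤ ‖1 / t‖ := by
    rw [norm_div, norm_one]; exact one_div_le_one_div_of_le (by linarith) htS
  have h2 : ‖1 / t‖ ≤ ‖M ^ 2 / s‖ + ε := by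
    have := norm_sub_norm_le (1 / t) (M ^ 2 / s)
    rw [norm_sub_rev] at this
    linarith
  have h3 : 1 / (2 * S) ≤ ‖M ^ 2 / s‖ := by
    have : 1 / S = 1 / (2 * S) + 1 / (2 * S) := by field_simp; norm_num
    linarith
  rw [norm_div, norm_pow, div_le_div_iff₀ (by positivity) (by linarith)] at h3
  rw [div_le_iff₀ (by positivity)]
  nlinarith [norm_nonneg M]

lemma lower_alg {s r Pl Ml Pr Mr : ℂ} {S ε m δ : ℝ} (hs : 9 ≤ ‖s‖) (hr : 9 ≤ ‖r‖) (hsS : ‖s‖ ≤ S) (hrS : ‖r‖ ≤ S)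
    (hδ : 0 < δ) (hsr : s ^ 2 - r ^ 2 = 2 * I * δ) (hm : 0 < m)
    (hPl : ‖Pl‖ ≤ 3) (hMl : ‖Ml‖ ≤ 3) (hMr : ‖Mr‖ ≤ 3)
    (hPl' : ‖Pl‖ ≤ ε) (hPr' : ‖Pr‖ ≤ ε) (hml : m ≤ ‖Ml‖) (hmr : m ≤ ‖Mr‖) (hε : ε ≤ m ^ 2 * (δ / S ^ 3) / 4) :
    m ^ 2 * (δ / S ^ 3) / 8 ≤
      ‖(Pl - Ml) * (Pr + Mr) / (4 * I * s) - (Pl + Ml) * (Pr - Mr) / (4 * I * r)‖ := by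
  have hs0 : s ≠ 0 := by rw [← norm_pos_iff]; linarith
  have hr0 : r ≠ 0 := by rw [← norm_pos_iff]; linarith
  have hS : 0 < S := by linarith
  have hε0 : 0 ≤ ε := (norm_nonneg _).trans hPl'
  have e1 : (Pl - Ml) * (Pr + Mr) / (4 * I * s) - (Pl + Ml) * (Pr - Mr) / (4 * I * r)
      = Ml * Mr * (s - r) / (4 * I * (s * r)) -
        (-((Pl * Pr + Pl * Mr - Ml * Pr) / (4 * I * s)) + (Pl * Pr - Pl * Mr + Ml * Pr) / (4 * I * r)) := by
    field_simp; ring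
  have bd : ∀ {x y : ℂ} {A B : ℝ}, ‖x‖ ≤ A → ‖y‖ ≤ B → ‖x * y‖ ≤ A * B := by
    intro x y A B hx hy
    rw [norm_mul]
    exact mul_le_mul hx hy (norm_nonneg y) ((norm_nonneg x).trans hx)
  have p1 := bd hPl hPr'
  have p2 := bd hPl' hMr
  have p3 := bd hMl hPr'
  have r1 : ‖(Pl * Pr + Pl * Mr - Ml * Pr) / (4 * I * s)‖ ≤ ε / 4 := by
    rw [norm_div, norm_mul, norm_mul, norm_I, Complex.norm_ofNat, div_le_iff₀ (by positivity)]
    have := norm_sub_le (Pl * Pr + Pl * Mr) (Ml * Pr)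
    have := norm_add_le (Pl * Pr) (Pl * Mr)
    nlinarith
  have r2 : ‖(Pl * Pr - Pl * Mr + Ml * Pr) / (4 * I * r)‖ ≤ ε / 4 := by
    rw [norm_div, norm_mul, norm_mul, norm_I, Complex.norm_ofNat, div_le_iff₀ (by positivity)]
    have := norm_add_le (Pl * Pr - Pl * Mr) (Ml * Pr)
    have := norm_sub_le (Pl * Pr) (Pl * Mr)
    nlinarith
  have d1 : δ / S ≤ ‖s - r‖ := by
    have h1 : ‖s - r‖ * ‖s + r‖ = 2 * δ := by
      rw [← norm_mul, show (s - r) * (s + r) = 2 * I * δ by rw [← hsr]; ring, norm_mul, norm_mul, norm_I,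
        Complex.norm_ofNat, norm_real, Real.norm_eq_abs, abs_of_pos hδ, mul_one]
    have h2 := norm_add_le s r
    rw [div_le_iff₀ hS]
    nlinarith [norm_nonneg (s - r)]
  have d2 : m ^ 2 * (δ / S ^ 3) / 4 ≤ ‖Ml * Mr * (s - r) / (4 * I * (s * r))‖ := by
    rw [norm_div, norm_mul, norm_mul, norm_mul, norm_mul, norm_mul, norm_I, Complex.norm_ofNat,
      le_div_iff₀ (by positivity)]
    have t1 : m * m ≤ ‖Ml‖ * ‖Mr‖ := by gcongr
    have t2 : ‖s‖ * ‖r‖ ≤ S * S := by gcongr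
    calc m ^ 2 * (δ / S ^ 3) / 4 * (4 * 1 * (‖s‖ * ‖r‖)) ≤ m ^ 2 * (δ / S ^ 3) / 4 * (4 * 1 * (S * S)) := by gcongr
      _ = m * m * (δ / S) := by field_simp
      _ ≤ _ := by gcongr
  rw [e1]
  have n1 := norm_sub_norm_le (Ml * Mr * (s - r) / (4 * I * (s * r)))
    (-((Pl * Pr + Pl * Mr - Ml * Pr) / (4 * I * s)) + (Pl * Pr - Pl * Mr + Ml * Pr) / (4 * I * r))
  have n2 := norm_add_le (-((Pl * Pr + Pl * Mr - Ml * Pr) / (4 * I * s))) ((Pl * Pr - Pl * Mr + Ml * Pr) / (4 * I * r))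
  rw [norm_neg] at n2
  linarith

/-- left action -/
noncomputable def Jl (β δ : ℝ) (E : ℂ) : ℂ := ∫ x in (-1:ℝ)..β, sq (E + I * δ) x

/-- right action -/
noncomputable def Jr (β δ : ℝ) (E : ℂ) : ℂ := ∫ x in β..(1:ℝ), sq (E - I * δ) x

lemma sides {β δ : ℝ} (hβ : β ∈ Set.Ioo (-1:ℝ) 1) {E : ℂ} (hE : 90 ≤ E.re) {h : ℝ} (hh : 0 < h) :
    ∃ s t Pl Ml r q Pr Mr : ℂ,
      (s ^ 2 = E + I * δ - I * β ^ 2 ∧ 9 ≤ ‖s‖ ∧ t ^ 2 = E + I * δ - I * (-1 : ℝ) ^ 2 ∧ 9 ≤ ‖t‖ ∧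
        ‖Pl‖ ≤ 3 ∧ ‖Ml‖ ≤ 3 ∧ (0 < |(Jl β δ E).im| → ‖Pl‖ ≤ 2 * h / |(Jl β δ E).im| ∧
          ‖Ml ^ 2 / s - 1 / t‖ ≤ 2 * h / |(Jl β δ E).im|)) ∧
      (r ^ 2 = E - I * δ - I * β ^ 2 ∧ 9 ≤ ‖r‖ ∧ q ^ 2 = E - I * δ - I * (1 : ℝ) ^ 2 ∧ 9 ≤ ‖q‖ ∧
        ‖Pr‖ ≤ 3 ∧ ‖Mr‖ ≤ 3 ∧ (0 < |(Jr β δ E).im| → ‖Pr‖ ≤ 2 * h / |(Jr β δ E).im| ∧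
          ‖Mr ^ 2 / r - 1 / q‖ ≤ 2 * h / |(Jr β δ E).im|)) ∧
      ‖F β δ h E‖ = Real.exp ((|(Jl β δ E).im| + |(Jr β δ E).im|) / h) *
        ‖(Pl - Ml) * (Pr + Mr) / (4 * I * s) - (Pl + Ml) * (Pr - Mr) / (4 * I * r)‖ := by
  have hb : |β| ≤ 1 := abs_le.2 ⟨hβ.1.le, hβ.2.le⟩
  have hl : |(Jl β δ E).im| = |(∫ x in (-1:ℝ)..β, sq (E + I * δ) x).im| := rfl
  have hr : |(Jr β δ E).im| = |(∫ x in (1:ℝ)..β, sq (E - I * δ) x).im| := by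
    rw [intervalIntegral.integral_symm, neg_im, abs_neg]; rfl
  obtain ⟨s, t, Pl, Ml, Xl, a1, a2, a3, a4, a5, a6, a7, a8, a9, a10⟩ :=
    side (e := E + I * δ) (by simpa using hE) (a := -1) (by simp) hb hh hl
  obtain ⟨r, q, Pr, Mr, Xr, b1, b2, b3, b4, b5, b6, b7, b8, b9, b10⟩ :=
    side (e := E - I * δ) (by simpa using hE) (a := 1) (by simp) hb hh hr
  refine ⟨s, t, Pl, Ml, r, q, Pr, Mr, ⟨a1, a2, a3, a4, a8, a9, a10⟩, ⟨b1, b2, b3, b4, b8, b9, b10⟩, ?_⟩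
  have hs0 : s ≠ 0 := by rw [← norm_pos_iff]; linarith
  have hr0 : r ≠ 0 := by rw [← norm_pos_iff]; linarith
  have := FXX hs0 hr0 a6 a7 b6 b7
  rw [← this, norm_mul, norm_mul, a5, b5, add_div, Real.exp_add, Real.exp_neg, Real.exp_neg]
  have e1 := (Real.exp_pos (|(Jl β δ E).im| / h)).ne'
  have e2 := (Real.exp_pos (|(Jr β δ E).im| / h)).ne'
  unfold F
  field_simp

lemma F_upper {β δ : ℝ} (hβ : β ∈ Set.Ioo (-1:ℝ) 1) {E : ℂ} (hE : 90 ≤ E.re) {h : ℝ} (hh : 0 < h) :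
    ‖F β δ h E‖ ≤ Real.exp ((|(Jl β δ E).im| + |(Jr β δ E).im|) / h) * 2 := by
  obtain ⟨s, t, Pl, Ml, r, q, Pr, Mr, ⟨a1, a2, a3, a4, a5, a6, a7⟩, ⟨b1, b2, b3, b4, b5, b6, b7⟩, hF⟩ :=
    sides (δ := δ) hβ hE hh
  rw [hF]
  have := upper_alg a2 b2 a5 a6 b5 b6
  have := Real.exp_pos ((|(Jl β δ E).im| + |(Jr β δ E).im|) / h)
  gcongr

lemma F_lower {β δ : ℝ} (hβ : β ∈ Set.Ioo (-1:ℝ) 1) (hδ : δ ∈ Set.Ioc (0:ℝ) 1) {K η : ℝ} (hK : 0 < K) (hη : 0 < η) :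
    ∃ c h0 : ℝ, 0 < c ∧ 0 < h0 ∧ ∀ (E : ℂ) (h : ℝ), 90 ≤ E.re → ‖E‖ ≤ K → η ≤ |(Jl β δ E).im| →
      η ≤ |(Jr β δ E).im| → 0 < h → h < h0 →
      Real.exp ((|(Jl β δ E).im| + |(Jr β δ E).im|) / h) * c ≤ ‖F β δ h E‖ := by
  have hδ0 := hδ.1
  set S := K + 2 with hS
  have hS0 : 0 < S := by positivity
  set m := 3 / (2 * S) with hm
  have hm0 : 0 < m := by positivity
  refine ⟨m ^ 2 * (δ / S ^ 3) / 8, η / 2 * min (1 / (2 * S)) (m ^ 2 * (δ / S ^ 3) / 4), by positivity,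
    by positivity, ?_⟩
  intro E h hE hEK hl hr hh hh0
  obtain ⟨s, t, Pl, Ml, r, q, Pr, Mr, ⟨a1, a2, a3, a4, a5, a6, a7⟩, ⟨b1, b2, b3, b4, b5, b6, b7⟩, hF⟩ :=
    sides (δ := δ) hβ hE hh
  rw [hF]
  have hle : ∀ l : ℝ, η ≤ l → 2 * h / l ≤ 1 / (2 * S) ∧ 2 * h / l ≤ m ^ 2 * (δ / S ^ 3) / 4 := by
    intro l hl
    have h1 : 2 * h / l ≤ min (1 / (2 * S)) (m ^ 2 * (δ / S ^ 3) / 4) := by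
      rw [div_le_iff₀ (by linarith)]
      have h3 : 0 < min (1 / (2 * S)) (m ^ 2 * (δ / S ^ 3) / 4) := by positivity
      nlinarith
    exact le_min_iff.1 h1
  have hsb : ∀ (w : ℂ) (d x : ℝ), |d| ≤ 1 → |x| ≤ 1 → 9 ≤ ‖w‖ → w ^ 2 = E + I * d - I * (x : ℂ) ^ 2 → ‖w‖ ≤ S := by
    intro w d x hd hx h9 hw
    have h1 : ‖w‖ ^ 2 ≤ K + 2 := by
      rw [← norm_pow, hw]
      refine (norm_sub_le _ _).trans ?_
      have := norm_add_le E (I * d)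
      have n1 : ‖I * (d : ℂ)‖ ≤ 1 := by simpa using hd
      have n2 : ‖I * (x : ℂ) ^ 2‖ ≤ 1 := by
        simpa [norm_pow] using hx
      linarith
    nlinarith
  have hd1 : |δ| ≤ 1 := by rw [abs_of_pos hδ0]; exact hδ.2
  have hd2 : |-δ| ≤ 1 := by rw [abs_neg]; exact hd1
  have hb : |β| ≤ 1 := abs_le.2 ⟨hβ.1.le, hβ.2.le⟩
  have s1 := hsb s δ β hd1 hb a2 a1
  have s2 := hsb t δ (-1) hd1 (by simp) a4 a3
  have s3 := hsb r (-δ) β hd2 hb b2 (by rw [b1]; push_cast; ring)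
  have s4 := hsb q (-δ) 1 hd2 (by simp) b4 (by rw [b3]; push_cast; ring)
  obtain ⟨a8, a9⟩ := a7 (by linarith)
  obtain ⟨b8, b9⟩ := b7 (by linarith)
  have ml := M_lower a2 a4 s2 a6 (hle _ hl).1 a9
  have mr := M_lower b2 b4 s4 b6 (hle _ hr).1 b9
  have := lower_alg a2 b2 s1 s3 hδ0 (by rw [a1, b1]; ring) hm0 a5 a6 b6
    (a8.trans (hle _ hl).2) (b8.trans (hle _ hr).2) ml mr le_rfl
  have := Real.exp_pos ((|(Jl β δ E).im| + |(Jr β δ E).im|) / h)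
  gcongr
end WKB


namespace WKB
open Complex Metric Filter Topology

/-- holomorphic in `Re E > 90` with derivative of positive real part -/
def Good (J : ℂ → ℂ) : Prop := ∀ E : ℂ, 90 < E.re → ∃ J' : ℂ, HasDerivAt J J' E ∧ 0 < J'.re

lemma sq_cont {e : ℂ} (he : 90 ≤ e.re) {a b : ℝ} (ha : -1 ≤ a) (hab : a < b) (hb : b ≤ 1) :
    ContinuousOn (fun x : ℝ => sq e x) (Set.uIcc a b) := by
  intro x hx
  rw [Set.uIcc_of_le hab.le] at hx
  have nx : ‖(x : ℂ)‖ ≤ 3 := by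
    rw [norm_real, Real.norm_eq_abs, abs_le]; constructor <;> linarith [hx.1, hx.2]
  have h1 : ContinuousAt (fun z : ℂ => sq e z) (x : ℂ) := (sq_deriv he nx).continuousAt
  exact (h1.comp (f := fun x : ℝ => (x : ℂ)) continuous_ofReal.continuousAt).continuousWithinAt

lemma good_int {a b : ℝ} (ha : -1 ≤ a) (hab : a < b) (hb : b ≤ 1) {c : ℂ} (hc : c.re = 0) :
    Good (fun E => ∫ x in a..b, sq (E + c) x) := by
  intro E hE
  have hs : {z : ℂ | 90 < z.re} ∈ 𝓝 E := (isOpen_lt continuous_const continuous_re).mem_nhds hE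
  have hre : ∀ z : ℂ, (z + c).re = z.re := by intro z; simp [hc]
  have nx : ∀ x ∈ Set.Icc a b, ‖(x : ℂ)‖ ≤ 3 := by
    intro x hx
    rw [norm_real, Real.norm_eq_abs, abs_le]; constructor <;> linarith [hx.1, hx.2]
  have huI : Set.uIoc a b ⊆ Set.Icc a b := by
    rw [Set.uIoc_of_le hab.le]; exact Set.Ioc_subset_Icc_self
  have hc0 : ∀ z : ℂ, 90 < z.re → ContinuousOn (fun x : ℝ => sq (z + c) x) (Set.uIcc a b) :=
    fun z hz => sq_cont (by rw [hre]; exact hz.le) ha hab hb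
  have hc1 : ContinuousOn (fun x : ℝ => 1 / (2 * sq (E + c) x)) (Set.uIcc a b) := by
    refine continuousOn_const.div (continuousOn_const.mul (hc0 E hE)) ?_
    intro x hx
    rw [Set.uIcc_of_le hab.le] at hx
    exact mul_ne_zero two_ne_zero (sq_ne (by rw [hre]; exact hE.le) (nx x hx))
  have key := intervalIntegral.hasDerivAt_integral_of_dominated_loc_of_deriv_le
    (μ := MeasureTheory.volume) (a := a) (b := b)
    (F := fun (E : ℂ) (x : ℝ) => sq (E + c) x) (F' := fun E x => 1 / (2 * sq (E + c) x))
    (bound := fun _ => 1) hs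
    (by
      filter_upwards [hs] with z hz
      exact ((hc0 z hz).intervalIntegrable).def'.aestronglyMeasurable)
    (hc0 E hE).intervalIntegrable
    (hc1.intervalIntegrable.def'.aestronglyMeasurable)
    (by
      refine Eventually.of_forall fun x hx z hz => ?_
      have := sq_norm (e := z + c) (z := x) (by rw [hre]; exact le_of_lt hz) (nx x (huI hx))
      rw [norm_div, norm_mul, norm_one, Complex.norm_two, div_le_one (by linarith)]
      linarith)
    intervalIntegrable_const
    (by
      refine Eventually.of_forall fun x hx z hz => ?_
      have := sq_deriv_e (e := z + c) (z := x) (by rw [hre]; exact le_of_lt hz) (nx x (huI hx))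
      exact this.comp_add_const z c)
  refine ⟨_, key.2, ?_⟩
  have h2 := (Complex.reCLM.intervalIntegral_comp_comm key.1).symm
  simp only [Complex.reCLM_apply] at h2
  rw [h2]
  refine intervalIntegral.intervalIntegral_pos_of_pos_on ?_ ?_ hab
  · exact (Complex.continuous_re.comp_continuousOn hc1).intervalIntegrable
  · intro x hx
    have hr := sq_re (e := E + c) (z := x) (by rw [hre]; exact hE.le) (nx x ⟨hx.1.le, hx.2.le⟩)
    rw [one_div, Complex.inv_re]
    refine div_pos ?_ (normSq_pos.2 ?_)
    · simp; linarith
    · exact mul_ne_zero two_ne_zero (sq_ne (by rw [hre]; exact hE.le) (nx x ⟨hx.1.le, hx.2.le⟩))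

lemma good_Jl {β : ℝ} (hβ : β ∈ Set.Ioo (-1:ℝ) 1) (δ : ℝ) : Good (Jl β δ) :=
  good_int (le_refl _) hβ.1 hβ.2.le (by simp)

lemma good_Jr {β : ℝ} (hβ : β ∈ Set.Ioo (-1:ℝ) 1) (δ : ℝ) : Good (Jr β δ) := by
  have := good_int (c := -(I * δ)) hβ.1.le hβ.2 (le_refl _) (by simp)
  simp only [← sub_eq_add_neg] at this
  exact this

lemma Good.analytic {J : ℂ → ℂ} (hJ : Good J) {E : ℂ} (hE : 90 < E.re) : AnalyticAt ℂ J E := by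
  have ho : IsOpen {z : ℂ | 90 < z.re} := isOpen_lt continuous_const continuous_re
  have : DifferentiableOn ℂ J {z : ℂ | 90 < z.re} := by
    intro z hz
    obtain ⟨J', h, -⟩ := hJ z hz
    exact h.differentiableAt.differentiableWithinAt
  exact this.analyticAt (ho.mem_nhds hE)

lemma Good.mono {J : ℂ → ℂ} (hJ : Good J) {E : ℂ} (hE : 90 < E.re) :
    StrictMono (fun t : ℝ => (J (E + I * t)).im) := by
  have hd : ∀ t : ℝ, ∃ d : ℝ, 0 < d ∧ HasDerivAt (fun t : ℝ => (J (E + I * t)).im) d t := by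
    intro t
    obtain ⟨J', h, hp⟩ := hJ (E + I * t) (by simpa using hE)
    have h1 : HasDerivAt (fun t : ℝ => E + I * (t : ℂ)) (I * 1) t :=
      (((hasDerivAt_id t).ofReal_comp).const_mul I).const_add E
    have h2 := HasDerivAt.comp (h := fun t : ℝ => E + I * (t : ℂ)) t h h1
    have h3 := (Complex.imCLM.hasFDerivAt.comp_hasDerivAt t h2)
    refine ⟨_, ?_, h3⟩
    simpa using hp
  refine strictMono_of_deriv_pos fun t => ?_
  obtain ⟨d, h1, h2⟩ := hd t
  rw [h2.deriv]; exact h1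

lemma circle_re {E₀ : ℂ} {ρ : ℝ} (h : 90 < E₀.re - ρ) {z : ℂ} (hz : z ∈ closedBall E₀ ρ) :
    90 < z.re := by
  rw [mem_closedBall, dist_eq_norm] at hz
  have := (abs_le.1 ((abs_re_le_norm (z - E₀)).trans hz)).1
  rw [sub_re] at this
  linarith

lemma Good.exists_ne {J : ℂ → ℂ} (hJ : Good J) {E₀ : ℂ} {ρ : ℝ} (hρ : 0 < ρ) (h : 90 < E₀.re - ρ) :
    ∃ θ ∈ Set.Icc 0 (2 * Real.pi), (J (circleMap E₀ ρ θ)).im ≠ 0 := by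
  by_contra! hc
  have h1 := hc (Real.pi / 2) ⟨by positivity, by linarith [Real.pi_pos]⟩
  have h2 := hc (3 * Real.pi / 2) ⟨by positivity, by linarith [Real.pi_pos]⟩
  have e1 : circleMap E₀ ρ (Real.pi / 2) = E₀ + I * (ρ : ℝ) := by
    simp only [circleMap, ofReal_div, ofReal_ofNat, Complex.exp_pi_div_two_mul_I]; ring
  have e2 : circleMap E₀ ρ (3 * Real.pi / 2) = E₀ + I * ((-ρ : ℝ) : ℂ) := by
    have : cexp (3 * Real.pi / 2 * I) = -I := by
      rw [show (3 * Real.pi / 2 * I : ℂ) = Real.pi * I + Real.pi / 2 * I by ring, Complex.exp_add]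
      simp [Complex.exp_pi_div_two_mul_I]
    simp only [circleMap, ofReal_div, ofReal_mul, ofReal_neg, ofReal_ofNat, this]; ring
  have := hJ.mono (E := E₀) (by linarith) (show -ρ < ρ by linarith)
  beta_reduce at this
  rw [← e1, ← e2, h1, h2] at this
  exact lt_irrefl _ this

lemma Good.ae_ne {J : ℂ → ℂ} (hJ : Good J) {E₀ : ℂ} {ρ : ℝ} (hρ : 0 < ρ) (h : 90 < E₀.re - ρ) :
    ∀ᵐ θ : ℝ, (J (circleMap E₀ ρ θ)).im ≠ 0 := by
  have ha : AnalyticOnNhd ℝ (fun θ : ℝ => (J (circleMap E₀ ρ θ)).im) Set.univ := by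
    intro θ _
    have h1 : AnalyticAt ℝ (circleMap E₀ ρ) θ := analyticOnNhd_circleMap E₀ ρ θ (Set.mem_univ _)
    have h2 : AnalyticAt ℝ J (circleMap E₀ ρ θ) :=
      (hJ.analytic (circle_re h (circleMap_mem_closedBall _ hρ.le θ))).restrictScalars
    exact (Complex.imCLM.analyticAt _).comp (h2.comp h1)
  obtain ⟨θ, -, hθ⟩ := hJ.exists_ne hρ h
  have h3 := ha.preimage_zero_mem_codiscrete (x := θ) hθ
  have h4 := ae_restrict_le_codiscreteWithin (μ := (MeasureTheory.volume : MeasureTheory.Measure ℝ)) (U := Set.univ) MeasurableSet.univ h3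
  rw [MeasureTheory.Measure.restrict_univ] at h4
  filter_upwards [h4] with θ hθ
  simpa using hθ

end WKB


namespace WKB
open Complex Metric Filter Topology

lemma harm_bound {φ : ℂ → ℝ} {E₁ : ℂ} {r M : ℝ} (hr : 0 < r) (hM : 0 < M)
    (hφ : InnerProductSpace.HarmonicOnNhd φ (ball E₁ (4 * r)))
    (hb : ∀ z ∈ ball E₁ (4 * r), φ z ≤ M) {z : ℂ} (hz : z ∈ closedBall E₁ (2 * r)) :
    |φ z| ≤ 2 * M + 3 * |φ E₁| := by
  obtain ⟨g, hg, hgφ⟩ := InnerProductSpace.HarmonicOnNhd.exists_analyticOnNhd_ball_re_eq hφ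
  have hmem : ∀ w ∈ ball (0 : ℂ) (4 * r), E₁ + w ∈ ball E₁ (4 * r) := by
    intro w hw; simpa [dist_eq_norm] using hw
  have h1 : DifferentiableOn ℂ (fun w => g (E₁ + w) - I * (g E₁).im) (ball 0 (4 * r)) := by
    intro w hw
    have := (hg _ (hmem w hw)).differentiableAt
    have h2 : DifferentiableAt ℂ (fun w : ℂ => E₁ + w) w := by fun_prop
    exact ((DifferentiableAt.comp w this h2).sub_const _).differentiableWithinAt
  have hre : ∀ w ∈ ball (0 : ℂ) (4 * r), (g (E₁ + w) - I * (g E₁).im).re = φ (E₁ + w) := by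
    intro w hw
    have := hgφ (hmem w hw)
    beta_reduce at this
    rw [← this]; simp
  have hzn : ‖z - E₁‖ ≤ 2 * r := by simpa [dist_eq_norm] using hz
  have hz' : z - E₁ ∈ ball (0 : ℂ) (4 * r) := by
    rw [mem_ball_zero_iff]; linarith
  have key := Complex.borelCaratheodory hM h1 (by
    intro w hw
    rw [Set.mem_ofPred_eq, hre w hw]
    exact hb _ (hmem w hw)) (by positivity) hz'
  have e0 : ‖g (E₁ + 0) - I * (g E₁).im‖ = |φ E₁| := by
    have h0 := hre 0 (by simpa using hr)
    have : g (E₁ + 0) - I * (g E₁).im = (φ E₁ : ℂ) := by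
      apply Complex.ext
      · rw [h0]; simp
      · simp
    rw [this, norm_real, Real.norm_eq_abs]
  rw [e0] at key
  have h3 : |φ z| ≤ ‖g (E₁ + (z - E₁)) - I * (g E₁).im‖ := by
    have h0 := hre _ hz'
    rw [add_sub_cancel] at h0 ⊢
    rw [← h0]; exact abs_re_le_norm _
  refine h3.trans (key.trans ?_)
  have hp : 0 < 4 * r - ‖z - E₁‖ := by linarith
  have hn := norm_nonneg (z - E₁)
  gcongr ?_ + ?_
  · rw [div_le_iff₀ hp]
    nlinarith
  · rw [div_le_iff₀ hp]
    nlinarith [abs_nonneg (φ E₁)]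

lemma pot {φ : ℕ → ℂ → ℝ} {Φ : ℂ → ℝ} {ε : ℕ → ℝ} {E₀ : ℂ} {ρ : ℝ} (hρ : 0 < ρ)
    (hφ : ∀ n, InnerProductSpace.HarmonicOnNhd (φ n) (ball E₀ (6 * ρ)))
    (hle : ∀ n, ∀ z ∈ ball E₀ (6 * ρ), φ n z ≤ Φ z + ε n) (hε : Tendsto ε atTop (𝓝 0))
    (hΦ : ContinuousOn Φ (closedBall E₀ (6 * ρ)))
    (hae : ∀ᵐ θ : ℝ, Tendsto (fun n => φ n (circleMap E₀ ρ θ)) atTop (𝓝 (Φ (circleMap E₀ ρ θ)))) :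
    Real.circleAverage Φ E₀ ρ ≤ Φ E₀ := by
  obtain ⟨θ₁, hθ₁⟩ := hae.exists
  set E₁ := circleMap E₀ ρ θ₁ with hE₁
  have d1 : dist E₁ E₀ = ρ := circleMap_mem_sphere E₀ hρ.le θ₁
  have hsub : ball E₁ (4 * ρ) ⊆ ball E₀ (6 * ρ) := ball_subset_ball' (by rw [d1]; linarith)
  obtain ⟨M1, hM1⟩ := (isCompact_closedBall E₀ (6 * ρ)).exists_bound_of_continuousOn hΦ
  obtain ⟨M2, hM2⟩ := hε.bddAbove_range
  obtain ⟨M3, hM3⟩ := (hθ₁.abs).bddAbove_range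
  set M := |M1| + |M2| + 1 with hMdef
  have hbound : ∀ n θ, ‖φ n (circleMap E₀ ρ θ)‖ ≤ 2 * M + 3 * M3 := by
    intro n θ
    rw [Real.norm_eq_abs]
    have := harm_bound (φ := φ n) (E₁ := E₁) (M := M) hρ (by positivity) ((hφ n).mono hsub) (by
      intro z hz
      have h1 := hle n z (hsub hz)
      have h2 := (le_abs_self _).trans (hM1 z (ball_subset_closedBall (hsub hz)))
      have h3 : ε n ≤ M2 := hM2 ⟨n, rfl⟩
      linarith [le_abs_self M1, le_abs_self M2]) (z := circleMap E₀ ρ θ) (by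
      rw [mem_closedBall]
      have h1 := circleMap_mem_sphere E₀ hρ.le θ
      rw [mem_sphere] at h1
      have h2 := dist_triangle_right (circleMap E₀ ρ θ) E₁ E₀
      linarith)
    have h4 : |φ n E₁| ≤ M3 := hM3 ⟨n, rfl⟩
    linarith
  have hcirc : ∀ θ, circleMap E₀ ρ θ ∈ ball E₀ (6 * ρ) := by
    intro θ
    have h1 := circleMap_mem_sphere E₀ hρ.le θ
    rw [mem_sphere] at h1
    rw [mem_ball]; linarith
  have hlim := intervalIntegral.tendsto_integral_filter_of_dominated_convergence
    (μ := MeasureTheory.volume) (a := 0) (b := 2 * Real.pi) (l := atTop)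
    (F := fun n θ => φ n (circleMap E₀ ρ θ)) (f := fun θ => Φ (circleMap E₀ ρ θ))
    (fun _ => 2 * M + 3 * M3)
    (Eventually.of_forall fun n => by
      have : Continuous (fun θ => φ n (circleMap E₀ ρ θ)) :=
        (hφ n).continuousOn.comp_continuous (continuous_circleMap E₀ ρ) hcirc
      exact this.aestronglyMeasurable)
    (Eventually.of_forall fun n => Eventually.of_forall fun θ _ => hbound n θ)
    intervalIntegrable_const
    (by filter_upwards [hae] with θ hθ _; exact hθ)
  have hlim2 : Tendsto (fun n => φ n E₀) atTop (𝓝 (Real.circleAverage Φ E₀ ρ)) := by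
    have : (fun n => φ n E₀) = fun n => (2 * Real.pi)⁻¹ • ∫ θ in (0:ℝ)..2 * Real.pi, φ n (circleMap E₀ ρ θ) := by
      funext n
      rw [← Real.circleAverage_def, InnerProductSpace.HarmonicOnNhd.circleAverage_eq]
      refine (hφ n).mono (closedBall_subset_ball ?_)
      rw [abs_of_pos hρ]; linarith
    rw [this, Real.circleAverage_def]
    exact hlim.const_smul _
  have hlim3 : Tendsto (fun n => Φ E₀ + ε n) atTop (𝓝 (Φ E₀ + 0)) := hε.const_add _
  rw [add_zero] at hlim3
  exact le_of_tendsto_of_tendsto' hlim2 hlim3 (fun n => hle n E₀ (mem_ball_self (by positivity)))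

lemma Good.harm {J : ℂ → ℂ} (hJ : Good J) {E₀ : ℂ} {ρ : ℝ} (h : 90 < E₀.re - ρ) :
    InnerProductSpace.HarmonicOnNhd (fun z => (J z).im) (closedBall E₀ ρ) :=
  fun _ hz => (hJ.analytic (circle_re h hz)).harmonicAt_im

lemma Good.cont {J : ℂ → ℂ} (hJ : Good J) {E₀ : ℂ} {ρ : ℝ} (h : 90 < E₀.re - ρ) :
    ContinuousOn (fun z => |(J z).im|) (closedBall E₀ ρ) :=
  fun _ hz => ((continuous_im.continuousAt.comp
    (hJ.analytic (circle_re h hz)).continuousAt).abs).continuousWithinAt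

lemma Good.circInt {J : ℂ → ℂ} (hJ : Good J) {E₀ : ℂ} {ρ : ℝ} (hρ : 0 < ρ) (h : 90 < E₀.re - ρ) :
    CircleIntegrable (fun z => |(J z).im|) E₀ ρ :=
  ((hJ.cont h).mono sphere_subset_closedBall).circleIntegrable hρ.le

lemma Good.avg {J : ℂ → ℂ} (hJ : Good J) {E₀ : ℂ} {ρ : ℝ} (hρ : 0 < ρ) (h : 90 < E₀.re - ρ) :
    |(J E₀).im| ≤ Real.circleAverage (fun z => |(J z).im|) E₀ ρ := by
  have h1 := InnerProductSpace.HarmonicOnNhd.circleAverage_eq (c := E₀) (R := ρ)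
    (f := fun z => (J z).im) (by rw [abs_of_pos hρ]; exact hJ.harm h)
  have h2 := Real.abs_circleAverage_le_circleAverage_abs (c := E₀) (R := ρ) (f := fun z => (J z).im)
  rw [h1] at h2
  exact h2

lemma Good.avg_pos {J : ℂ → ℂ} (hJ : Good J) {E₀ : ℂ} {ρ : ℝ} (hρ : 0 < ρ) (h : 90 < E₀.re - ρ) :
    0 < Real.circleAverage (fun z => |(J z).im|) E₀ ρ := by
  obtain ⟨θ, hθ, hne⟩ := hJ.exists_ne hρ h
  rw [Real.circleAverage_def]
  refine smul_pos (by positivity) ?_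
  refine intervalIntegral.integral_pos (by positivity) ?_ (fun _ _ => abs_nonneg _) ⟨θ, hθ, abs_pos.2 hne⟩
  exact ((hJ.cont h).comp_continuous (continuous_circleMap E₀ ρ)
    (fun θ => circleMap_mem_closedBall _ hρ.le θ)).continuousOn

lemma strict {J K : ℂ → ℂ} (hJ : Good J) (hK : Good K) {E₀ : ℂ} {ρ : ℝ} (hρ : 0 < ρ)
    (h : 90 < E₀.re - ρ) (h0 : (J E₀).im = 0 ∨ (K E₀).im = 0) :
    |(J E₀).im| + |(K E₀).im| < Real.circleAverage (fun z => |(J z).im| + |(K z).im|) E₀ ρ := by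
  rw [Real.circleAverage_fun_add (hJ.circInt hρ h) (hK.circInt hρ h)]
  rcases h0 with h0 | h0
  · rw [h0, abs_zero]
    exact add_lt_add_of_lt_of_le (hJ.avg_pos hρ h) (hK.avg hρ h)
  · rw [h0, abs_zero]
    exact add_lt_add_of_le_of_lt (hJ.avg hρ h) (hK.avg_pos hρ h)

end WKB


namespace WKB
open Complex Metric Filter Topology

lemma lower_near {β δ : ℝ} (hβ : β ∈ Set.Ioo (-1:ℝ) 1) (hδ : δ ∈ Set.Ioc (0:ℝ) 1) {E₀ : ℂ}
    (hE : 90 < E₀.re) (hl : (Jl β δ E₀).im ≠ 0) (hr : (Jr β δ E₀).im ≠ 0) :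
    ∃ c h0 : ℝ, 0 < c ∧ 0 < h0 ∧ ∀ᶠ E in 𝓝 E₀, ∀ h, 0 < h → h < h0 →
      Real.exp ((|(Jl β δ E).im| + |(Jr β δ E).im|) / h) * c ≤ ‖F β δ h E‖ := by
  have hl' := abs_pos.2 hl
  have hr' := abs_pos.2 hr
  set η := min |(Jl β δ E₀).im| |(Jr β δ E₀).im| / 2 with hη
  have hη0 : 0 < η := half_pos (lt_min hl' hr')
  have h1 : η < |(Jl β δ E₀).im| := by
    have := min_le_left |(Jl β δ E₀).im| |(Jr β δ E₀).im|
    linarith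
  have h2 : η < |(Jr β δ E₀).im| := by
    have := min_le_right |(Jl β δ E₀).im| |(Jr β δ E₀).im|
    linarith
  obtain ⟨c, h0, hc, hh0, key⟩ := F_lower hβ hδ (K := ‖E₀‖ + 1) (η := η) (by positivity) hη0
  refine ⟨c, h0, hc, hh0, ?_⟩
  have c1 : ContinuousAt (fun z => |(Jl β δ z).im|) E₀ :=
    (continuous_im.continuousAt.comp ((good_Jl hβ δ).analytic hE).continuousAt).abs
  have c2 : ContinuousAt (fun z => |(Jr β δ z).im|) E₀ :=
    (continuous_im.continuousAt.comp ((good_Jr hβ δ).analytic hE).continuousAt).abs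
  have c3 : ContinuousAt (fun z : ℂ => ‖z‖) E₀ := continuous_norm.continuousAt
  have c4 : ContinuousAt (fun z : ℂ => z.re) E₀ := continuous_re.continuousAt
  filter_upwards [c1.eventually (lt_mem_nhds h1), c2.eventually (lt_mem_nhds h2),
    c3.eventually (gt_mem_nhds (lt_add_one _)), c4.eventually (lt_mem_nhds hE)] with E e1 e2 e3 e4
  intro h hh hh'
  exact key E h e4.le e3.le e1.le e2.le hh hh'

lemma exists_zero {β δ : ℝ} (hβ : β ∈ Set.Ioo (-1:ℝ) 1) (hδ : δ ∈ Set.Ioc (0:ℝ) 1) {E₀ : ℂ}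
    (hE : 100 ≤ E₀.re) (h0 : (Jl β δ E₀).im = 0 ∨ (Jr β δ E₀).im = 0) {ε : ℝ} (hε : 0 < ε) :
    ∃ (h : ℝ) (E : ℂ), 0 < h ∧ h < ε ∧ dist E E₀ < ε ∧ F β δ h E = 0 := by
  by_contra! hcon
  have gl := good_Jl hβ δ
  have gr := good_Jr hβ δ
  set ρ := min ε 9 / 6 with hρdef
  have hρ : 0 < ρ := by positivity
  have hρ1 : 6 * ρ ≤ ε := by have := min_le_left ε 9; linarith
  have hρ2 : 6 * ρ ≤ 9 := by have := min_le_right ε 9; linarith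
  have hEρ : 90 < E₀.re - ρ := by linarith
  have hEρ6 : 90 < E₀.re - 6 * ρ := by linarith
  set hs : ℕ → ℝ := fun n => ε * (1 / ((n : ℝ) + 1)) / 2 with hsdef
  have hs0 : ∀ n, 0 < hs n := by intro n; simp only [hsdef]; positivity
  have hs1 : ∀ n, hs n < ε := by
    intro n
    have : 1 / ((n : ℝ) + 1) ≤ 1 := by
      rw [div_le_one (by positivity)]; linarith [n.cast_nonneg (α := ℝ)]
    simp only [hsdef]; nlinarith
  have hslim : Tendsto hs atTop (𝓝 0) := by
    have := ((tendsto_one_div_add_atTop_nhds_zero_nat (𝕜 := ℝ)).const_mul ε).div_const 2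
    simpa [hsdef] using this
  have hne : ∀ n, ∀ z ∈ ball E₀ (6 * ρ), F β δ (hs n) z ≠ 0 := by
    intro n z hz
    exact hcon _ z (hs0 n) (hs1 n) ((mem_ball.1 hz).trans_le hρ1)
  have hup : ∀ n, ∀ z ∈ ball E₀ (6 * ρ), hs n * Real.log ‖F β δ (hs n) z‖
      ≤ (|(Jl β δ z).im| + |(Jr β δ z).im|) + hs n * Real.log 2 := by
    intro n z hz
    have h1 := F_upper hβ (δ := δ) (circle_re hEρ6 (ball_subset_closedBall hz)).le (hs0 n)
    have h2 := Real.log_le_log (norm_pos_iff.2 (hne n z hz)) h1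
    rw [Real.log_mul (Real.exp_ne_zero _) two_ne_zero, Real.log_exp] at h2
    have h3 := mul_le_mul_of_nonneg_left h2 (hs0 n).le
    rwa [mul_add, mul_div_cancel₀ _ (hs0 n).ne'] at h3
  have key := pot (φ := fun n z => hs n * Real.log ‖F β δ (hs n) z‖)
    (Φ := fun z => |(Jl β δ z).im| + |(Jr β δ z).im|) (ε := fun n => hs n * Real.log 2)
    (E₀ := E₀) hρ ?_ hup ?_ ?_ ?_
  · exact absurd key (not_le.2 (strict gl gr hρ hEρ h0))
  · intro n z hz
    have ha : AnalyticAt ℂ (F β δ (hs n)) z :=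
      (F_diff (hs0 n) β δ).analyticAt z
    exact (ha.harmonicAt_log_norm (hne n z hz)).const_smul (c := hs n)
  · simpa using hslim.mul_const (Real.log 2)
  · exact (gl.cont hEρ6).add (gr.cont hEρ6)
  · filter_upwards [gl.ae_ne hρ hEρ, gr.ae_ne hρ hEρ] with θ hl hr
    set z := circleMap E₀ ρ θ with hz
    have hzc : z ∈ closedBall E₀ ρ := circleMap_mem_closedBall _ hρ.le θ
    have hzb : z ∈ ball E₀ (6 * ρ) := closedBall_subset_ball (by linarith) hzc
    obtain ⟨c, h0, hc, hh0, hlow⟩ := lower_near hβ hδ (circle_re hEρ hzc) hl hr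
    have hlow := hlow.self_of_nhds
    have l1 : Tendsto (fun n => (|(Jl β δ z).im| + |(Jr β δ z).im|) + hs n * Real.log 2) atTop
        (𝓝 (|(Jl β δ z).im| + |(Jr β δ z).im|)) := by
      simpa using (hslim.mul_const (Real.log 2)).const_add (|(Jl β δ z).im| + |(Jr β δ z).im|)
    have l2 : Tendsto (fun n => (|(Jl β δ z).im| + |(Jr β δ z).im|) + hs n * Real.log c) atTop
        (𝓝 (|(Jl β δ z).im| + |(Jr β δ z).im|)) := by
      simpa using (hslim.mul_const (Real.log c)).const_add (|(Jl β δ z).im| + |(Jr β δ z).im|)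
    refine tendsto_of_tendsto_of_tendsto_of_le_of_le' l2 l1 ?_
      (Eventually.of_forall fun n => hup n z hzb)
    filter_upwards [hslim.eventually (gt_mem_nhds hh0)] with n hn
    have h1 := hlow (hs n) (hs0 n) hn
    have h2 := Real.log_le_log (by positivity) h1
    rw [Real.log_mul (Real.exp_ne_zero _) hc.ne', Real.log_exp] at h2
    have h3 := mul_le_mul_of_nonneg_left h2 (hs0 n).le
    rwa [mul_add, mul_div_cancel₀ _ (hs0 n).ne'] at h3

end WKB

/-- Theorem `reciper` of the paper for the perturbed operator
`P^h_δ = -h²d²/dx² + ix² ∓ iδ` on either side of `β`: for `E₀` large with small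
imaginary part, `E₀` is a limit as `h → 0` of Dirichlet eigenvalues of `P^h_δ` iff
`Im ∫_{-1}^β √(E₀ − ix² + iδ) dx = 0` or `Im ∫_β^1 √(E₀ − ix² − iδ) dx = 0`. -/
theorem stmt15 (β : ℝ) (hβ : β ∈ Set.Ioo (-1:ℝ) 1) (δ : ℝ) (hδ : δ ∈ Set.Ioc (0:ℝ) 1) :
    ∃ R : ℝ, 0 < R ∧
      ∀ E₀ : ℂ, R ≤ E₀.re → |E₀.im| ≤ 1 →
        ((((∫ x in (-1:ℝ)..β,
              (E₀ - Complex.I * (x : ℂ) ^ 2 + Complex.I * δ) ^ (1/2 : ℂ)).im = 0) ∨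
          ((∫ x in β..(1:ℝ),
              (E₀ - Complex.I * (x : ℂ) ^ 2 - Complex.I * δ) ^ (1/2 : ℂ)).im = 0))
        ↔
        (∃ (hseq : ℕ → ℝ) (Eseq : ℕ → ℂ),
          (∀ n, 0 < hseq n) ∧
          Filter.Tendsto hseq Filter.atTop (nhds 0) ∧
          Filter.Tendsto Eseq Filter.atTop (nhds E₀) ∧
          ∀ n, ∃ u u' ul'' ur'' : ℝ → ℂ,
            IsPiecewiseDirichletSol (hseq n) β
              (fun x : ℝ => Complex.I * (x : ℂ) ^ 2 - Complex.I * δ)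
              (fun x : ℝ => Complex.I * (x : ℂ) ^ 2 + Complex.I * δ)
              (Eseq n) u u' ul'' ur'' ∧
            ∃ x ∈ Set.Icc (-1:ℝ) 1, u x ≠ 0)) := by
  refine ⟨100, by norm_num, fun E₀ hE _ => ?_⟩
  have e1 : (∫ x in (-1:ℝ)..β, (E₀ - Complex.I * (x : ℂ) ^ 2 + Complex.I * δ) ^ (1/2 : ℂ))
      = WKB.Jl β δ E₀ := by
    unfold WKB.Jl WKB.sq
    congr 1; funext x; congr 1; ring
  have e2 : (∫ x in β..(1:ℝ), (E₀ - Complex.I * (x : ℂ) ^ 2 - Complex.I * δ) ^ (1/2 : ℂ))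
      = WKB.Jr β δ E₀ := by
    unfold WKB.Jr WKB.sq
    congr 1; funext x; congr 1; ring
  rw [e1, e2]
  constructor
  · intro h0
    have hz : ∀ n : ℕ, ∃ (h : ℝ) (E : ℂ), 0 < h ∧ h < 1 / ((n : ℝ) + 1) ∧
        dist E E₀ < 1 / ((n : ℝ) + 1) ∧ WKB.F β δ h E = 0 :=
      fun n => WKB.exists_zero hβ hδ hE h0 (by positivity)
    choose hs Es hpos hlt hd hF using hz
    refine ⟨hs, Es, hpos, ?_, ?_, fun n => WKB.eig_of_F hβ (hpos n) (hF n)⟩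
    · exact squeeze_zero (fun n => (hpos n).le) (fun n => (hlt n).le)
        tendsto_one_div_add_atTop_nhds_zero_nat
    · rw [tendsto_iff_dist_tendsto_zero]
      exact squeeze_zero (fun n => dist_nonneg) (fun n => (hd n).le)
        tendsto_one_div_add_atTop_nhds_zero_nat
  · rintro ⟨hs, Es, hpos, hlim, hElim, hsol⟩
    by_contra! hcon
    obtain ⟨c, h0, hc, hh0, hlow⟩ := WKB.lower_near hβ hδ (by linarith) hcon.1 hcon.2
    obtain ⟨n, h1, h2⟩ := ((hElim.eventually hlow).and (hlim.eventually (gt_mem_nhds hh0))).exists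
    obtain ⟨u, u', ul, ur, hu, hne⟩ := hsol n
    have h3 := h1 (hs n) (hpos n) h2
    rw [WKB.F_of_eig hβ (hpos n) hu hne, norm_zero] at h3
    exact absurd h3 (not_le.2 (by positivity))
end
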